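/- arXiv:1809.07918 — 2 statements merged into one kernel-verified Lean document; each statement's English description precedes it below -/
import Mathlib

section
/- Let Ω be a properly convex quasi-homogeneous affine domain in ℝⁿ with n ≥ 1. Then the identity component Aut⁰(Ω) of Aut(Ω) is noncompact. -/
open Matrix Set Filter Topology Pointwise

noncomputable section

/-- The affine action on ℝⁿ of an (n+1)×(n+1) invertible matrix in affine form
(ℝⁿ is identified with the hyperplane x_{n+1} = 1). -/
def affAct (n : ℕ) (g : GL (Fin (n + 1)) ℝ) (x : Fin n → ℝ) : Fin n → ℝ :=
  fun i => (∑ j : Fin n, g.val i.castSucc j.castSucc * x j) + g.val i.castSucc (Fin.last n)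

/-- A matrix in GL(n+1,ℝ) has affine form if its last row is (0, …, 0, 1). -/
def IsAffineForm (n : ℕ) (g : GL (Fin (n + 1)) ℝ) : Prop :=
  (∀ j : Fin n, g.val (Fin.last n) j.castSucc = 0) ∧ g.val (Fin.last n) (Fin.last n) = 1

/-- Aut(Ω): the group (here: set) of affine transformations of ℝⁿ preserving Ω,
realized as affine-form matrices in GL(n+1,ℝ). -/
def AutSet (n : ℕ) (Ω : Set (Fin n → ℝ)) : Set (GL (Fin (n + 1)) ℝ) :=
  {g | IsAffineForm n g ∧ affAct n g '' Ω = Ω}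

/-- Aut⁰(Ω): the identity component of Aut(Ω). -/
def AutIdComp (n : ℕ) (Ω : Set (Fin n → ℝ)) : Set (GL (Fin (n + 1)) ℝ) :=
  connectedComponentIn (AutSet n Ω) 1

/-- The limit set Λ_G of a subset G of Aut(Ω). -/
def limitSet (n : ℕ) (Ω : Set (Fin n → ℝ)) (G : Set (GL (Fin (n + 1)) ℝ)) :
    Set (Fin n → ℝ) :=
  {ξ | ξ ∈ frontier Ω ∧ ∃ x ∈ Ω, ∃ u : ℕ → GL (Fin (n + 1)) ℝ,
    (∀ k, u k ∈ G) ∧ Filter.Tendsto (fun k => affAct n (u k) x) Filter.atTop (nhds ξ)}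

/-- Ω is a convex affine domain: a nonempty open convex subset of ℝⁿ. -/
def IsConvexDomain (n : ℕ) (Ω : Set (Fin n → ℝ)) : Prop :=
  Ω.Nonempty ∧ IsOpen Ω ∧ Convex ℝ Ω

/-- Ω contains no complete affine line. -/
def HasNoLine (n : ℕ) (Ω : Set (Fin n → ℝ)) : Prop :=
  ¬ ∃ x ∈ Ω, ∃ v : Fin n → ℝ, v ≠ 0 ∧ ∀ t : ℝ, x + t • v ∈ Ω

/-- Ω is a properly convex affine domain. -/
def IsProperlyConvexDomain (n : ℕ) (Ω : Set (Fin n → ℝ)) : Prop :=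
  IsConvexDomain n Ω ∧ HasNoLine n Ω

/-- Ω is quasi-homogeneous: some compact K ⊆ Ω has ⋃_{g ∈ Aut(Ω)} g(K) = Ω. -/
def IsQuasiHomogeneous (n : ℕ) (Ω : Set (Fin n → ℝ)) : Prop :=
  ∃ K : Set (Fin n → ℝ), IsCompact K ∧ K ⊆ Ω ∧
    (⋃ g ∈ AutSet n Ω, affAct n g '' K) = Ω

/-- Aut(Ω) is irreducible: it preserves no nonempty proper affine subspace of ℝⁿ. -/
def IsIrreducibleAut (n : ℕ) (Ω : Set (Fin n → ℝ)) : Prop :=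
  ¬ ∃ S : AffineSubspace ℝ (Fin n → ℝ), (S : Set (Fin n → ℝ)).Nonempty ∧
      (S : Set (Fin n → ℝ)) ≠ Set.univ ∧
      ∀ g ∈ AutSet n Ω, affAct n g '' (S : Set (Fin n → ℝ)) = (S : Set (Fin n → ℝ))

/-- The asymptotic cone AC(Ω). -/
def asympCone (n : ℕ) (Ω : Set (Fin n → ℝ)) : Set (Fin n → ℝ) :=
  {u | ∀ x ∈ Ω, ∀ t : ℝ, 0 ≤ t → x + t • u ∈ Ω}

/-- Ω is a cone with some vertex v. -/
def IsCone (n : ℕ) (Ω : Set (Fin n → ℝ)) : Prop :=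
  ∃ v : Fin n → ℝ, ∀ x ∈ Ω, ∀ t : ℝ, 0 < t → v + t • (x - v) ∈ Ω

/-- Two subsets of ℝⁿ are affinely equivalent. -/
def AffinelyEquivalent (n : ℕ) (Ω Ω' : Set (Fin n → ℝ)) : Prop :=
  ∃ e : (Fin n → ℝ) ≃ᵃ[ℝ] (Fin n → ℝ), e '' Ω = Ω'

/-- Γ acts freely on Ω. -/
def ActsFreely (n : ℕ) (Ω : Set (Fin n → ℝ)) (Γ : Set (GL (Fin (n + 1)) ℝ)) : Prop :=
  ∀ γ ∈ Γ, γ ≠ 1 → ∀ x ∈ Ω, affAct n γ x ≠ x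

/-- Γ acts properly discontinuously on Ω. -/
def ActsProperlyDiscontinuously (n : ℕ) (Ω : Set (Fin n → ℝ))
    (Γ : Set (GL (Fin (n + 1)) ℝ)) : Prop :=
  ∀ K L : Set (Fin n → ℝ), K ⊆ Ω → L ⊆ Ω → IsCompact K → IsCompact L →
    {γ ∈ Γ | (affAct n γ '' K ∩ L).Nonempty}.Finite

/-- Γ acts cocompactly on Ω. -/
def ActsCocompactly (n : ℕ) (Ω : Set (Fin n → ℝ)) (Γ : Set (GL (Fin (n + 1)) ℝ)) : Prop :=
  ∃ K : Set (Fin n → ℝ), IsCompact K ∧ K ⊆ Ω ∧ (⋃ γ ∈ Γ, affAct n γ '' K) = Ω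

/-- The linear part of an affine-form matrix has determinant one. -/
def LinearPartDetOne (n : ℕ) (g : GL (Fin (n + 1)) ℝ) : Prop :=
  (Matrix.of fun i j : Fin n => g.val i.castSucc j.castSucc).det = 1

/-- The linear part of an affine-form matrix. -/
def linPart (n : ℕ) (g : GL (Fin (n + 1)) ℝ) : Matrix (Fin n) (Fin n) ℝ :=
  Matrix.of fun i j => g.val i.castSucc j.castSucc

theorem affAct_eq (n : ℕ) (g : GL (Fin (n + 1)) ℝ) (x : Fin n → ℝ) :
    affAct n g x = linPart n g *ᵥ x + affAct n g 0 := by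
  ext i
  simp [affAct, linPart, Matrix.mulVec, dotProduct]

theorem affAct_zero_apply (n : ℕ) (g : GL (Fin (n + 1)) ℝ) (i : Fin n) :
    affAct n g 0 i = g.val i.castSucc (Fin.last n) := by
  simp [affAct]

theorem affAct_sub (n : ℕ) (g : GL (Fin (n + 1)) ℝ) (x y : Fin n → ℝ) :
    affAct n g x - affAct n g y = linPart n g *ᵥ (x - y) := by
  rw [affAct_eq n g x, affAct_eq n g y, Matrix.mulVec_sub]
  abel

theorem continuous_affAct (n : ℕ) (g : GL (Fin (n + 1)) ℝ) : Continuous (affAct n g) := by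
  unfold affAct
  fun_prop

theorem isAffineForm_one (n : ℕ) : IsAffineForm n 1 := by
  refine ⟨fun j => ?_, ?_⟩
  · simp [(Fin.castSucc_lt_last j).ne']
  · simp

theorem isAffineForm_iff (n : ℕ) (g : GL (Fin (n + 1)) ℝ) :
    IsAffineForm n g ↔
      (Pi.single (Fin.last n) 1 : Fin (n + 1) → ℝ) ᵥ* g.val = Pi.single (Fin.last n) 1 := by
  rw [Matrix.single_one_vecMul]
  constructor
  · rintro ⟨h, h'⟩
    ext j
    refine Fin.lastCases ?_ (fun j => ?_) j
    · simpa using h'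
    · simpa [(Fin.castSucc_lt_last j).ne] using h j
  · intro h
    refine ⟨fun j => ?_, ?_⟩
    · simpa [(Fin.castSucc_lt_last j).ne] using congrFun h j.castSucc
    · simpa using congrFun h (Fin.last n)

theorem IsAffineForm.mul {n : ℕ} {g h : GL (Fin (n + 1)) ℝ} (hg : IsAffineForm n g)
    (hh : IsAffineForm n h) : IsAffineForm n (g * h) := by
  rw [isAffineForm_iff] at *
  rw [Units.val_mul, ← Matrix.vecMul_vecMul, hg, hh]

theorem IsAffineForm.inv {n : ℕ} {g : GL (Fin (n + 1)) ℝ} (hg : IsAffineForm n g) :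
    IsAffineForm n g⁻¹ := by
  rw [isAffineForm_iff] at *
  conv_lhs => rw [← hg]
  rw [Matrix.vecMul_vecMul, ← Units.val_mul]
  simp

theorem affAct_one (n : ℕ) (x : Fin n → ℝ) : affAct n 1 x = x := by
  ext i
  simp [affAct, Matrix.one_apply, (Fin.castSucc_lt_last i).ne]

theorem affAct_mul {n : ℕ} (g : GL (Fin (n + 1)) ℝ) {h : GL (Fin (n + 1)) ℝ}
    (hh : IsAffineForm n h) (x : Fin n → ℝ) :
    affAct n (g * h) x = affAct n g (affAct n h x) := by
  have key : ∀ (k : GL (Fin (n + 1)) ℝ) (y : Fin n → ℝ) (i : Fin n),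
      affAct n k y i = (k.val *ᵥ (Fin.snoc y 1 : Fin (n + 1) → ℝ)) i.castSucc := by
    intro k y i
    simp [affAct, Matrix.mulVec, dotProduct, Fin.sum_univ_castSucc]
  have hsn : h.val *ᵥ (Fin.snoc x 1 : Fin (n + 1) → ℝ) = Fin.snoc (affAct n h x) 1 := by
    ext i
    refine Fin.lastCases ?_ (fun j => ?_) i
    · simp [Matrix.mulVec, dotProduct, Fin.sum_univ_castSucc, hh.1, hh.2]
    · rw [← key]
      simp
  ext i
  rw [key, key, Units.val_mul, ← Matrix.mulVec_mulVec, hsn]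

theorem linPart_one (n : ℕ) : linPart n 1 = 1 := by
  ext i j
  simp [linPart, Matrix.one_apply]

theorem linPart_mul {n : ℕ} (g : GL (Fin (n + 1)) ℝ) {h : GL (Fin (n + 1)) ℝ}
    (hh : IsAffineForm n h) : linPart n (g * h) = linPart n g * linPart n h := by
  refine Matrix.ext_of_mulVec_single fun j => ?_
  have := affAct_sub n (g * h) (Pi.single j 1) 0
  rw [affAct_mul g hh, affAct_mul g hh, affAct_sub, affAct_sub, Matrix.mulVec_mulVec] at this
  simpa using this.symm

theorem affAct_inv_apply {n : ℕ} {g : GL (Fin (n + 1)) ℝ} (hg : IsAffineForm n g)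
    (x : Fin n → ℝ) : affAct n g⁻¹ (affAct n g x) = x := by
  rw [← affAct_mul _ hg, inv_mul_cancel, affAct_one]

theorem affAct_apply_inv {n : ℕ} {g : GL (Fin (n + 1)) ℝ} (hg : IsAffineForm n g)
    (x : Fin n → ℝ) : affAct n g (affAct n g⁻¹ x) = x := by
  rw [← affAct_mul _ hg.inv, mul_inv_cancel, affAct_one]

theorem mem_autSet_iff {n : ℕ} {Ω : Set (Fin n → ℝ)} {g : GL (Fin (n + 1)) ℝ} :
    g ∈ AutSet n Ω ↔
      IsAffineForm n g ∧ (∀ x ∈ Ω, affAct n g x ∈ Ω) ∧ ∀ x ∈ Ω, affAct n g⁻¹ x ∈ Ω := by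
  constructor
  · rintro ⟨hg, h⟩
    refine ⟨hg, fun x hx => h ▸ mem_image_of_mem _ hx, fun x hx => ?_⟩
    rw [← h] at hx
    obtain ⟨y, hy, rfl⟩ := hx
    rwa [affAct_inv_apply hg]
  · rintro ⟨hg, h, h'⟩
    refine ⟨hg, Subset.antisymm (image_subset_iff.2 h) fun x hx => ⟨_, h' x hx, ?_⟩⟩
    exact affAct_apply_inv hg x

/-- The automorphism group of `Ω` as a subgroup of `GL(n+1,ℝ)`. -/
def autGroup (n : ℕ) (Ω : Set (Fin n → ℝ)) : Subgroup (GL (Fin (n + 1)) ℝ) where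
  carrier := AutSet n Ω
  one_mem' := mem_autSet_iff.2 ⟨isAffineForm_one n, by simp [affAct_one]⟩
  mul_mem' {g h} hg hh := by
    rw [mem_autSet_iff] at *
    refine ⟨hg.1.mul hh.1, fun x hx => ?_, fun x hx => ?_⟩
    · rw [affAct_mul _ hh.1]
      exact hg.2.1 _ (hh.2.1 _ hx)
    · rw [_root_.mul_inv_rev, affAct_mul _ hg.1.inv]
      exact hh.2.2 _ (hg.2.2 _ hx)
  inv_mem' {g} hg := by
    rw [mem_autSet_iff] at *
    refine ⟨hg.1.inv, hg.2.2, by simpa using hg.2.1⟩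

theorem autGroup_affine {n : ℕ} {Ω : Set (Fin n → ℝ)} (g : autGroup n Ω) :
    IsAffineForm n g.1 := (mem_autSet_iff.1 g.2).1

theorem autGroup_map {n : ℕ} {Ω : Set (Fin n → ℝ)} (g : autGroup n Ω) {x : Fin n → ℝ}
    (hx : x ∈ Ω) : affAct n g.1 x ∈ Ω := (mem_autSet_iff.1 g.2).2.1 x hx

/-- The action of `Aut(Ω)` on linear functionals, with respect to the dot product. -/
def dualRep (n : ℕ) (Ω : Set (Fin n → ℝ)) : autGroup n Ω →* Matrix (Fin n) (Fin n) ℝ where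
  toFun g := (linPart n (g⁻¹).1)ᵀ
  map_one' := by simp [linPart_one]
  map_mul' g h := by
    rw [_root_.mul_inv_rev, Subgroup.coe_mul, linPart_mul _ (autGroup_affine _), Matrix.transpose_mul]

theorem dualRep_dotProduct {n : ℕ} {Ω : Set (Fin n → ℝ)} (g : autGroup n Ω) (ξ x : Fin n → ℝ) :
    (dualRep n Ω g *ᵥ ξ) ⬝ᵥ x = ξ ⬝ᵥ (linPart n (g⁻¹).1 *ᵥ x) := by
  change (linPart n (g⁻¹).1)ᵀ *ᵥ ξ ⬝ᵥ x = _
  rw [Matrix.mulVec_transpose, Matrix.dotProduct_mulVec]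

theorem dualRep_dotProduct_sub {n : ℕ} {Ω : Set (Fin n → ℝ)} (g : autGroup n Ω)
    (ξ x y : Fin n → ℝ) :
    (dualRep n Ω g *ᵥ ξ) ⬝ᵥ (affAct n g.1 x - affAct n g.1 y) = ξ ⬝ᵥ (x - y) := by
  rw [dualRep_dotProduct, ← affAct_sub, Subgroup.coe_inv, affAct_inv_apply (autGroup_affine g),
    affAct_inv_apply (autGroup_affine g)]

theorem continuous_linPart (n : ℕ) : Continuous (linPart n) := by
  unfold linPart
  have : Continuous fun g : GL (Fin (n + 1)) ℝ => g.val := Units.continuous_val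
  refine continuous_matrix fun i j => ?_
  exact this.matrix_elem _ _

theorem continuous_dualRep (n : ℕ) (Ω : Set (Fin n → ℝ)) : Continuous (dualRep n Ω) := by
  change Continuous fun g : autGroup n Ω => (linPart n (g⁻¹).1)ᵀ
  exact ((continuous_linPart n).comp (continuous_subtype_val.comp continuous_inv)).matrix_transpose

theorem continuous_affAct_left (n : ℕ) (x : Fin n → ℝ) : Continuous fun g => affAct n g x := by
  have : Continuous fun g : GL (Fin (n + 1)) ℝ => g.val := Units.continuous_val
  refine continuous_pi fun i => ?_
  refine (continuous_finsetSum _ fun j _ => ?_).add (this.matrix_elem _ _)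
  exact (this.matrix_elem _ _).mul continuous_const

theorem det_dualRep {n : ℕ} {Ω : Set (Fin n → ℝ)} (g : autGroup n Ω) :
    (dualRep n Ω g).det * (linPart n g.1).det = 1 := by
  change (linPart n (g⁻¹).1)ᵀ.det * _ = 1
  rw [Matrix.det_transpose, ← Matrix.det_mul, ← linPart_mul _ (autGroup_affine g),
    ← Subgroup.coe_mul, inv_mul_cancel, Subgroup.coe_one, linPart_one, Matrix.det_one]

theorem isClosed_autSet {n : ℕ} {Ω : Set (Fin n → ℝ)} (ho : IsOpen Ω) (hc : Convex ℝ Ω) :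
    IsClosed (AutSet n Ω) := by
  have hval : Continuous fun g : GL (Fin (n + 1)) ℝ => g.val := Units.continuous_val
  have h_int : interior (closure Ω) = Ω := by
    rcases Ω.eq_empty_or_nonempty with rfl | hne
    · simp
    rw [hc.interior_closure_eq_interior_of_nonempty_interior (by rwa [ho.interior_eq]),
      ho.interior_eq]
  have himg : ∀ g : GL (Fin (n + 1)) ℝ, IsAffineForm n g → (∀ x ∈ Ω, affAct n g x ∈ closure Ω) →
      ∀ x ∈ Ω, affAct n g x ∈ Ω := by
    intro g hg h x hx
    have hopen : IsOpen (affAct n g⁻¹ ⁻¹' Ω) := ho.preimage (continuous_affAct n _)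
    have hsub : affAct n g⁻¹ ⁻¹' Ω ⊆ closure Ω := fun y hy => by
      simpa [affAct_apply_inv hg] using h _ hy
    rw [← h_int]
    refine interior_maximal hsub hopen ?_
    simpa [affAct_inv_apply hg] using hx
  have heq : AutSet n Ω = {g | IsAffineForm n g} ∩ ((⋂ x ∈ Ω, {g | affAct n g x ∈ closure Ω}) ∩
      ⋂ x ∈ Ω, {g | affAct n g⁻¹ x ∈ closure Ω}) := by
    ext g
    simp only [mem_autSet_iff, mem_inter_iff, mem_ofPred_eq, mem_iInter]
    constructor
    · rintro ⟨h, h', h''⟩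
      exact ⟨h, fun x hx => subset_closure (h' x hx), fun x hx => subset_closure (h'' x hx)⟩
    · rintro ⟨h, h', h''⟩
      exact ⟨h, himg g h h', himg _ h.inv h''⟩
  rw [heq]
  refine IsClosed.inter ?_ (IsClosed.inter ?_ ?_)
  · simp only [IsAffineForm, ofPred_and, ofPred_forall]
    refine (isClosed_iInter fun j => ?_).inter ?_
    · exact isClosed_eq (hval.matrix_elem _ _) continuous_const
    · exact isClosed_eq (hval.matrix_elem _ _) continuous_const
  · exact isClosed_biInter fun x _ => isClosed_closure.preimage (continuous_affAct_left n x)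
  · exact isClosed_biInter fun x _ => isClosed_closure.preimage
      ((continuous_affAct_left n x).comp continuous_inv)

theorem abs_dotProduct_le {n : ℕ} (ξ y : Fin n → ℝ) : |ξ ⬝ᵥ y| ≤ n * ‖ξ‖ * ‖y‖ := by
  calc |ξ ⬝ᵥ y| ≤ ∑ i, |ξ i * y i| := Finset.abs_sum_le_sum_abs _ _
    _ ≤ ∑ _i : Fin n, ‖ξ‖ * ‖y‖ := by
        refine Finset.sum_le_sum fun i _ => ?_
        rw [abs_mul]
        exact mul_le_mul (norm_le_pi_norm ξ i) (norm_le_pi_norm y i) (abs_nonneg _) (norm_nonneg _)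
    _ = n * ‖ξ‖ * ‖y‖ := by simp [mul_assoc]

/-- The functionals growing at least linearly on `Ω`. -/
def coerciveDual {n : ℕ} (Ω : Set (Fin n → ℝ)) : Set (Fin n → ℝ) :=
  {ξ | ∃ ε > 0, ∃ C : ℝ, ∀ y ∈ Ω, ε * ‖y‖ - C ≤ ξ ⬝ᵥ y}

/-- The functionals of norm at most `r` with prescribed linear growth on `Ω`. -/
def coerciveSet {n : ℕ} (Ω : Set (Fin n → ℝ)) (ε C r : ℝ) : Set (Fin n → ℝ) :=
  {ξ | ‖ξ‖ ≤ r ∧ ∀ y ∈ Ω, ε * ‖y‖ - C ≤ ξ ⬝ᵥ y}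

/-- The points of `Ω` at which `ξ` exceeds its infimum by at most `t`. -/
def cap {n : ℕ} (Ω : Set (Fin n → ℝ)) (t : ℝ) (ξ : Fin n → ℝ) : Set (Fin n → ℝ) :=
  {x | x ∈ Ω ∧ ∀ y ∈ Ω, ξ ⬝ᵥ x ≤ ξ ⬝ᵥ y + t}

theorem coerciveSet_subset {n : ℕ} {Ω : Set (Fin n → ℝ)} {ε C r : ℝ} (hε : 0 < ε) :
    coerciveSet Ω ε C r ⊆ coerciveDual Ω := fun _ h => ⟨ε, hε, C, h.2⟩

theorem isClosed_coerciveSet {n : ℕ} (Ω : Set (Fin n → ℝ)) (ε C r : ℝ) :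
    IsClosed (coerciveSet Ω ε C r) := by
  have : coerciveSet Ω ε C r = {ξ | ‖ξ‖ ≤ r} ∩ ⋂ y ∈ Ω, {ξ | ε * ‖y‖ - C ≤ ξ ⬝ᵥ y} := by
    ext; simp [coerciveSet]
  rw [this]
  refine (isClosed_le continuous_norm continuous_const).inter (isClosed_biInter fun y _ => ?_)
  exact isClosed_le continuous_const (by fun_prop)

theorem isOpen_coerciveDual {n : ℕ} (Ω : Set (Fin n → ℝ)) : IsOpen (coerciveDual Ω) := by
  rw [Metric.isOpen_iff]
  rintro ξ ⟨ε, hε, C, h⟩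
  refine ⟨ε / (2 * (n + 1)), by positivity, fun η hη => ⟨ε / 2, by positivity, C, fun y hy => ?_⟩⟩
  rw [Metric.mem_ball, dist_eq_norm] at hη
  have h1 := abs_dotProduct_le (η - ξ) y
  have h2 : (n : ℝ) * ‖η - ξ‖ ≤ ε / 2 := by
    calc (n : ℝ) * ‖η - ξ‖ ≤ (n + 1) * (ε / (2 * (n + 1))) := by gcongr; simp
      _ = ε / 2 := by field_simp
  have h3 := mul_le_mul_of_nonneg_right h2 (norm_nonneg y)
  have h4 := (abs_le.1 h1).1
  rw [sub_dotProduct] at h4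
  linarith [h y hy]

theorem smul_mem_coerciveDual {n : ℕ} {Ω : Set (Fin n → ℝ)} {ξ : Fin n → ℝ}
    (h : ξ ∈ coerciveDual Ω) {t : ℝ} (ht : 0 < t) : t • ξ ∈ coerciveDual Ω := by
  obtain ⟨ε, hε, C, h⟩ := h
  refine ⟨t * ε, by positivity, t * C, fun y hy => ?_⟩
  have := mul_le_mul_of_nonneg_left (h y hy) ht.le
  rw [smul_dotProduct, smul_eq_mul]
  linarith

theorem smul_mem_coerciveDual_iff {n : ℕ} {Ω : Set (Fin n → ℝ)} {ξ : Fin n → ℝ} {t : ℝ}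
    (ht : 0 < t) : t • ξ ∈ coerciveDual Ω ↔ ξ ∈ coerciveDual Ω := by
  refine ⟨fun h => ?_, fun h => smul_mem_coerciveDual h ht⟩
  simpa [smul_smul, inv_mul_cancel₀ ht.ne'] using smul_mem_coerciveDual h (inv_pos.2 ht)

/-- A bound on the size of an affine map. -/
def AffBound (n : ℕ) (M : ℝ) (g : GL (Fin (n + 1)) ℝ) : Prop :=
  ∀ x, ‖affAct n g x‖ ≤ M * (‖x‖ + 1)

theorem exists_affBound (n : ℕ) (g : GL (Fin (n + 1)) ℝ) : ∃ M, AffBound n M g := by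
  let L : (Fin n → ℝ) →L[ℝ] (Fin n → ℝ) := LinearMap.toContinuousLinearMap (linPart n g).mulVecLin
  refine ⟨‖L‖ + ‖affAct n g 0‖, fun x => ?_⟩
  rw [affAct_eq]
  have h1 : ‖linPart n g *ᵥ x‖ ≤ ‖L‖ * ‖x‖ := L.le_opNorm x
  have h2 := norm_add_le (linPart n g *ᵥ x) (affAct n g 0)
  nlinarith [norm_nonneg L, norm_nonneg x, norm_nonneg (affAct n g 0),
    mul_nonneg (norm_nonneg (affAct n g 0)) (norm_nonneg x)]

theorem dualRep_mem_coerciveSet {n : ℕ} (Ω : Set (Fin n → ℝ)) {M ε C r : ℝ} (hε : 0 < ε) :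
    ∃ ε' > 0, ∃ C' r' : ℝ, ∀ g : autGroup n Ω, AffBound n M g.1 → AffBound n M (g⁻¹).1 →
      ∀ ξ ∈ coerciveSet Ω ε C r, dualRep n Ω g *ᵥ ξ ∈ coerciveSet Ω ε' C' r' := by
  refine ⟨ε / (|M| + 1), by positivity, ε + C + n * r * |M|, n * r * (3 * |M|),
    fun g hg hg' ξ hξ => ⟨?_, fun y hy => ?_⟩⟩
  · have hr : 0 ≤ r := (norm_nonneg _).trans hξ.1
    rw [pi_norm_le_iff_of_nonneg (by positivity)]
    intro i
    have h1 := dualRep_dotProduct g ξ (Pi.single i 1)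
    rw [dotProduct_single_one] at h1
    rw [h1, Real.norm_eq_abs]
    refine (abs_dotProduct_le _ _).trans ?_
    have h2 := affAct_sub n (g⁻¹).1 (Pi.single i 1) 0
    rw [sub_zero] at h2
    have h3 : ‖linPart n (g⁻¹).1 *ᵥ Pi.single i 1‖ ≤ 3 * |M| := by
      rw [← h2]
      refine (norm_sub_le _ _).trans ?_
      have h4 := hg' (Pi.single i 1)
      have h5 := hg' 0
      have h6 : ‖(Pi.single i 1 : Fin n → ℝ)‖ = 1 := by
        rw [Pi.norm_single, norm_one]
      rw [h6] at h4
      rw [norm_zero] at h5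
      linarith [le_abs_self M]
    exact mul_le_mul (mul_le_mul_of_nonneg_left hξ.1 (by positivity)) h3 (norm_nonneg _)
      (by positivity)
  · have hr : 0 ≤ r := (norm_nonneg _).trans hξ.1
    set x := affAct n (g⁻¹).1 y with hx
    have hxΩ : x ∈ Ω := autGroup_map _ hy
    have h1 : (dualRep n Ω g *ᵥ ξ) ⬝ᵥ y = ξ ⬝ᵥ x - ξ ⬝ᵥ affAct n (g⁻¹).1 0 := by
      rw [dualRep_dotProduct, ← dotProduct_sub, affAct_sub, sub_zero]
    have h2 := hξ.2 x hxΩ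
    have h3 : y = affAct n g.1 x := by
      rw [hx, Subgroup.coe_inv, affAct_apply_inv (autGroup_affine g)]
    have h4 : ‖y‖ ≤ (|M| + 1) * (‖x‖ + 1) := by
      rw [h3]
      refine (hg x).trans ?_
      gcongr
      linarith [le_abs_self M]
    have h5 : ε / (|M| + 1) * ‖y‖ ≤ ε * (‖x‖ + 1) := by
      rw [div_mul_eq_mul_div, div_le_iff₀ (by positivity)]
      nlinarith
    have h6 : ξ ⬝ᵥ affAct n (g⁻¹).1 0 ≤ n * r * |M| := by
      refine (le_abs_self _).trans ((abs_dotProduct_le _ _).trans ?_)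
      have := hg' 0
      rw [norm_zero] at this
      exact mul_le_mul (mul_le_mul_of_nonneg_left hξ.1 (by positivity))
        (by linarith [le_abs_self M]) (norm_nonneg _) (by positivity)
    rw [h1]
    linarith

theorem mem_coerciveSet_of_mem_coerciveDual {n : ℕ} {Ω : Set (Fin n → ℝ)} {ξ : Fin n → ℝ}
    (h : ξ ∈ coerciveDual Ω) : ∃ ε > 0, ∃ C r : ℝ, ξ ∈ coerciveSet Ω ε C r := by
  obtain ⟨ε, hε, C, h⟩ := h
  exact ⟨ε, hε, C, ‖ξ‖, le_rfl, h⟩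

theorem dualRep_mem_coerciveDual {n : ℕ} {Ω : Set (Fin n → ℝ)} (g : autGroup n Ω)
    {ξ : Fin n → ℝ} (h : ξ ∈ coerciveDual Ω) : dualRep n Ω g *ᵥ ξ ∈ coerciveDual Ω := by
  obtain ⟨ε, hε, C, r, h⟩ := mem_coerciveSet_of_mem_coerciveDual h
  obtain ⟨M, hM⟩ := exists_affBound n g.1
  obtain ⟨M', hM'⟩ := exists_affBound n (g⁻¹).1
  obtain ⟨ε', hε', C', r', h'⟩ := dualRep_mem_coerciveSet (M := max M M') (C := C) (r := r) Ω hε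
  refine coerciveSet_subset hε' (h' g (fun x => (hM x).trans ?_) (fun x => (hM' x).trans ?_) ξ h)
  · gcongr
    exact le_max_left _ _
  · gcongr
    exact le_max_right _ _

theorem dualRep_inv_mulVec {n : ℕ} {Ω : Set (Fin n → ℝ)} (g : autGroup n Ω) (ξ : Fin n → ℝ) :
    dualRep n Ω g⁻¹ *ᵥ (dualRep n Ω g *ᵥ ξ) = ξ := by
  rw [Matrix.mulVec_mulVec, ← map_mul, inv_mul_cancel, map_one, Matrix.one_mulVec]

theorem dualRep_mem_coerciveDual_iff {n : ℕ} {Ω : Set (Fin n → ℝ)} (g : autGroup n Ω)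
    {ξ : Fin n → ℝ} : dualRep n Ω g *ᵥ ξ ∈ coerciveDual Ω ↔ ξ ∈ coerciveDual Ω := by
  refine ⟨fun h => ?_, dualRep_mem_coerciveDual g⟩
  rw [← dualRep_inv_mulVec g ξ]
  exact dualRep_mem_coerciveDual _ h

theorem affAct_mem_cap {n : ℕ} {Ω : Set (Fin n → ℝ)} (g : autGroup n Ω) {ξ : Fin n → ℝ} {t : ℝ}
    {x : Fin n → ℝ} (hx : x ∈ cap Ω t ξ) : affAct n g.1 x ∈ cap Ω t (dualRep n Ω g *ᵥ ξ) := by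
  refine ⟨autGroup_map g hx.1, fun y hy => ?_⟩
  have h1 := hx.2 _ (autGroup_map g⁻¹ hy)
  have h2 := dualRep_dotProduct_sub g ξ x (affAct n (g⁻¹).1 y)
  rw [Subgroup.coe_inv, affAct_apply_inv (autGroup_affine g), dotProduct_sub, dotProduct_sub] at h2
  rw [Subgroup.coe_inv] at h1
  linarith

theorem affAct_image_cap {n : ℕ} {Ω : Set (Fin n → ℝ)} (g : autGroup n Ω) (ξ : Fin n → ℝ)
    (t : ℝ) : affAct n g.1 '' cap Ω t ξ = cap Ω t (dualRep n Ω g *ᵥ ξ) := by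
  refine Subset.antisymm (image_subset_iff.2 fun x hx => affAct_mem_cap g hx) fun x hx => ?_
  refine ⟨affAct n (g⁻¹).1 x, ?_, ?_⟩
  · have h := affAct_mem_cap g⁻¹ hx
    rwa [dualRep_inv_mulVec] at h
  · rw [Subgroup.coe_inv, affAct_apply_inv (autGroup_affine g)]

theorem exists_near_min {n : ℕ} {Ω : Set (Fin n → ℝ)} (hne : Ω.Nonempty) {ξ : Fin n → ℝ} {C : ℝ}
    (h : ∀ y ∈ Ω, C ≤ ξ ⬝ᵥ y) {δ : ℝ} (hδ : 0 < δ) : ∃ x ∈ Ω, ∀ y ∈ Ω, ξ ⬝ᵥ x ≤ ξ ⬝ᵥ y + δ := by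
  have hb : BddBelow ((fun y => ξ ⬝ᵥ y) '' Ω) := ⟨C, by rintro _ ⟨y, hy, rfl⟩; exact h y hy⟩
  obtain ⟨_, ⟨x, hx, rfl⟩, hlt⟩ := exists_lt_of_csInf_lt (hne.image fun y => ξ ⬝ᵥ y) (lt_add_of_pos_right _ hδ)
  refine ⟨x, hx, fun y hy => ?_⟩
  have h1 : ξ ⬝ᵥ x < _ := hlt
  have h2 := csInf_le hb (mem_image_of_mem _ hy)
  linarith

theorem cap_nonempty {n : ℕ} {Ω : Set (Fin n → ℝ)} (hne : Ω.Nonempty) {ξ : Fin n → ℝ}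
    (h : ξ ∈ coerciveDual Ω) {t : ℝ} (ht : 0 < t) : (cap Ω t ξ).Nonempty := by
  obtain ⟨ε, hε, C, h⟩ := h
  obtain ⟨x, hx, hx'⟩ := exists_near_min hne (C := -C)
    (fun y hy => by linarith [h y hy, mul_nonneg hε.le (norm_nonneg y)]) ht
  exact ⟨x, hx, hx'⟩

theorem cap_subset_closedBall {n : ℕ} {Ω : Set (Fin n → ℝ)} (hne : Ω.Nonempty) {ε : ℝ}
    (hε : 0 < ε) (C r t : ℝ) :
    ∃ R, 0 ≤ R ∧ ∀ ξ ∈ coerciveSet Ω ε C r, ∀ x ∈ cap Ω t ξ, ‖x‖ ≤ R := by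
  obtain ⟨x₀, hx₀⟩ := hne
  refine ⟨|n * r * ‖x₀‖ + t + C| / ε, by positivity, fun ξ hξ x hx => ?_⟩
  rw [le_div_iff₀ hε]
  have h1 := hξ.2 x hx.1
  have h2 := hx.2 x₀ hx₀
  have h3 : ξ ⬝ᵥ x₀ ≤ n * r * ‖x₀‖ := by
    refine (le_abs_self _).trans ((abs_dotProduct_le _ _).trans ?_)
    gcongr
    exact hξ.1
  linarith [le_abs_self (n * r * ‖x₀‖ + t + C)]

theorem exists_ball_subset_cap {n : ℕ} {Ω : Set (Fin n → ℝ)} (hne : Ω.Nonempty) (ho : IsOpen Ω)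
    (hc : Convex ℝ Ω) {ε : ℝ} (hε : 0 < ε) (C r : ℝ) :
    ∃ s > 0, ∀ ξ ∈ coerciveSet Ω ε C r, ∃ z, Metric.ball z s ⊆ cap Ω 1 ξ := by
  obtain ⟨x₀, hx₀⟩ := hne
  obtain ⟨s₀, hs₀, hball⟩ := Metric.isOpen_iff.1 ho x₀ hx₀
  set H : ℝ := |n * r * (‖x₀‖ + s₀) + C| with hH
  have hH0 : 0 ≤ H := abs_nonneg _
  have ht : 0 < 1 / (2 * H + 2) := by positivity
  set t : ℝ := 1 / (2 * H + 2) with htdef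
  have ht1 : t ≤ 1 := by
    rw [htdef, div_le_one (by positivity)]
    linarith
  have htH : t * H ≤ 1 / 2 := by
    rw [htdef, one_div_mul_eq_div, div_le_iff₀ (by positivity)]
    linarith
  refine ⟨t * s₀, by positivity, fun ξ hξ => ?_⟩
  have hlow : ∀ y ∈ Ω, -C ≤ ξ ⬝ᵥ y := fun y hy => by
    linarith [hξ.2 y hy, mul_nonneg hε.le (norm_nonneg y)]
  obtain ⟨y₁, hy₁, hmin⟩ := exists_near_min ⟨x₀, hx₀⟩ hlow (δ := 1 / 2) (by norm_num)
  refine ⟨y₁ + t • (x₀ - y₁), fun x hx => ?_⟩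
  obtain ⟨w, hw, rfl⟩ : ∃ w ∈ Metric.ball x₀ s₀, x = y₁ + t • (w - y₁) := by
    refine ⟨y₁ + t⁻¹ • (x - y₁), ?_, by simp [smul_smul, mul_inv_cancel₀ ht.ne']⟩
    rw [Metric.mem_ball, dist_eq_norm] at *
    have : y₁ + t⁻¹ • (x - y₁) - x₀ = t⁻¹ • (x - (y₁ + t • (x₀ - y₁))) := by
      simp only [smul_sub, smul_add, smul_smul, inv_mul_cancel₀ ht.ne', one_smul]
      abel
    rw [this, norm_smul, Real.norm_of_nonneg (inv_pos.2 ht).le, inv_mul_lt_iff₀ ht]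
    exact hx
  have hwΩ := hball hw
  refine ⟨hc.add_smul_sub_mem hy₁ hwΩ ⟨ht.le, ht1⟩, fun y hy => ?_⟩
  rw [dotProduct_add, dotProduct_smul, smul_eq_mul, dotProduct_sub]
  have h1 : ξ ⬝ᵥ w ≤ n * r * (‖x₀‖ + s₀) := by
    refine (le_abs_self _).trans ((abs_dotProduct_le _ _).trans ?_)
    have h2 : ‖w‖ ≤ ‖x₀‖ + s₀ := by
      rw [Metric.mem_ball, dist_eq_norm] at hw
      have := norm_add_le x₀ (w - x₀)
      rw [add_sub_cancel] at this
      linarith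
    have hr : 0 ≤ r := (norm_nonneg _).trans hξ.1
    exact mul_le_mul (mul_le_mul_of_nonneg_left hξ.1 (by positivity)) h2 (norm_nonneg _)
      (by positivity)
  have h3 : ξ ⬝ᵥ w - ξ ⬝ᵥ y₁ ≤ H := by
    linarith [hlow y₁ hy₁, le_abs_self (n * r * (‖x₀‖ + s₀) + C)]
  have h4 := mul_le_mul_of_nonneg_left h3 ht.le
  linarith [hmin y hy]

theorem exists_affBound_of_mem_coerciveSet {n : ℕ} {Ω : Set (Fin n → ℝ)} (hne : Ω.Nonempty)
    (ho : IsOpen Ω) (hc : Convex ℝ Ω) {ε : ℝ} (hε : 0 < ε) (C r : ℝ) :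
    ∃ M, ∀ (g : autGroup n Ω) (ξ : Fin n → ℝ), ξ ∈ coerciveSet Ω ε C r →
      dualRep n Ω g *ᵥ ξ ∈ coerciveSet Ω ε C r → AffBound n M g.1 ∧ AffBound n M (g⁻¹).1 := by
  obtain ⟨s, hs, hs'⟩ := exists_ball_subset_cap hne ho hc hε C r
  obtain ⟨R, hR0, hR⟩ := cap_subset_closedBall hne hε C r 1
  have key : ∀ (g : autGroup n Ω) (ξ : Fin n → ℝ), ξ ∈ coerciveSet Ω ε C r →
      dualRep n Ω g *ᵥ ξ ∈ coerciveSet Ω ε C r →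
      AffBound n (R + 4 * R / s * (R + 1)) g.1 := by
    intro g ξ h h'
    obtain ⟨z, hz⟩ := hs' ξ h
    have hzR : ‖z‖ ≤ R := hR ξ h z (hz (Metric.mem_ball_self hs))
    have himg : ∀ w ∈ Metric.ball z s, ‖affAct n g.1 w‖ ≤ R := fun w hw =>
      hR _ h' _ (affAct_mem_cap g (hz hw))
    have hlin : ∀ v, ‖linPart n g.1 *ᵥ v‖ ≤ 4 * R / s * ‖v‖ := by
      intro v
      rcases eq_or_ne v 0 with rfl | hv
      · simp
      have hv' : 0 < ‖v‖ := norm_pos_iff.2 hv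
      have h1 : z + (s / (2 * ‖v‖)) • v ∈ Metric.ball z s := by
        rw [Metric.mem_ball, dist_eq_norm, add_sub_cancel_left, norm_smul,
          Real.norm_of_nonneg (by positivity)]
        rw [div_mul_eq_mul_div, div_lt_iff₀ (by positivity)]
        nlinarith
      have h2 := affAct_sub n g.1 (z + (s / (2 * ‖v‖)) • v) z
      rw [add_sub_cancel_left, Matrix.mulVec_smul] at h2
      have h3 : ‖(s / (2 * ‖v‖)) • (linPart n g.1 *ᵥ v)‖ ≤ R + R := by
        rw [← h2]
        exact (norm_sub_le _ _).trans (add_le_add (himg _ h1) (himg _ (Metric.mem_ball_self hs)))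
      rw [norm_smul, Real.norm_of_nonneg (by positivity), div_mul_eq_mul_div,
        div_le_iff₀ (by positivity)] at h3
      rw [div_mul_eq_mul_div, le_div_iff₀ hs]
      linarith
    intro x
    have h1 := affAct_sub n g.1 x z
    have h2 : affAct n g.1 x = affAct n g.1 z + linPart n g.1 *ᵥ (x - z) := by
      rw [← h1]
      abel
    rw [h2]
    refine (norm_add_le _ _).trans ?_
    have h3 := himg z (Metric.mem_ball_self hs)
    have h4 := hlin (x - z)
    have h5 : ‖x - z‖ ≤ ‖x‖ + R := (norm_sub_le _ _).trans (by linarith)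
    have h6 : 4 * R / s * ‖x - z‖ ≤ 4 * R / s * ((R + 1) * (‖x‖ + 1)) := by
      gcongr
      nlinarith [norm_nonneg x, mul_nonneg hR0 (norm_nonneg x)]
    have h7 : R ≤ R * (‖x‖ + 1) := by nlinarith [norm_nonneg x, mul_nonneg hR0 (norm_nonneg x)]
    calc _ ≤ R * (‖x‖ + 1) + 4 * R / s * ((R + 1) * (‖x‖ + 1)) := by linarith
      _ = _ := by ring
  refine ⟨_, fun g ξ h h' => ⟨key g ξ h h', key g⁻¹ _ h' ?_⟩⟩
  rwa [dualRep_inv_mulVec]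

theorem LinearMap.apply_eq_dotProduct {n : ℕ} (f : (Fin n → ℝ) →ₗ[ℝ] ℝ) (ξ : Fin n → ℝ) :
    f ξ = ξ ⬝ᵥ fun i => f (Pi.single i 1) := by
  rw [LinearMap.pi_apply_eq_sum_univ f ξ]
  refine Finset.sum_congr rfl fun i _ => ?_
  rw [smul_eq_mul]
  congr 2
  ext j
  simp [Pi.single_apply, eq_comm]

theorem coerciveDual_nonempty {n : ℕ} {Ω : Set (Fin n → ℝ)} (hne : Ω.Nonempty) (ho : IsOpen Ω)
    (hc : Convex ℝ Ω) (hl : HasNoLine n Ω) : (coerciveDual Ω).Nonempty := by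
  let W : Submodule ℝ (Fin n → ℝ) :=
    { carrier := {ζ | ∃ (η : Fin n → ℝ) (C : ℝ), ∀ y ∈ Ω, |ζ ⬝ᵥ y| ≤ η ⬝ᵥ y + C}
      zero_mem' := ⟨0, 0, by simp⟩
      add_mem' := by
        rintro ζ ζ' ⟨η, C, h⟩ ⟨η', C', h'⟩
        refine ⟨η + η', C + C', fun y hy => ?_⟩
        rw [add_dotProduct, add_dotProduct]
        linarith [abs_add_le (ζ ⬝ᵥ y) (ζ' ⬝ᵥ y), h y hy, h' y hy]
      smul_mem' := by
        rintro c ζ ⟨η, C, h⟩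
        refine ⟨|c| • η, |c| * C, fun y hy => ?_⟩
        rw [smul_dotProduct, smul_dotProduct, smul_eq_mul, smul_eq_mul, abs_mul, ← mul_add]
        exact mul_le_mul_of_nonneg_left (h y hy) (abs_nonneg c) }
  have hW : W = ⊤ := by
    by_contra hW
    obtain ⟨f, hf, hker⟩ := W.exists_le_ker_of_lt_top (lt_top_iff_ne_top.2 hW)
    set v : Fin n → ℝ := fun i => f (Pi.single i 1) with hv
    have hfv : ∀ ξ, f ξ = ξ ⬝ᵥ v := fun ξ => f.apply_eq_dotProduct ξ
    obtain ⟨x, hx⟩ := hne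
    refine hl ⟨x, hx, v, fun h0 => hf (LinearMap.ext fun ξ => by simp [hfv, h0]), fun t => ?_⟩
    by_contra hxt
    obtain ⟨φ, hφ⟩ := geometric_hahn_banach_open_point hc ho hxt
    set ζ : Fin n → ℝ := fun i => φ (Pi.single i 1) with hζ
    have hφζ : ∀ y, φ y = ζ ⬝ᵥ y := fun y => by
      rw [dotProduct_comm]
      exact φ.toLinearMap.apply_eq_dotProduct y
    have hmem : ζ ∈ W := by
      refine ⟨-ζ, 2 * |ζ ⬝ᵥ (x + t • v)|, fun y hy => ?_⟩
      have h1 := hφ y hy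
      rw [hφζ, hφζ] at h1
      rw [neg_dotProduct]
      have h2 := le_abs_self (ζ ⬝ᵥ (x + t • v))
      have h3 := abs_nonneg (ζ ⬝ᵥ (x + t • v))
      rw [abs_le]
      constructor <;> linarith
    have h0 : ζ ⬝ᵥ v = 0 := by
      rw [← hfv]
      exact hker hmem
    have h1 := hφ x hx
    rw [hφζ, hφζ, dotProduct_add, dotProduct_smul, h0] at h1
    simp at h1
  have hmem : ∀ i : Fin n, (Pi.single i 1 : Fin n → ℝ) ∈ W := fun i => hW ▸ Submodule.mem_top
  choose η C h using hmem
  refine ⟨∑ i, η i, 1, one_pos, ∑ i, C i, fun y hy => ?_⟩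
  have h1 : ‖y‖ ≤ ∑ i, |y i| := by
    rw [pi_norm_le_iff_of_nonneg (Finset.sum_nonneg fun _ _ => abs_nonneg _)]
    exact fun i => Finset.single_le_sum (f := fun i => |y i|) (fun _ _ => abs_nonneg _)
      (Finset.mem_univ i)
  have h2 : ∑ i, |y i| ≤ ∑ i, (η i ⬝ᵥ y + C i) := Finset.sum_le_sum fun i _ => by
    simpa using h i y hy
  rw [Finset.sum_add_distrib] at h2
  rw [sum_dotProduct]
  linarith

theorem Convex.sum_smul_add_mem {E ι : Type*} [AddCommGroup E] [Module ℝ E] {S : Set E}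
    (hS : Convex ℝ S) {J : Finset ι} {f : ι → E} {c : ℝ} {y : E} (hf : ∀ j ∈ J, f j ∈ S)
    (hy : y ∈ S) (hc : 0 ≤ c) (hc1 : c * J.card ≤ 1) :
    ∑ j ∈ J, c • f j + (1 - c * J.card) • y ∈ S := by
  have := hS.sum_mem (t := Finset.insertNone J) (w := fun o => o.elim (1 - c * J.card) fun _ => c)
    (z := fun o => o.elim y f) ?_ ?_ ?_
  · simpa [add_comm] using this
  · rintro (_ | j) _
    · simpa using hc1
    · simpa using hc
  · simp [mul_comm]
  · rintro (_ | j) hj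
    · simpa using hy
    · exact hf j (by simpa using hj)

theorem exists_center {n : ℕ} (hn : 1 ≤ n) {B : Set (Fin n → ℝ)} (hne : B.Nonempty)
    (hc : Convex ℝ B) (hb : Bornology.IsBounded B) :
    ∃ x, ∀ y ∈ B, ∃ y' ∈ closure B,
      x = (1 / (n + 1) : ℝ) • y + (n / (n + 1) : ℝ) • y' := by
  have hn' : (0 : ℝ) < n := by exact_mod_cast hn
  obtain ⟨y₀, hy₀⟩ := hne
  have hcl : Convex ℝ (closure B) := hc.closure
  have hcpt : IsCompact (closure B) := hb.isCompact_closure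
  have := Convex.helly_theorem_compact' (𝕜 := ℝ) (E := Fin n → ℝ) (ι := B)
    (F := fun y => (fun y' => (1 / (n + 1) : ℝ) • y.1 + (n / (n + 1) : ℝ) • y') '' closure B)
    (fun y => ?_) (fun y => hcpt.image (by fun_prop)) ?_
  · obtain ⟨x, hx⟩ := this
    refine ⟨x, fun y hy => ?_⟩
    obtain ⟨y', hy', h⟩ := mem_iInter.1 hx ⟨y, hy⟩
    exact ⟨y', hy', h.symm⟩
  · have := (hcl.smul (n / (n + 1) : ℝ)).translate ((1 / (n + 1) : ℝ) • y.1)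
    rw [← image_smul, image_image] at this
    exact this
  · intro I hI
    rw [Module.finrank_fin_fun] at hI
    refine ⟨∑ j ∈ I, (1 / (n + 1) : ℝ) • j.1 + (1 - (1 / (n + 1) : ℝ) * I.card) • y₀,
      mem_iInter₂.2 fun i hi => ?_⟩
    have hcard : ((I.erase i).card : ℝ) = I.card - 1 := by
      rw [Finset.card_erase_of_mem hi, Nat.cast_pred (Finset.card_pos.2 ⟨i, hi⟩)]
    have hI' : (I.card : ℝ) ≤ n + 1 := by exact_mod_cast hI
    refine ⟨_, hcl.sum_smul_add_mem (J := I.erase i) (f := fun j => j.1) (c := 1 / n)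
      (fun j _ => subset_closure j.2) (subset_closure hy₀) (by positivity) ?_, ?_⟩
    · rw [hcard, one_div_mul_eq_div, div_le_one hn']
      linarith
    · beta_reduce
      rw [← Finset.add_sum_erase I _ hi, hcard, smul_add, Finset.smul_sum]
      simp only [smul_smul]
      have h1 : (n / (n + 1) * (1 / n) : ℝ) = 1 / (n + 1) := by field_simp
      have h2 : (n / (n + 1) * (1 - 1 / n * (I.card - 1)) : ℝ) = 1 - 1 / (n + 1) * I.card := by
        field_simp
        ring
      rw [h1, h2, add_assoc]

theorem convex_cap {n : ℕ} {Ω : Set (Fin n → ℝ)} (hc : Convex ℝ Ω) (t : ℝ) (ξ : Fin n → ℝ) :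
    Convex ℝ (cap Ω t ξ) := by
  intro x hx y hy a b ha hb hab
  refine ⟨hc hx.1 hy.1 ha hb hab, fun z hz => ?_⟩
  have h1 := mul_le_mul_of_nonneg_left (hx.2 z hz) ha
  have h2 := mul_le_mul_of_nonneg_left (hy.2 z hz) hb
  rw [dotProduct_add, dotProduct_smul, dotProduct_smul, smul_eq_mul, smul_eq_mul]
  calc _ ≤ (a + b) * (ξ ⬝ᵥ z + t) := by linarith
    _ = _ := by rw [hab, one_mul]

/-- `x` is a point of `Ω` lying deep inside the cap of height one of `ξ`. -/
def IsCapCenter {n : ℕ} (Ω : Set (Fin n → ℝ)) (ξ x : Fin n → ℝ) : Prop :=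
  x ∈ Ω ∧ (∀ y ∈ Ω, ξ ⬝ᵥ x ≤ ξ ⬝ᵥ y + n / (n + 1)) ∧
    ∀ y ∈ cap Ω 1 ξ, ∃ y' ∈ closure Ω, x = (1 / (n + 1) : ℝ) • y + (n / (n + 1) : ℝ) • y'

theorem exists_isCapCenter {n : ℕ} (hn : 1 ≤ n) {Ω : Set (Fin n → ℝ)} (hne : Ω.Nonempty)
    (ho : IsOpen Ω) (hc : Convex ℝ Ω) {ξ : Fin n → ℝ} (hξ : ξ ∈ coerciveDual Ω) :
    ∃ x, IsCapCenter Ω ξ x := by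
  have hn' : (0 : ℝ) < n := by exact_mod_cast hn
  have hb : Bornology.IsBounded (cap Ω 1 ξ) := by
    obtain ⟨ε, hε, C, r, h⟩ := mem_coerciveSet_of_mem_coerciveDual hξ
    obtain ⟨R, _, hR⟩ := cap_subset_closedBall hne hε C r 1
    exact isBounded_iff_forall_norm_le.2 ⟨R, hR ξ h⟩
  have hcne := cap_nonempty hne hξ one_pos
  obtain ⟨x, hx⟩ := exists_center hn hcne (convex_cap hc 1 ξ) hb
  have hcl : closure (cap Ω 1 ξ) ⊆ closure Ω := closure_mono fun _ h => h.1
  have hval : ∀ y ∈ closure (cap Ω 1 ξ), ∀ z ∈ Ω, ξ ⬝ᵥ y ≤ ξ ⬝ᵥ z + 1 := by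
    intro y hy z hz
    have : IsClosed {y : Fin n → ℝ | ξ ⬝ᵥ y ≤ ξ ⬝ᵥ z + 1} :=
      isClosed_le (by fun_prop) continuous_const
    exact this.closure_subset_iff.2 (fun w hw => hw.2 z hz) hy
  have hcap : ∀ y ∈ cap Ω 1 ξ, ξ ⬝ᵥ x ≤ ξ ⬝ᵥ y + n / (n + 1) := by
    intro y hy
    obtain ⟨y', hy', rfl⟩ := hx y hy
    have h1 := mul_le_mul_of_nonneg_left (hval y' hy' y hy.1) (a := (n / (n + 1) : ℝ))
      (by positivity)
    rw [dotProduct_add, dotProduct_smul, dotProduct_smul, smul_eq_mul, smul_eq_mul]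
    have h2 : (1 / (n + 1) : ℝ) + n / (n + 1) = 1 := by field_simp; ring
    calc _ ≤ (1 / (n + 1) + n / (n + 1)) * (ξ ⬝ᵥ y) + n / (n + 1) := by linarith
      _ = _ := by rw [h2, one_mul]
  refine ⟨x, ?_, fun y hy => ?_, fun y hy => ?_⟩
  · obtain ⟨y, hy⟩ := hcne
    obtain ⟨y', hy', rfl⟩ := hx y hy
    rw [← ho.interior_eq]
    refine hc.combo_interior_closure_mem_interior (by rw [ho.interior_eq]; exact hy.1) (hcl hy')
      (by positivity) (by positivity) (by field_simp; ring)
  · by_cases hyc : y ∈ cap Ω 1 ξ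
    · exact hcap y hyc
    · obtain ⟨z, hz⟩ := hcne
      have h3 : ∃ w ∈ Ω, ξ ⬝ᵥ w + 1 < ξ ⬝ᵥ y := by
        by_contra! hcon
        exact hyc ⟨hy, hcon⟩
      obtain ⟨w, hw, hwy⟩ := h3
      linarith [hcap z hz, hz.2 w hw]
  · obtain ⟨y', hy', h⟩ := hx y hy
    exact ⟨y', hcl hy', h⟩

theorem affAct_combo (n : ℕ) (g : GL (Fin (n + 1)) ℝ) {a b : ℝ} (hab : a + b = 1)
    (x y : Fin n → ℝ) : affAct n g (a • x + b • y) = a • affAct n g x + b • affAct n g y := by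
  have h : affAct n g 0 = (a + b) • affAct n g 0 := by rw [hab, one_smul]
  rw [affAct_eq, affAct_eq n g x, affAct_eq n g y, Matrix.mulVec_add, Matrix.mulVec_smul,
    Matrix.mulVec_smul, h]
  simp only [hab, one_smul, smul_add]
  nth_rewrite 1 [h]
  rw [add_smul]
  abel

theorem IsCapCenter.map {n : ℕ} {Ω : Set (Fin n → ℝ)} (g : autGroup n Ω) {ξ x : Fin n → ℝ}
    (h : IsCapCenter Ω ξ x) : IsCapCenter Ω (dualRep n Ω g *ᵥ ξ) (affAct n g.1 x) := by
  obtain ⟨h1, h2, h3⟩ := h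
  refine ⟨autGroup_map g h1, fun y hy => ?_, fun y hy => ?_⟩
  · have h4 := h2 _ (autGroup_map g⁻¹ hy)
    have h5 := dualRep_dotProduct_sub g ξ x (affAct n (g⁻¹).1 y)
    rw [Subgroup.coe_inv, affAct_apply_inv (autGroup_affine g), dotProduct_sub,
      dotProduct_sub] at h5
    rw [Subgroup.coe_inv] at h4
    linarith
  · rw [← affAct_image_cap] at hy
    obtain ⟨z, hz, rfl⟩ := hy
    obtain ⟨z', hz', rfl⟩ := h3 z hz
    refine ⟨affAct n g.1 z', ?_, affAct_combo n g.1 (by field_simp; ring) z z'⟩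
    exact map_mem_closure (continuous_affAct n g.1) hz' fun w hw => autGroup_map g hw

theorem exists_dualRep_mem_coerciveSet {n : ℕ} (hn : 1 ≤ n) {Ω : Set (Fin n → ℝ)}
    (hne : Ω.Nonempty) (ho : IsOpen Ω) (hc : Convex ℝ Ω) (hl : HasNoLine n Ω)
    (hq : IsQuasiHomogeneous n Ω) :
    ∃ ε > 0, ∃ C r : ℝ, ∀ ξ ∈ coerciveDual Ω, ∃ g : autGroup n Ω,
      dualRep n Ω g *ᵥ ξ ∈ coerciveSet Ω ε C r := by
  have hn' : (0 : ℝ) < n := by exact_mod_cast hn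
  obtain ⟨K, hK, hKΩ, hcov⟩ := hq
  obtain ⟨η, ε₀, hε₀, C₀, hη⟩ := coerciveDual_nonempty hne ho hc hl
  have hηcl : ∀ y ∈ closure Ω, ε₀ * ‖y‖ - C₀ ≤ η ⬝ᵥ y := by
    have : IsClosed {y : Fin n → ℝ | ε₀ * ‖y‖ - C₀ ≤ η ⬝ᵥ y} :=
      isClosed_le (by fun_prop) (by fun_prop)
    exact fun y hy => this.closure_subset_iff.2 hη hy
  obtain ⟨δ, hδ, hthick⟩ := hK.exists_cthickening_subset_open ho hKΩ
  obtain ⟨Q, hQ⟩ := (hK.image_of_continuousOn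
    (f := fun y => η ⬝ᵥ y) (by fun_prop)).bddAbove
  set R : ℝ := |(n + 1) * (Q + C₀) / ε₀| with hRdef
  have hR0 : 0 ≤ R := abs_nonneg _
  set T : ℝ := 4 * R + 1 with hT
  have hT0 : 0 < T := by positivity
  set c : ℝ := 1 / (n + 1) with hcdef
  have hc0 : 0 < c := by positivity
  have hc1 : c ≤ 1 := by
    rw [hcdef, div_le_one (by positivity)]
    linarith
  refine ⟨c / T, by positivity, c / T * R + 2 + n * (1 / δ) * R, 1 / δ, fun ξ hξ => ?_⟩
  obtain ⟨x, hx⟩ := exists_isCapCenter hn hne ho hc hξ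
  have hxΩ := hx.1
  rw [← hcov] at hxΩ
  simp only [mem_iUnion, mem_image, exists_prop] at hxΩ
  obtain ⟨g, hg, k, hk, rfl⟩ := hxΩ
  refine ⟨(⟨g, hg⟩ : autGroup n Ω)⁻¹, ?_⟩
  have hcen := hx.map (⟨g, hg⟩ : autGroup n Ω)⁻¹
  rw [Subgroup.coe_inv, affAct_inv_apply (mem_autSet_iff.1 hg).1] at hcen
  generalize dualRep n Ω (⟨g, hg⟩ : autGroup n Ω)⁻¹ *ᵥ ξ = ζ at hcen ⊢
  obtain ⟨hkΩ, hkmin, hkcap⟩ := hcen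
  have hfrac : (n / (n + 1) : ℝ) = 1 - c := by rw [hcdef]; field_simp; ring
  have hcapR : ∀ y ∈ cap Ω 1 ζ, ‖y‖ ≤ R := by
    intro y hy
    obtain ⟨y', hy', h⟩ := hkcap y hy
    have h1 : η ⬝ᵥ k ≤ Q := hQ (mem_image_of_mem _ hk)
    rw [h, dotProduct_add, dotProduct_smul, dotProduct_smul, smul_eq_mul, smul_eq_mul, ← hcdef,
      hfrac] at h1
    have h2 := mul_le_mul_of_nonneg_left (hη y hy.1) hc0.le
    have h3 := mul_le_mul_of_nonneg_left (hηcl y' hy') (sub_nonneg.2 hc1)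
    have h4 : 0 ≤ (1 - c) * (ε₀ * ‖y'‖) :=
      mul_nonneg (sub_nonneg.2 hc1) (mul_nonneg hε₀.le (norm_nonneg _))
    refine le_trans ?_ (le_abs_self _)
    rw [le_div_iff₀ hε₀]
    have h5 : c * (‖y‖ * ε₀) ≤ Q + C₀ := by linarith
    calc ‖y‖ * ε₀ = (n + 1) * (c * (‖y‖ * ε₀)) := by rw [hcdef]; field_simp
      _ ≤ _ := by gcongr
  have hkc : k ∈ cap Ω 1 ζ := ⟨hkΩ, fun y hy => by linarith [hkmin y hy]⟩
  have hkR := hcapR k hkc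
  have hnorm : ‖ζ‖ ≤ 1 / δ := by
    rw [pi_norm_le_iff_of_nonneg (by positivity)]
    intro i
    have hmem : ∀ s : ℝ, |s| ≤ δ → k + Pi.single i s ∈ Ω := fun s hs => by
      refine hthick (Metric.mem_cthickening_of_dist_le _ k _ _ hk ?_)
      rw [dist_eq_norm, add_sub_cancel_left, Pi.norm_single]
      exact hs
    have h1 := hkc.2 _ (hmem δ (abs_of_pos hδ).le)
    have h2 := hkc.2 _ (hmem (-δ) (by rw [abs_neg]; exact (abs_of_pos hδ).le))
    rw [dotProduct_add, dotProduct_single] at h1 h2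
    rw [Real.norm_eq_abs, le_div_iff₀ hδ, ← abs_of_pos hδ, ← abs_mul, abs_le]
    constructor <;> linarith
  refine ⟨hnorm, fun y hy => ?_⟩
  have hζk : -(n * (1 / δ) * R) ≤ ζ ⬝ᵥ k := by
    refine (abs_le.1 ((abs_dotProduct_le ζ k).trans ?_)).1
    gcongr
  have hgrow : c / T * ‖y - k‖ - 2 ≤ ζ ⬝ᵥ y - ζ ⬝ᵥ k := by
    rcases le_or_gt ‖y - k‖ T with hle | hlt
    · have h1 : c / T * ‖y - k‖ ≤ c := by
        rw [div_mul_eq_mul_div, div_le_iff₀ hT0]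
        gcongr
      linarith [hkc.2 y hy]
    · have hpos : 0 < ‖y - k‖ := hT0.trans hlt
      set τ : ℝ := T / ‖y - k‖ with hτ
      have hτ0 : 0 < τ := by positivity
      have hτ1 : τ ≤ 1 := by rw [hτ, div_le_one hpos]; exact hlt.le
      have hzΩ : k + τ • (y - k) ∈ Ω := hc.add_smul_sub_mem hkΩ hy ⟨hτ0.le, hτ1⟩
      have hzn : R < ‖k + τ • (y - k)‖ := by
        have h1 : ‖τ • (y - k)‖ = T := by
          rw [norm_smul, Real.norm_of_nonneg hτ0.le, hτ, div_mul_cancel₀ _ hpos.ne']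
        have h2 := norm_sub_norm_le (τ • (y - k)) (-k)
        rw [h1, norm_neg, sub_neg_eq_add, add_comm (τ • (y - k))] at h2
        linarith
      have h3 : ∃ w ∈ Ω, ζ ⬝ᵥ w + 1 < ζ ⬝ᵥ (k + τ • (y - k)) := by
        by_contra! hcon
        exact absurd (hcapR _ ⟨hzΩ, hcon⟩) (not_le.2 hzn)
      obtain ⟨w, hw, hwz⟩ := h3
      have h4 := hkmin w hw
      rw [hfrac] at h4
      rw [dotProduct_add, dotProduct_smul, smul_eq_mul, dotProduct_sub] at hwz
      have h5 : c ≤ τ * (ζ ⬝ᵥ y - ζ ⬝ᵥ k) := by linarith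
      rw [hτ, div_mul_eq_mul_div, le_div_iff₀ hpos] at h5
      have h6 : c / T * ‖y - k‖ ≤ ζ ⬝ᵥ y - ζ ⬝ᵥ k := by
        rw [div_mul_eq_mul_div, div_le_iff₀ hT0]
        linarith
      linarith
  have h7 : c / T * (‖y‖ - R) ≤ c / T * ‖y - k‖ := by
    gcongr
    linarith [norm_sub_norm_le y k]
  linarith

theorem eq_one_of_norm_pow_sub_one_le {A : Type*} [NormedRing A] [NormedAlgebra ℝ A] {a : A}
    (h : ∀ k : ℕ, ‖a ^ k - 1‖ ≤ 1 / 2) : a = 1 := by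
  have hgrow : ∀ k : ℕ, (3 / 2 : ℝ) ^ k * ‖a - 1‖ ≤ ‖a ^ 2 ^ k - 1‖ := by
    intro k
    induction k with
    | zero => simp
    | succ k ih =>
      set b := a ^ 2 ^ k - 1 with hb
      have h1 : (2 : ℝ) • b = (a ^ 2 ^ (k + 1) - 1) - b * b := by
        rw [two_smul, pow_succ, pow_mul, sq, hb]
        noncomm_ring
      have h3 : 2 * ‖b‖ ≤ ‖a ^ 2 ^ (k + 1) - 1‖ + ‖b‖ * ‖b‖ := by
        have h5 := norm_sub_le (a ^ 2 ^ (k + 1) - 1) (b * b)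
        rw [← h1, norm_smul] at h5
        norm_num at h5
        linarith [norm_mul_le b b]
      have h4 : ‖b‖ * ‖b‖ ≤ 1 / 2 * ‖b‖ := mul_le_mul_of_nonneg_right (h _) (norm_nonneg _)
      rw [pow_succ]
      linarith
  by_contra hne
  have hpos : 0 < ‖a - 1‖ := norm_pos_iff.2 (sub_ne_zero.2 hne)
  obtain ⟨k, hk⟩ := pow_unbounded_of_one_lt (1 / ‖a - 1‖) (by norm_num : (1 : ℝ) < 3 / 2)
  rw [div_lt_iff₀ hpos] at hk
  linarith [hgrow k, h (2 ^ k)]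

theorem eventually_eq_one_of_isCompact_connectedComponent {G A : Type*} [Group G]
    [TopologicalSpace G] [IsTopologicalGroup G] [LocallyCompactSpace G] [T2Space G]
    [NormedRing A] [NormedAlgebra ℝ A] (ρ : G →* A) (hρ : Continuous ρ)
    (hcpt : IsCompact (connectedComponent (1 : G))) (h1 : ∀ g ∈ connectedComponent (1 : G), ρ g = 1) :
    ∀ᶠ g in 𝓝 (1 : G), ρ g = 1 := by
  set W : Set G := ρ ⁻¹' Metric.ball 1 (1 / 2) with hW
  have hWo : IsOpen W := Metric.isOpen_ball.preimage hρ
  have hCW : connectedComponent (1 : G) ⊆ W := fun g hg => by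
    rw [hW, mem_preimage, h1 g hg]
    exact Metric.mem_ball_self (by norm_num)
  obtain ⟨Z, hZ, hCZ, hZW⟩ := exists_compact_between hcpt hWo hCW
  have : CompactSpace Z := isCompact_iff_compactSpace.1 hZ
  have h1Z : (1 : G) ∈ Z := interior_subset (hCZ mem_connectedComponent)
  have hcomp : connectedComponent (⟨1, h1Z⟩ : Z) ⊆ Subtype.val ⁻¹' interior Z := by
    rw [← image_subset_iff]
    refine Subset.trans ?_ hCZ
    exact (isPreconnected_connectedComponent.image _
      continuous_subtype_val.continuousOn).subset_connectedComponent
      ⟨_, mem_connectedComponent, rfl⟩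
  rw [connectedComponent_eq_iInter_isClopen] at hcomp
  have : Nonempty {s : Set Z // IsClopen s ∧ (⟨1, h1Z⟩ : Z) ∈ s} :=
    ⟨⟨univ, isClopen_univ, mem_univ _⟩⟩
  obtain ⟨⟨s, hs, h1s⟩, hsZ⟩ := exists_subset_nhds_of_compactSpace
    (V := fun s : {s : Set Z // IsClopen s ∧ (⟨1, h1Z⟩ : Z) ∈ s} => s.1)
    (fun s t => ⟨⟨s.1 ∩ t.1, s.2.1.inter t.2.1, s.2.2, t.2.2⟩, inter_subset_left,
      inter_subset_right⟩) (fun s => s.2.1.1)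
    (fun x hx => (isOpen_interior.preimage continuous_subtype_val).mem_nhds (hcomp hx))
  have hAc : IsCompact (Subtype.val '' s) := hs.1.isCompact.image continuous_subtype_val
  have hAo : IsOpen (Subtype.val '' s) := by
    obtain ⟨O, hO, rfl⟩ := isOpen_induced_iff.1 hs.2
    have : Subtype.val '' (Subtype.val ⁻¹' O : Set Z) = O ∩ interior Z := by
      ext x
      constructor
      · rintro ⟨y, hy, rfl⟩
        exact ⟨hy, hsZ hy⟩
      · rintro ⟨hx, hx'⟩
        exact ⟨⟨x, interior_subset hx'⟩, hx, rfl⟩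
    rw [this]
    exact hO.inter isOpen_interior
  obtain ⟨V, hV, hAV⟩ := compact_open_separated_mul_right hAc hAo Subset.rfl
  filter_upwards [hV] with g hg
  have hpow : ∀ k : ℕ, g ^ k ∈ Subtype.val '' s := by
    intro k
    induction k with
    | zero => exact ⟨_, h1s, by simp⟩
    | succ k ih => exact hAV (pow_succ g k ▸ Set.mul_mem_mul ih hg)
  refine eq_one_of_norm_pow_sub_one_le fun k => ?_
  obtain ⟨z, -, hz⟩ := hpow k
  have : g ^ k ∈ W := hZW (hz ▸ z.2)
  rw [hW, mem_preimage, map_pow, mem_ball_iff_norm] at this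
  exact this.le

theorem exists_integral_fixed {n : ℕ} {H : Type*} [Group H] [TopologicalSpace H]
    [IsTopologicalGroup H] [CompactSpace H] (ρ : H →* Matrix (Fin n) (Fin n) ℝ)
    (hρ : Continuous ρ) {S : Set (Fin n → ℝ)} (hS : IsClosed S) (hS' : Convex ℝ S)
    {ξ : Fin n → ℝ} (hξ : ∀ h, ρ h *ᵥ ξ ∈ S) : ∃ ξ₀ ∈ S, ∀ h, ρ h *ᵥ ξ₀ = ξ₀ := by
  let _ : MeasurableSpace H := borel H
  have : BorelSpace H := ⟨rfl⟩
  let μ : MeasureTheory.Measure H := MeasureTheory.Measure.haarMeasure ⊤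
  have : MeasureTheory.IsProbabilityMeasure μ :=
    ⟨MeasureTheory.Measure.haarMeasure_self⟩
  have hcont : Continuous fun h => ρ h *ᵥ ξ := hρ.matrix_mulVec continuous_const
  have h_int : MeasureTheory.Integrable (fun h => ρ h *ᵥ ξ) μ := by
    refine hcont.integrable_of_hasCompactSupport (HasCompactSupport.of_compactSpace _)
  refine ⟨∫ h, ρ h *ᵥ ξ ∂μ, hS'.integral_mem hS (Filter.Eventually.of_forall hξ) h_int, fun h => ?_⟩
  let L : (Fin n → ℝ) →L[ℝ] (Fin n → ℝ) := LinearMap.toContinuousLinearMap (ρ h).mulVecLin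
  have h1 := L.integral_comp_comm h_int
  have h2 : ∀ k, L (ρ k *ᵥ ξ) = ρ (h * k) *ᵥ ξ := fun k => by
    rw [map_mul, ← Matrix.mulVec_mulVec]
    rfl
  simp only [h2] at h1
  rw [MeasureTheory.integral_mul_left_eq_self (fun k => ρ k *ᵥ ξ) h] at h1
  exact h1.symm

theorem convex_coerciveSet {n : ℕ} (Ω : Set (Fin n → ℝ)) (ε C r : ℝ) :
    Convex ℝ (coerciveSet Ω ε C r) := by
  rintro ξ hξ η hη a b ha hb hab
  refine ⟨?_, fun y hy => ?_⟩
  · have h1 := norm_add_le (a • ξ) (b • η)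
    rw [norm_smul, norm_smul, Real.norm_of_nonneg ha, Real.norm_of_nonneg hb] at h1
    calc ‖a • ξ + b • η‖ ≤ a * ‖ξ‖ + b * ‖η‖ := h1
      _ ≤ a * r + b * r := by gcongr; exacts [hξ.1, hη.1]
      _ = r := by rw [← add_mul, hab, one_mul]
  · have h1 := mul_le_mul_of_nonneg_left (hξ.2 y hy) ha
    have h2 := mul_le_mul_of_nonneg_left (hη.2 y hy) hb
    rw [add_dotProduct, smul_dotProduct, smul_dotProduct, smul_eq_mul, smul_eq_mul]
    calc ε * ‖y‖ - C = a * (ε * ‖y‖ - C) + b * (ε * ‖y‖ - C) := by rw [← add_mul, hab, one_mul]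
      _ ≤ _ := by linarith

theorem affBound_sum (n : ℕ) (g : GL (Fin (n + 1)) ℝ) :
    AffBound n (∑ i, ∑ j, |g.val i j|) g := by
  intro x
  have h0 : 0 ≤ ∑ i, ∑ j, |g.val i j| :=
    Finset.sum_nonneg fun _ _ => Finset.sum_nonneg fun _ _ => abs_nonneg _
  rw [pi_norm_le_iff_of_nonneg (by positivity)]
  intro i
  have h1 : ∑ j, |g.val i.castSucc j| ≤ ∑ i, ∑ j, |g.val i j| :=
    Finset.single_le_sum (f := fun i => ∑ j, |g.val i j|)
      (fun _ _ => Finset.sum_nonneg fun _ _ => abs_nonneg _) (Finset.mem_univ _)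
  refine le_trans ?_ (mul_le_mul_of_nonneg_right h1 (by positivity))
  rw [Fin.sum_univ_castSucc, add_mul, Finset.sum_mul]
  refine (norm_add_le _ _).trans (add_le_add ((norm_sum_le _ _).trans ?_) ?_)
  · refine Finset.sum_le_sum fun j _ => ?_
    rw [norm_mul]
    refine mul_le_mul_of_nonneg_left ?_ (abs_nonneg _)
    linarith [norm_le_pi_norm x j]
  · exact le_mul_of_one_le_right (abs_nonneg _) (by linarith [norm_nonneg x])

theorem AffBound.mono {n : ℕ} {M M' : ℝ} {g : GL (Fin (n + 1)) ℝ} (h : AffBound n M g)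
    (hM : M ≤ M') : AffBound n M' g := fun x => (h x).trans (by gcongr)

theorem IsCompact.exists_affBound {n : ℕ} {Ω : Set (Fin n → ℝ)} {S : Set (autGroup n Ω)}
    (hS : IsCompact S) : ∃ M, ∀ g ∈ S, AffBound n M g.1 ∧ AffBound n M (g⁻¹).1 := by
  have hval : Continuous fun g : autGroup n Ω => g.1.val :=
    Units.continuous_val.comp continuous_subtype_val
  have hc : Continuous fun g : autGroup n Ω => ∑ i, ∑ j, |g.1.val i j| :=
    continuous_finsetSum _ fun i _ => continuous_finsetSum _ fun j _ => (hval.matrix_elem i j).abs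
  obtain ⟨M, hM⟩ := hS.bddAbove_image hc.continuousOn
  obtain ⟨M', hM'⟩ := hS.bddAbove_image (hc.comp continuous_inv).continuousOn
  refine ⟨max M M', fun g hg => ⟨?_, ?_⟩⟩
  · exact (affBound_sum n g.1).mono ((hM (mem_image_of_mem _ hg)).trans (le_max_left _ _))
  · exact (affBound_sum n _).mono ((hM' (mem_image_of_mem _ hg)).trans (le_max_right _ _))

theorem abs_le_of_affBound {n : ℕ} {M : ℝ} {g : GL (Fin (n + 1)) ℝ} (hg : IsAffineForm n g)
    (h : AffBound n M g) (i j : Fin (n + 1)) : |g.val i j| ≤ 3 * |M| + 1 := by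
  have hlast : ∀ i : Fin n, |g.val i.castSucc (Fin.last n)| ≤ |M| := fun i => by
    rw [← affAct_zero_apply]
    refine (norm_le_pi_norm _ i).trans ((h 0).trans ?_)
    simpa using le_abs_self M
  refine Fin.lastCases ?_ (fun i => ?_) i
  · refine Fin.lastCases ?_ (fun j => ?_) j
    · rw [hg.2, abs_one]
      linarith [abs_nonneg M]
    · rw [hg.1, abs_zero]
      positivity
  · refine Fin.lastCases ?_ (fun j => ?_) j
    · linarith [hlast i, abs_nonneg M]
    · have h1 : affAct n g (Pi.single j 1) i =
          g.val i.castSucc j.castSucc + g.val i.castSucc (Fin.last n) := by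
        simp [affAct, Pi.single_apply]
      have h2 : |affAct n g (Pi.single j 1) i| ≤ M * 2 := by
        refine (norm_le_pi_norm _ i).trans ((h _).trans_eq ?_)
        rw [Pi.norm_single, norm_one]
        norm_num
      have h3 := abs_sub (affAct n g (Pi.single j 1) i) (g.val i.castSucc (Fin.last n))
      rw [h1, add_sub_cancel_right] at h3
      rw [h1] at h2
      linarith [hlast i, le_abs_self M]

theorem exists_isCompact_affBound {n : ℕ} {Ω : Set (Fin n → ℝ)} (ho : IsOpen Ω) (hc : Convex ℝ Ω)
    (M : ℝ) : ∃ K : Set (autGroup n Ω), IsCompact K ∧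
      ∀ g : autGroup n Ω, AffBound n M g.1 → AffBound n M (g⁻¹).1 → g ∈ K := by
  let T : Set (Matrix (Fin (n + 1)) (Fin (n + 1)) ℝ) :=
    univ.pi fun _ => univ.pi fun _ => Icc (-(3 * |M| + 1)) (3 * |M| + 1)
  have hT : IsCompact T := isCompact_univ_pi fun _ => isCompact_univ_pi fun _ => isCompact_Icc
  have hmem : ∀ g : GL (Fin (n + 1)) ℝ, IsAffineForm n g → AffBound n M g → g.val ∈ T :=
    fun g hg hM i _ j _ => abs_le.1 (abs_le_of_affBound hg hM i j)
  have h1 : IsCompact (T ×ˢ (MulOpposite.unop ⁻¹' T)) :=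
    hT.prod (MulOpposite.opHomeomorph.symm.isCompact_preimage.2 hT)
  have h2 := Units.isClosedEmbedding_embedProduct.isCompact_preimage h1
  have h3 : IsClosedEmbedding (Subtype.val : autGroup n Ω → GL (Fin (n + 1)) ℝ) :=
    (isClosed_autSet ho hc).isClosedEmbedding_subtypeVal
  refine ⟨_, h3.isCompact_preimage h2, fun g hg hg' => ⟨?_, ?_⟩⟩
  · exact hmem _ (autGroup_affine g) hg
  · exact hmem _ (autGroup_affine g⁻¹) hg'

theorem exists_normal_affBound {n : ℕ} {Ω : Set (Fin n → ℝ)} (hne : Ω.Nonempty) (ho : IsOpen Ω)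
    (hc : Convex ℝ Ω) (hl : HasNoLine n Ω) (hcpt : IsCompact (AutIdComp n Ω)) :
    ∃ N : Subgroup (autGroup n Ω), N.Normal ∧ IsOpen (N : Set (autGroup n Ω)) ∧
      ∃ M, ∀ g ∈ N, AffBound n M g.1 ∧ AffBound n M (g⁻¹).1 := by
  have hemb : IsClosedEmbedding (Subtype.val : autGroup n Ω → GL (Fin (n + 1)) ℝ) :=
    (isClosed_autSet ho hc).isClosedEmbedding_subtypeVal
  have : LocallyCompactSpace (Matrix (Fin (n + 1)) (Fin (n + 1)) ℝ) :=
    inferInstanceAs (LocallyCompactSpace (Fin (n + 1) → Fin (n + 1) → ℝ))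
  have : LocallyCompactSpace (autGroup n Ω) := hemb.locallyCompactSpace
  have hcomp : IsCompact (connectedComponent (1 : autGroup n Ω)) := by
    rw [hemb.isEmbedding.isCompact_iff]
    have himg := connectedComponentIn_eq_image (F := AutSet n Ω) (autGroup n Ω).one_mem
    rwa [AutIdComp, himg] at hcpt
  set H := Subgroup.connectedComponentOfOne (autGroup n Ω) with hH
  have : CompactSpace H := isCompact_iff_compactSpace.1 hcomp
  have hHn : H.Normal := ⟨fun h hh g => by
    have hconj : Continuous fun k : autGroup n Ω => g * k * g⁻¹ := by fun_prop
    have h1 := hconj.mapsTo_connectedComponent 1 hh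
    rwa [mul_one, mul_inv_cancel] at h1⟩
  obtain ⟨ξ, hξ⟩ := coerciveDual_nonempty hne ho hc hl
  obtain ⟨ε, hε, C, r, hξ⟩ := mem_coerciveSet_of_mem_coerciveDual hξ
  obtain ⟨M, hM⟩ := hcomp.exists_affBound
  obtain ⟨ε', hε', C', r', hmem⟩ := dualRep_mem_coerciveSet (M := M) (C := C) (r := r) Ω hε
  obtain ⟨ξ₀, hξ₀, hfix⟩ := exists_integral_fixed ((dualRep n Ω).comp H.subtype)
    ((continuous_dualRep n Ω).comp continuous_subtype_val) (isClosed_coerciveSet Ω ε' C' r')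
    (convex_coerciveSet Ω ε' C' r') (ξ := ξ)
    (fun h => hmem _ (hM _ h.2).1 (hM _ h.2).2 ξ hξ)
  let F : Submodule ℝ (Fin n → ℝ) :=
    { carrier := {η | ∀ h ∈ H, dualRep n Ω h *ᵥ η = η}
      zero_mem' := fun h _ => Matrix.mulVec_zero _
      add_mem' := fun {a b} ha hb h hh => by rw [Matrix.mulVec_add, ha h hh, hb h hh]
      smul_mem' := fun c a ha h hh => by rw [Matrix.mulVec_smul, ha h hh] }
  have hF : ∀ g : autGroup n Ω, ∀ η ∈ F, dualRep n Ω g *ᵥ η ∈ F := by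
    intro g η hη h hh
    have h1 := hη (g⁻¹ * h * g) (by simpa using hHn.conj_mem h hh g⁻¹)
    have h2 : h * g = g * (g⁻¹ * h * g) := by group
    rw [Matrix.mulVec_mulVec, ← map_mul, h2, map_mul, ← Matrix.mulVec_mulVec, h1]
  let ρ : autGroup n Ω →* (F →L[ℝ] F) :=
    { toFun := fun g => LinearMap.toContinuousLinearMap
        ((dualRep n Ω g).mulVecLin.restrict (hF g))
      map_one' := by
        ext x : 2
        simp
      map_mul' := fun g h => by
        ext x : 2
        change dualRep n Ω (g * h) *ᵥ x.1 = dualRep n Ω g *ᵥ (dualRep n Ω h *ᵥ x.1)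
        rw [map_mul, Matrix.mulVec_mulVec] }
  have hρ : ∀ g (η : F), (ρ g η : Fin n → ℝ) = dualRep n Ω g *ᵥ η := fun g η => rfl
  have hρc : Continuous ρ := by
    rw [continuous_clm_apply]
    intro η
    exact ((continuous_dualRep n Ω).matrix_mulVec continuous_const).subtype_mk _
  have hev := eventually_eq_one_of_isCompact_connectedComponent (A := F →L[ℝ] F) ρ hρc hcomp
    (fun g hg => by
      refine ContinuousLinearMap.ext fun η => Subtype.ext ?_
      exact η.2 g hg)
  refine ⟨ρ.ker, inferInstance, ?_, ?_⟩
  · exact Subgroup.isOpen_of_mem_nhds _ (g := 1) hev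
  · obtain ⟨M', hM'⟩ := exists_affBound_of_mem_coerciveSet hne ho hc hε' C' r'
    refine ⟨M', fun g hg => hM' g ξ₀ hξ₀ ?_⟩
    have h1 : ρ g ⟨ξ₀, fun h hh => hfix ⟨h, hh⟩⟩ = ⟨ξ₀, fun h hh => hfix ⟨h, hh⟩⟩ := by
      rw [MonoidHom.mem_ker.1 hg]
      rfl
    have h2 : dualRep n Ω g *ᵥ ξ₀ = ξ₀ := congrArg Subtype.val h1
    rwa [h2]

open MeasureTheory
open scoped ENNReal

/-- The sum of `f` over the cosets of `N`, along the orbit of a point under the maps `a g`. -/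
def orbitSum {G E : Type*} [Group G] (N : Subgroup G) (a : G → E → E) (f : E → ℝ≥0∞) (x : E) :
    ℝ≥0∞ :=
  ∑' q : G ⧸ N, f (a q.out x)

theorem measurable_orbitSum {G E : Type*} [Group G] {N : Subgroup G} {a : G → E → E} [MeasurableSpace E]
    [Countable (G ⧸ N)] (ha : ∀ g, Measurable (a g))
    {f : E → ℝ≥0∞} (hf : Measurable f) : Measurable (orbitSum N a f) :=
  Measurable.tsum fun q => hf.comp (ha q.out)

section OrbitSum

variable {G E : Type*} [Group G] {N : Subgroup G} [N.Normal] {a : G → E → E}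

theorem apply_eq_of_mk_eq (hmul : ∀ g h x, a (g * h) x = a g (a h x)) {f : E → ℝ≥0∞}
    (hf : ∀ h ∈ N, ∀ x, f (a h x) = f x) {g g' : G} (h : (g : G ⧸ N) = g') (x : E) :
    f (a g x) = f (a g' x) := by
  have h1 : g' * g⁻¹ ∈ N := by
    rw [← QuotientGroup.eq_one_iff, QuotientGroup.mk_mul, QuotientGroup.mk_inv, h,
      mul_inv_cancel]
  have h2 := hf _ h1 (a g x)
  rwa [← hmul, inv_mul_cancel_right, eq_comm] at h2

theorem orbitSum_apply (hmul : ∀ g h x, a (g * h) x = a g (a h x)) {f : E → ℝ≥0∞}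
    (hf : ∀ h ∈ N, ∀ x, f (a h x) = f x) (g : G) (x : E) :
    orbitSum N a f (a g x) = orbitSum N a f x := by
  unfold orbitSum
  rw [← (Equiv.mulRight (g : G ⧸ N)).tsum_eq fun q : G ⧸ N => f (a q.out x)]
  refine tsum_congr fun q => ?_
  rw [← hmul]
  refine apply_eq_of_mk_eq hmul hf ?_ x
  simp

theorem le_orbitSum (hmul : ∀ g h x, a (g * h) x = a g (a h x)) {f : E → ℝ≥0∞}
    (hf : ∀ h ∈ N, ∀ x, f (a h x) = f x) (g : G) (x : E) : f (a g x) ≤ orbitSum N a f x := by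
  rw [apply_eq_of_mk_eq hmul hf (g' := (g : G ⧸ N).out) (by simp) x]
  exact ENNReal.le_tsum (f := fun q : G ⧸ N => f (a q.out x)) _

theorem lintegral_mul_orbitSum [MeasurableSpace E] [Countable (G ⧸ N)]
    (hmul : ∀ g h x, a (g * h) x = a g (a h x)) (hone : ∀ x, a 1 x = x)
    (ha : ∀ g, Measurable (a g)) {μ : Measure E}
    (hμ : ∀ g (F : E → ℝ≥0∞), Measurable F → ∫⁻ x, F (a g x) ∂μ = ∫⁻ x, F x ∂μ)
    {f₁ f₂ k : E → ℝ≥0∞}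
    (hf₂ : ∀ h ∈ N, ∀ x, f₂ (a h x) = f₂ x) (hk : ∀ g x, k (a g x) = k x)
    (mf₁ : Measurable f₁) (mf₂ : Measurable f₂) (mk : Measurable k) :
    ∫⁻ x, f₁ x * k x * orbitSum N a f₂ x ∂μ = ∫⁻ x, f₂ x * k x * orbitSum N a f₁ x ∂μ := by
  have hexp : ∀ {f f' : E → ℝ≥0∞}, Measurable f → Measurable f' →
      ∫⁻ x, f x * k x * orbitSum N a f' x ∂μ =
        ∑' q : G ⧸ N, ∫⁻ x, f x * k x * f' (a q.out x) ∂μ := fun {f f'} hf hf' => by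
    refine Eq.trans (lintegral_congr fun x => ENNReal.tsum_mul_left.symm) ?_
    exact lintegral_tsum fun q => ((hf.mul mk).mul (hf'.comp (ha q.out))).aemeasurable
  rw [hexp mf₁ mf₂, hexp mf₂ mf₁, ← (Equiv.inv (G ⧸ N)).tsum_eq]
  refine tsum_congr fun q => ?_
  refine (hμ q.out _ ((mf₁.mul mk).mul (mf₂.comp (ha _)))).symm.trans ?_
  refine lintegral_congr fun x => ?_
  have h1 : f₂ (a (q⁻¹).out (a q.out x)) = f₂ x := by
    rw [← hmul, apply_eq_of_mk_eq hmul hf₂ (g' := 1) (by simp) x, hone]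
  simp only [Pi.mul_apply, Function.comp_apply, Equiv.inv_apply, h1, hk]
  ring

end OrbitSum

theorem exists_fundamental_set {n : ℕ} {Ω : Set (Fin n → ℝ)} (hn : 1 ≤ n) (hne : Ω.Nonempty)
    (ho : IsOpen Ω) (hc : Convex ℝ Ω) (hl : HasNoLine n Ω) (hq : IsQuasiHomogeneous n Ω)
    (hcpt : IsCompact (AutIdComp n Ω)) :
    ∃ N : Subgroup (autGroup n Ω), N.Normal ∧ Countable (autGroup n Ω ⧸ N) ∧
      ∃ P : Set (Fin n → ℝ), MeasurableSet P ∧ (∃ ε > 0, ∃ C r : ℝ, P ⊆ coerciveSet Ω ε C r) ∧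
        (∀ h ∈ N, ∀ ξ, dualRep n Ω h *ᵥ ξ ∈ P ↔ ξ ∈ P) ∧
        (∀ ξ ∈ coerciveDual Ω, ∃ g, dualRep n Ω g *ᵥ ξ ∈ P) ∧
        ∀ ξ ∈ P, {q : autGroup n Ω ⧸ N | dualRep n Ω q.out *ᵥ ξ ∈ P}.Finite := by
  obtain ⟨N, hN, hNo, M, hM⟩ := exists_normal_affBound hne ho hc hl hcpt
  obtain ⟨ε₀, hε₀, C₀, r₀, hD⟩ := exists_dualRep_mem_coerciveSet hn hne ho hc hl hq
  obtain ⟨ε, hε, C, r, hmem⟩ := dualRep_mem_coerciveSet (M := M) (C := C₀) (r := r₀) Ω hε₀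
  have : DiscreteTopology (autGroup n Ω ⧸ N) := QuotientGroup.discreteTopology hNo
  have hfin : ∀ M : ℝ, {q : autGroup n Ω ⧸ N | ∃ g : autGroup n Ω, (g : autGroup n Ω ⧸ N) = q ∧
      AffBound n M g.1 ∧ AffBound n M (g⁻¹).1}.Finite := by
    intro M
    obtain ⟨K, hK, hK'⟩ := exists_isCompact_affBound ho hc M
    refine ((hK.image (QuotientGroup.continuous_mk (N := N))).finite_of_discrete).subset ?_
    rintro _ ⟨g, rfl, h1, h2⟩
    exact ⟨g, hK' g h1 h2, rfl⟩
  set P : Set (Fin n → ℝ) := {ξ | ∀ h ∈ N, dualRep n Ω h *ᵥ ξ ∈ coerciveSet Ω ε C r} with hP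
  have hPsub : P ⊆ coerciveSet Ω ε C r := fun ξ hξ => by
    simpa using hξ 1 N.one_mem
  have hPN : ∀ h ∈ N, ∀ ξ ∈ P, dualRep n Ω h *ᵥ ξ ∈ P := fun h hh ξ hξ h' hh' => by
    rw [Matrix.mulVec_mulVec, ← map_mul]
    exact hξ _ (N.mul_mem hh' hh)
  refine ⟨N, hN, ?_, P, ?_, ⟨ε, hε, C, r, hPsub⟩, ?_, ?_, ?_⟩
  · have huniv : (univ : Set (autGroup n Ω ⧸ N)) = ⋃ m : ℕ, {q | ∃ g : autGroup n Ω,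
        (g : autGroup n Ω ⧸ N) = q ∧ AffBound n m g.1 ∧ AffBound n m (g⁻¹).1} := by
      refine (eq_univ_of_forall fun q => ?_).symm
      obtain ⟨g, rfl⟩ := QuotientGroup.mk_surjective q
      obtain ⟨M₁, h₁⟩ := exists_affBound n g.1
      obtain ⟨M₂, h₂⟩ := exists_affBound n (g⁻¹).1
      obtain ⟨m, hm⟩ := exists_nat_ge (max M₁ M₂)
      exact mem_iUnion.2 ⟨m, g, rfl, h₁.mono ((le_max_left _ _).trans hm),
        h₂.mono ((le_max_right _ _).trans hm)⟩
    rw [← countable_univ_iff, huniv]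
    exact countable_iUnion fun m => (hfin m).countable
  · have : P = ⋂ h ∈ N, (fun ξ => dualRep n Ω h *ᵥ ξ) ⁻¹' coerciveSet Ω ε C r := by
      ext ξ
      simp [hP]
    rw [this]
    exact (isClosed_biInter fun h _ => (isClosed_coerciveSet Ω ε C r).preimage
      (continuous_const.matrix_mulVec continuous_id)).measurableSet
  · refine fun h hh ξ => ⟨fun hξ => ?_, hPN h hh ξ⟩
    rw [← dualRep_inv_mulVec h ξ]
    exact hPN _ (N.inv_mem hh) _ hξ
  · intro ξ hξ
    obtain ⟨g, hg⟩ := hD ξ hξ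
    exact ⟨g, fun h hh => hmem h (hM h hh).1 (hM h hh).2 _ hg⟩
  · intro ξ hξ
    obtain ⟨M', hM'⟩ := exists_affBound_of_mem_coerciveSet hne ho hc hε C r
    refine (hfin M').subset fun q hq => ⟨q.out, by simp, ?_⟩
    exact hM' _ ξ (hPsub hξ) (hPsub hq)

theorem dualRep_mul_mulVec {n : ℕ} {Ω : Set (Fin n → ℝ)} (g h : autGroup n Ω) (ξ : Fin n → ℝ) :
    dualRep n Ω (g * h) *ᵥ ξ = dualRep n Ω g *ᵥ (dualRep n Ω h *ᵥ ξ) := by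
  rw [map_mul, Matrix.mulVec_mulVec]

theorem indicator_dualRep {n : ℕ} {Ω : Set (Fin n → ℝ)} {P : Set (Fin n → ℝ)} {h : autGroup n Ω}
    (hh : ∀ ξ, dualRep n Ω h *ᵥ ξ ∈ P ↔ ξ ∈ P) (ξ : Fin n → ℝ) :
    P.indicator (1 : (Fin n → ℝ) → ℝ≥0∞) (dualRep n Ω h *ᵥ ξ) = P.indicator 1 ξ := by
  by_cases hξ : ξ ∈ P
  · rw [indicator_of_mem hξ, indicator_of_mem ((hh ξ).2 hξ), Pi.one_apply, Pi.one_apply]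
  · rw [indicator_of_notMem hξ, indicator_of_notMem fun h' => hξ ((hh ξ).1 h')]

theorem orbitSum_indicator_mem {n : ℕ} {Ω : Set (Fin n → ℝ)} {N : Subgroup (autGroup n Ω)}
    [N.Normal] {P : Set (Fin n → ℝ)} (hN : ∀ h ∈ N, ∀ ξ, dualRep n Ω h *ᵥ ξ ∈ P ↔ ξ ∈ P)
    (hD : ∀ ξ ∈ coerciveDual Ω, ∃ g, dualRep n Ω g *ᵥ ξ ∈ P)
    (hfin : ∀ ξ ∈ P, {q : autGroup n Ω ⧸ N | dualRep n Ω q.out *ᵥ ξ ∈ P}.Finite)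
    {ξ : Fin n → ℝ} (hξ : ξ ∈ coerciveDual Ω) :
    1 ≤ orbitSum N (fun g ξ => dualRep n Ω g *ᵥ ξ) (P.indicator 1) ξ ∧
      orbitSum N (fun g ξ => dualRep n Ω g *ᵥ ξ) (P.indicator 1) ξ ≠ ∞ := by
  have hinv := fun h hh => indicator_dualRep (hN h hh)
  obtain ⟨g, hg⟩ := hD ξ hξ
  constructor
  · refine le_trans ?_ (le_orbitSum (N := N) dualRep_mul_mulVec hinv g ξ)
    simp [hg]
  · rw [← orbitSum_apply (N := N) dualRep_mul_mulVec hinv g ξ, orbitSum, tsum_eq_sum (s := (hfin _ hg).toFinset)]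
    · refine (ENNReal.sum_lt_top.2 fun q _ => ?_).ne
      exact (indicator_le_self' (fun _ _ => zero_le) _).trans_lt ENNReal.one_lt_top
    · intro q hq
      rw [Finite.mem_toFinset] at hq
      exact indicator_of_notMem (s := P) hq _

theorem measurable_volume_cap {n : ℕ} {Ω : Set (Fin n → ℝ)} (ho : IsOpen Ω) (t : ℝ) :
    Measurable fun ξ => volume (cap Ω t ξ) := by
  have h1 : MeasurableSet {z : (Fin n → ℝ) × (Fin n → ℝ) | z.2 ∈ cap Ω t z.1} := by
    have : {z : (Fin n → ℝ) × (Fin n → ℝ) | z.2 ∈ cap Ω t z.1} =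
        Prod.snd ⁻¹' Ω ∩ ⋂ y ∈ Ω, {z | z.1 ⬝ᵥ z.2 ≤ z.1 ⬝ᵥ y + t} := by
      ext z
      simp [cap]
    rw [this]
    refine (ho.preimage continuous_snd).measurableSet.inter (IsClosed.measurableSet ?_)
    exact isClosed_biInter fun y _ => isClosed_le (by fun_prop) (by fun_prop)
  exact measurable_measure_prodMk_left h1

theorem volume_affAct_image {n : ℕ} (g : GL (Fin (n + 1)) ℝ) (s : Set (Fin n → ℝ)) :
    volume (affAct n g '' s) = ENNReal.ofReal |(linPart n g).det| * volume s := by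
  have h1 : affAct n g '' s =
      (fun x => x + affAct n g 0) '' ((Matrix.toLin' (linPart n g)) '' s) := by
    rw [image_image]
    refine image_congr fun x _ => ?_
    rw [affAct_eq, Matrix.toLin'_apply]
  rw [h1, image_add_right, measure_preimage_add_right, Measure.addHaar_image_linearMap,
    LinearMap.det_toLin']

theorem volume_cap_dualRep {n : ℕ} {Ω : Set (Fin n → ℝ)} (g : autGroup n Ω) (t : ℝ)
    (ξ : Fin n → ℝ) : volume (cap Ω t (dualRep n Ω g *ᵥ ξ)) =
      ENNReal.ofReal |(linPart n g.1).det| * volume (cap Ω t ξ) := by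
  rw [← affAct_image_cap, volume_affAct_image]

theorem lintegral_dualRep {n : ℕ} {Ω : Set (Fin n → ℝ)} (g : autGroup n Ω)
    {F : (Fin n → ℝ) → ℝ≥0∞} (hF : Measurable F) :
    ∫⁻ ξ, F (dualRep n Ω g *ᵥ ξ) = ENNReal.ofReal |(linPart n g.1).det| * ∫⁻ ξ, F ξ := by
  have hdet := det_dualRep g
  have h0 : (dualRep n Ω g).det ≠ 0 := left_ne_zero_of_mul_eq_one hdet
  have h1 := Real.map_matrix_volume_pi_eq_smul_volume_pi h0
  have h2 : Measurable (Matrix.toLin' (dualRep n Ω g)) :=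
    (LinearMap.continuous_of_finiteDimensional _).measurable
  have h3 := lintegral_map (μ := volume) hF h2
  rw [h1, lintegral_smul_measure, inv_eq_of_mul_eq_one_right hdet] at h3
  simpa using h3.symm

theorem cap_inv_smul {n : ℕ} (Ω : Set (Fin n → ℝ)) {k : ℝ} (hk : 0 < k) (ξ : Fin n → ℝ) :
    cap Ω 1 (k⁻¹ • ξ) = cap Ω k ξ := by
  ext x
  refine and_congr_right fun _ => forall₂_congr fun y _ => ?_
  rw [smul_dotProduct, smul_dotProduct, smul_eq_mul, smul_eq_mul, inv_mul_le_iff₀ hk, mul_add,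
    mul_inv_cancel_left₀ hk.ne', mul_one]

theorem exists_forall_dotProduct_le {n : ℕ} {Ω : Set (Fin n → ℝ)} (hne : Ω.Nonempty)
    {ξ : Fin n → ℝ} (hξ : ξ ∈ coerciveDual Ω) : ∃ p ∈ closure Ω, ∀ y ∈ Ω, ξ ⬝ᵥ p ≤ ξ ⬝ᵥ y := by
  obtain ⟨ε, hε, C, r, hξ'⟩ := mem_coerciveSet_of_mem_coerciveDual hξ
  obtain ⟨R, -, hR⟩ := cap_subset_closedBall hne hε C r 1
  have hbdd : Bornology.IsBounded (cap Ω 1 ξ) :=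
    Metric.isBounded_closedBall.subset fun x hx => mem_closedBall_zero_iff.2 (hR ξ hξ' x hx)
  obtain ⟨z, hz⟩ := cap_nonempty hne hξ one_pos
  obtain ⟨p, hp, hmin⟩ := hbdd.isCompact_closure.exists_isMinOn ⟨z, subset_closure hz⟩
    (f := fun x => ξ ⬝ᵥ x) (by fun_prop)
  refine ⟨p, closure_mono (fun x hx => hx.1) hp, fun y hy => ?_⟩
  by_cases hy' : y ∈ cap Ω 1 ξ
  · exact hmin (subset_closure hy')
  · have h1 : ∃ y' ∈ Ω, ξ ⬝ᵥ y' + 1 < ξ ⬝ᵥ y := by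
      by_contra! h
      exact hy' ⟨hy, h⟩
    obtain ⟨y', hy', hlt⟩ := h1
    have h2 : ξ ⬝ᵥ p ≤ ξ ⬝ᵥ z := hmin (subset_closure hz)
    linarith [hz.2 y' hy']

theorem cap_subset_homothety {n : ℕ} {Ω : Set (Fin n → ℝ)} (ho : IsOpen Ω) (hc : Convex ℝ Ω)
    {ξ p : Fin n → ℝ} (hp : p ∈ closure Ω) (hmin : ∀ y ∈ Ω, ξ ⬝ᵥ p ≤ ξ ⬝ᵥ y) {k : ℝ} (hk : 1 ≤ k)
    (t : ℝ) : cap Ω (k * t) ξ ⊆ AffineMap.homothety p k '' cap Ω t ξ := by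
  have hk0 : 0 < k := one_pos.trans_le hk
  rintro x ⟨hx, hx'⟩
  refine ⟨p + k⁻¹ • (x - p), ⟨?_, fun y hy => ?_⟩, ?_⟩
  · have h1 := hc.add_smul_sub_mem_interior' hp (ho.interior_eq.symm ▸ hx)
      (t := k⁻¹) ⟨inv_pos.2 hk0, inv_le_one_of_one_le₀ hk⟩
    exact interior_subset h1
  · have h2 : ξ ⬝ᵥ x ≤ ξ ⬝ᵥ p + k * t := by
      have hcl : IsClosed {y | ξ ⬝ᵥ x ≤ ξ ⬝ᵥ y + k * t} :=
        isClosed_le (by fun_prop) (by fun_prop)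
      exact hcl.closure_subset_iff.2 (fun y hy => hx' y hy) hp
    rw [dotProduct_add, dotProduct_smul, dotProduct_sub, smul_eq_mul]
    have h3 : k⁻¹ * (ξ ⬝ᵥ x - ξ ⬝ᵥ p) ≤ t := by
      rw [inv_mul_le_iff₀ hk0]
      linarith
    linarith [hmin y hy]
  · simp [AffineMap.homothety_apply, smul_smul, hk0.ne']

theorem volume_homothety_image {n : ℕ} (p : Fin n → ℝ) {k : ℝ} (hk : 0 ≤ k)
    (s : Set (Fin n → ℝ)) :
    volume (AffineMap.homothety p k '' s) = ENNReal.ofReal (k ^ n) * volume s := by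
  rw [Measure.addHaar_image_homothety, Module.finrank_fin_fun, abs_of_nonneg (pow_nonneg hk n)]

theorem volume_cap_le {n : ℕ} {Ω : Set (Fin n → ℝ)} (hne : Ω.Nonempty) (ho : IsOpen Ω)
    (hc : Convex ℝ Ω) {ξ : Fin n → ℝ} (hξ : ξ ∈ coerciveDual Ω) {k : ℝ} (hk : 1 ≤ k) :
    volume (cap Ω k ξ) ≤ ENNReal.ofReal (k ^ n) * volume (cap Ω 1 ξ) := by
  obtain ⟨p, hp, hmin⟩ := exists_forall_dotProduct_le hne hξ
  rw [← volume_homothety_image p (zero_le_one.trans hk)]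
  refine measure_mono ?_
  have h := cap_subset_homothety ho hc hp hmin hk 1
  rwa [mul_one] at h

theorem cone_of_volume_cap {n : ℕ} {Ω : Set (Fin n → ℝ)} (hne : Ω.Nonempty) (ho : IsOpen Ω)
    (hc : Convex ℝ Ω) {ξ : Fin n → ℝ} (hξ : ξ ∈ coerciveDual Ω)
    (hvol : ∀ k : ℕ, 1 ≤ k →
      volume (cap Ω k ξ) = ENNReal.ofReal ((k : ℝ) ^ n) * volume (cap Ω 1 ξ)) :
    IsCone n Ω := by
  obtain ⟨p, hp, hmin⟩ := exists_forall_dotProduct_le hne hξ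
  have h_int : interior (closure Ω) = Ω := by
    rw [hc.interior_closure_eq_interior_of_nonempty_interior (by rwa [ho.interior_eq]),
      ho.interior_eq]
  have hnat : ∀ x ∈ Ω, ∀ k : ℕ, 1 ≤ k → p + (k : ℝ) • (x - p) ∈ Ω := by
    intro x hx k hk
    have hk0 : (0 : ℝ) < k := by exact_mod_cast hk
    obtain ⟨j, hj⟩ := exists_nat_gt (ξ ⬝ᵥ x - ξ ⬝ᵥ p)
    have hj1 : 1 ≤ j := by
      have : (0 : ℝ) < j := by linarith [hmin x hx]
      exact_mod_cast this
    set U : Set (Fin n → ℝ) := Ω ∩ {y | ξ ⬝ᵥ y < ξ ⬝ᵥ p + j} with hU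
    have hUo : IsOpen U := ho.inter (isOpen_lt (by fun_prop) (by fun_prop))
    have hUcap : U ⊆ cap Ω j ξ := fun y hy =>
      ⟨hy.1, fun z hz => (le_of_lt hy.2).trans (by linarith [hmin z hz])⟩
    set A := cap Ω (k * j) ξ
    set B := AffineMap.homothety p (k : ℝ) '' cap Ω j ξ
    set V := AffineMap.homothety p (k : ℝ) '' U
    have hVo : IsOpen V := AffineMap.homothety_isOpenMap p _ hk0.ne' U hUo
    have hAB : A ⊆ B := cap_subset_homothety ho hc hp hmin (by exact_mod_cast hk) _
    have hA : volume A = volume B := by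
      have h1 := hvol (k * j) (one_le_mul hk hj1)
      rw [Nat.cast_mul] at h1
      rw [volume_homothety_image p hk0.le, hvol j hj1, h1, mul_pow,
        ENNReal.ofReal_mul (by positivity), mul_assoc]
    have hfin : volume A ≠ ∞ := by
      obtain ⟨ε, hε, C, r, hξ'⟩ := mem_coerciveSet_of_mem_coerciveDual hξ
      obtain ⟨R, -, hR⟩ := cap_subset_closedBall hne hε C r (k * j)
      refine ((measure_mono fun x hx => mem_closedBall_zero_iff.2 (hR ξ hξ' x hx)).trans_lt
        measure_closedBall_lt_top).ne
    have hAm : NullMeasurableSet A volume := (convex_cap hc _ ξ).nullMeasurableSet volume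
    have hnull : volume (B \ A) = 0 := by
      rw [measure_sdiff hAB hAm hfin, hA, tsub_self]
    have hempty : V \ closure A = ∅ := by
      rw [← (hVo.sdiff isClosed_closure).measure_eq_zero_iff volume]
      exact measure_mono_null (sdiff_subset_sdiff (image_mono hUcap) subset_closure) hnull
    have hVΩ : V ⊆ Ω := by
      rw [← h_int]
      refine interior_maximal ?_ hVo
      exact (sdiff_eq_empty.1 hempty).trans (closure_mono fun y hy => hy.1)
    have hxV : p + (k : ℝ) • (x - p) ∈ V :=
      ⟨x, ⟨hx, by rw [mem_ofPred_eq]; linarith⟩, by simp [AffineMap.homothety_apply, add_comm]⟩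
    exact hVΩ hxV
  refine ⟨p, fun x hx t ht => ?_⟩
  obtain ⟨k, hk⟩ := exists_nat_ge (max 1 t)
  have hk1 : (1 : ℝ) ≤ k := (le_max_left _ _).trans hk
  have hk0 : (0 : ℝ) < k := one_pos.trans_le hk1
  have h1 := hnat x hx k (by exact_mod_cast hk1)
  have h2 := hc.add_smul_sub_mem_interior' hp (ho.interior_eq.symm ▸ h1)
    (t := t / k) ⟨by positivity, (div_le_one hk0).2 ((le_max_right _ _).trans hk)⟩
  rw [add_sub_cancel_left, smul_smul, div_mul_cancel₀ _ hk0.ne'] at h2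
  exact interior_subset h2

theorem coerciveDual_volume_ne_zero {n : ℕ} {Ω : Set (Fin n → ℝ)} (hD : (coerciveDual Ω).Nonempty)
    {N : Subgroup (autGroup n Ω)} [Countable (autGroup n Ω ⧸ N)] [N.Normal]
    {P : Set (Fin n → ℝ)} (hN : ∀ h ∈ N, ∀ ξ, dualRep n Ω h *ᵥ ξ ∈ P ↔ ξ ∈ P)
    (hP : ∀ ξ ∈ coerciveDual Ω, ∃ g, dualRep n Ω g *ᵥ ξ ∈ P) : volume P ≠ 0 := by
  intro h0
  refine (isOpen_coerciveDual Ω).measure_ne_zero volume hD ?_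
  refine measure_mono_null (t := ⋃ q : autGroup n Ω ⧸ N,
    Matrix.toLin' (dualRep n Ω q.out) ⁻¹' P) (fun ξ hξ => ?_) (measure_iUnion_null fun q => ?_)
  · obtain ⟨g, hg⟩ := hP ξ hξ
    refine mem_iUnion.2 ⟨g, ?_⟩
    have h1 := apply_eq_of_mk_eq (a := fun g ξ => dualRep n Ω g *ᵥ ξ) dualRep_mul_mulVec
      (fun h hh => indicator_dualRep (hN h hh)) (g := g) (g' := (g : autGroup n Ω ⧸ N).out)
      (by simp) ξ
    rw [indicator_of_mem hg] at h1
    by_contra h2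
    have h3 : dualRep n Ω (g : autGroup n Ω ⧸ N).out *ᵥ ξ ∉ P := h2
    rw [indicator_of_notMem h3] at h1
    exact one_ne_zero h1
  · rw [Measure.addHaar_preimage_linearMap, h0, mul_zero]
    rw [LinearMap.det_toLin']
    exact left_ne_zero_of_mul_eq_one (det_dualRep q.out)

theorem lintegral_comp_smul_pi {n : ℕ} {F : (Fin n → ℝ) → ℝ≥0∞} (hF : Measurable F) {k : ℝ}
    (hk : 0 < k) : ∫⁻ ξ, F (k • ξ) = ENNReal.ofReal (k ^ n)⁻¹ * ∫⁻ ξ, F ξ := by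
  have h1 := Measure.map_addHaar_smul (volume : Measure (Fin n → ℝ)) hk.ne'
  have h2 := lintegral_map (μ := (volume : Measure (Fin n → ℝ))) hF (measurable_const_smul k)
  rw [h1, lintegral_smul_measure, Module.finrank_fin_fun, abs_of_pos (by positivity)] at h2
  exact h2.symm

/-- The density of the invariant measure on the functionals coercive on `Ω`. -/
def capDensity {n : ℕ} (Ω : Set (Fin n → ℝ)) : (Fin n → ℝ) → ℝ≥0∞ :=
  (coerciveDual Ω).indicator fun ξ => volume (cap Ω 1 ξ)

theorem measurable_capDensity {n : ℕ} {Ω : Set (Fin n → ℝ)} (ho : IsOpen Ω) :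
    Measurable (capDensity Ω) :=
  (measurable_volume_cap ho 1).indicator (isOpen_coerciveDual Ω).measurableSet

theorem capDensity_dualRep {n : ℕ} {Ω : Set (Fin n → ℝ)} (g : autGroup n Ω) (ξ : Fin n → ℝ) :
    capDensity Ω (dualRep n Ω g *ᵥ ξ) =
      ENNReal.ofReal |(linPart n g.1).det| * capDensity Ω ξ := by
  unfold capDensity
  by_cases hξ : ξ ∈ coerciveDual Ω
  · rw [indicator_of_mem hξ, indicator_of_mem (dualRep_mem_coerciveDual g hξ), volume_cap_dualRep]
  · rw [indicator_of_notMem hξ, indicator_of_notMem fun h => hξ ((dualRep_mem_coerciveDual_iff g).1 h),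
      mul_zero]

theorem lintegral_capDensity_dualRep {n : ℕ} {Ω : Set (Fin n → ℝ)} (ho : IsOpen Ω)
    (g : autGroup n Ω) {F : (Fin n → ℝ) → ℝ≥0∞} (hF : Measurable F) :
    ∫⁻ ξ, F (dualRep n Ω g *ᵥ ξ) ∂(volume.withDensity (capDensity Ω)) =
      ∫⁻ ξ, F ξ ∂(volume.withDensity (capDensity Ω)) := by
  have hw := measurable_capDensity ho
  have hm : Measurable fun ξ => dualRep n Ω g *ᵥ ξ :=
    (continuous_const.matrix_mulVec continuous_id).measurable
  have hdet : ENNReal.ofReal |(linPart n g.1).det| ≠ 0 := by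
    rw [Ne, ENNReal.ofReal_eq_zero, not_le, abs_pos]
    exact right_ne_zero_of_mul_eq_one (det_dualRep g)
  have h1 := lintegral_dualRep g (hw.mul hF)
  simp only [Pi.mul_apply, capDensity_dualRep, mul_assoc] at h1
  have h2 := (lintegral_const_mul (μ := volume) (ENNReal.ofReal |(linPart n g.1).det|)
    (hw.mul (hF.comp hm))).symm.trans h1
  rw [ENNReal.mul_right_inj hdet ENNReal.ofReal_ne_top] at h2
  exact (lintegral_withDensity_eq_lintegral_mul _ hw (hF.comp hm)).trans
    (h2.trans (lintegral_withDensity_eq_lintegral_mul _ hw hF).symm)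

theorem isCone_of_isCompact_autIdComp {n : ℕ} {Ω : Set (Fin n → ℝ)} (hn : 1 ≤ n)
    (hne : Ω.Nonempty) (ho : IsOpen Ω) (hc : Convex ℝ Ω) (hl : HasNoLine n Ω)
    (hq : IsQuasiHomogeneous n Ω) (hcpt : IsCompact (AutIdComp n Ω)) : IsCone n Ω := by
  obtain ⟨N, hN, hcount, P, hPm, ⟨ε, hε, C, r, hPsub⟩, hPN, hPD, hfin⟩ :=
    exists_fundamental_set hn hne ho hc hl hq hcpt
  set a : autGroup n Ω → (Fin n → ℝ) → (Fin n → ℝ) := fun g ξ => dualRep n Ω g *ᵥ ξ with ha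
  set f : (Fin n → ℝ) → ℝ≥0∞ := P.indicator 1 with hf
  set c := orbitSum N a f with hcdef
  have hfm : Measurable f := measurable_one.indicator hPm
  have ham : ∀ g, Measurable (a g) := fun g =>
    (continuous_const.matrix_mulVec continuous_id).measurable
  have hcm : Measurable c := measurable_orbitSum ham hfm
  have hfN : ∀ h ∈ N, ∀ ξ, f (a h ξ) = f ξ := fun h hh => indicator_dualRep (hPN h hh)
  have hcG : ∀ g ξ, c (a g ξ) = c ξ := orbitSum_apply dualRep_mul_mulVec hfN
  have hc1 : ∀ ξ ∈ coerciveDual Ω, 1 ≤ c ξ ∧ c ξ ≠ ∞ := fun ξ hξ =>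
    orbitSum_indicator_mem hPN hPD hfin hξ
  have hPdual : P ⊆ coerciveDual Ω := hPsub.trans (coerciveSet_subset hε)
  have hsmul : ∀ (k : ℝ) g ξ, a g (k • ξ) = k • a g ξ := fun k g ξ => Matrix.mulVec_smul _ _ _
  have key : ∀ k : ℕ, 1 ≤ k → ∀ᵐ ξ : Fin n → ℝ, ξ ∈ P →
      volume (cap Ω k ξ) = ENNReal.ofReal ((k : ℝ) ^ n) * volume (cap Ω 1 ξ) := by
    intro k hk
    have hk1 : (1 : ℝ) ≤ k := by exact_mod_cast hk
    have hk0 : (0 : ℝ) < k := one_pos.trans_le hk1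
    have hkm : Measurable fun ξ : Fin n → ℝ => (k : ℝ) • ξ := measurable_const_smul _
    set g₁ : (Fin n → ℝ) → ℝ≥0∞ := fun ξ => f ξ * (c ξ)⁻¹ * volume (cap Ω 1 ξ) with hg₁
    set g₂ : (Fin n → ℝ) → ℝ≥0∞ := fun ξ => f ξ * (c ξ)⁻¹ * volume (cap Ω k ξ) with hg₂
    have hg₁m : Measurable g₁ := (hfm.mul hcm.inv).mul (measurable_volume_cap ho 1)
    have hg₂m : Measurable g₂ := (hfm.mul hcm.inv).mul (measurable_volume_cap ho k)
    have hck : orbitSum N a (fun ξ => f ((k : ℝ) • ξ)) = fun ξ => c ((k : ℝ) • ξ) := by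
      ext ξ
      simp only [hcdef, orbitSum, hsmul]
    have h_int : ∫⁻ ξ, g₁ ξ = ENNReal.ofReal ((k : ℝ) ^ n)⁻¹ * ∫⁻ ξ, g₂ ξ := by
      have hhm : Measurable fun ξ => (c ξ)⁻¹ * (c ((k : ℝ) • ξ))⁻¹ :=
        hcm.inv.mul (hcm.comp hkm).inv
      have h1 := lintegral_mul_orbitSum (N := N) (a := a) (f₁ := f)
        (f₂ := fun ξ => f ((k : ℝ) • ξ)) (k := fun ξ => (c ξ)⁻¹ * (c ((k : ℝ) • ξ))⁻¹)
        dualRep_mul_mulVec (fun ξ => by simp [ha]) ham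
        (fun g F hF => lintegral_capDensity_dualRep ho g hF)
        (fun h hh ξ => by rw [← hsmul, hfN h hh]) (fun g ξ => by rw [← hsmul, hcG, hcG])
        hfm (hfm.comp hkm) hhm
      rw [hck, ← hcdef] at h1
      have hw := measurable_capDensity ho
      have h1' := (lintegral_withDensity_eq_lintegral_mul volume hw
        ((hfm.mul hhm).mul (hcm.comp hkm))).symm.trans (h1.trans
          (lintegral_withDensity_eq_lintegral_mul volume hw
            (((hfm.comp hkm).mul hhm).mul hcm)))
      rw [← lintegral_comp_smul_pi hg₂m hk0]
      refine Eq.trans (lintegral_congr fun ξ => ?_) (h1'.trans (lintegral_congr fun ξ => ?_))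
      · by_cases hξ : ξ ∈ coerciveDual Ω
        · obtain ⟨h2, h3⟩ := hc1 _ (smul_mem_coerciveDual hξ hk0)
          have h4 := ENNReal.inv_mul_cancel (one_pos.trans_le h2).ne' h3
          calc g₁ ξ = f ξ * (c ξ)⁻¹ * volume (cap Ω 1 ξ) * 1 := (mul_one _).symm
            _ = _ := by
              rw [← h4]
              simp only [Pi.mul_apply, Function.comp_apply, capDensity, indicator_of_mem hξ]
              ring
        · have h2 : f ξ = 0 := indicator_of_notMem (fun h => hξ (hPdual h)) _
          simp [hg₁, h2]
      · by_cases hξ : ξ ∈ coerciveDual Ω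
        · obtain ⟨h2, h3⟩ := hc1 _ hξ
          have h4 := ENNReal.inv_mul_cancel (one_pos.trans_le h2).ne' h3
          have h5 : cap Ω 1 ξ = cap Ω k ((k : ℝ) • ξ) := by
            rw [← cap_inv_smul Ω hk0, inv_smul_smul₀ hk0.ne']
          refine Eq.trans ?_ (mul_one _)
          rw [← h4]
          simp only [Pi.mul_apply, capDensity, indicator_of_mem hξ, hg₂, ← h5]
          ring
        · have h2 : f ((k : ℝ) • ξ) = 0 := indicator_of_notMem
            (fun h => hξ ((smul_mem_coerciveDual_iff hk0).1 (hPdual h))) _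
          simp [hg₂, h2]
    have hkinv : ENNReal.ofReal ((k : ℝ) ^ n)⁻¹ * ENNReal.ofReal ((k : ℝ) ^ n) = 1 := by
      rw [← ENNReal.ofReal_mul (by positivity), inv_mul_cancel₀ (by positivity),
        ENNReal.ofReal_one]
    have hle : ∀ ξ, ENNReal.ofReal ((k : ℝ) ^ n)⁻¹ * g₂ ξ ≤ g₁ ξ := by
      intro ξ
      by_cases hξ : ξ ∈ P
      · calc ENNReal.ofReal ((k : ℝ) ^ n)⁻¹ * g₂ ξ
            ≤ ENNReal.ofReal ((k : ℝ) ^ n)⁻¹ * (f ξ * (c ξ)⁻¹ *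
              (ENNReal.ofReal ((k : ℝ) ^ n) * volume (cap Ω 1 ξ))) := by
              gcongr
              exact mul_le_mul_right (volume_cap_le hne ho hc (hPdual hξ) hk1) _
          _ = (ENNReal.ofReal ((k : ℝ) ^ n)⁻¹ * ENNReal.ofReal ((k : ℝ) ^ n)) * g₁ ξ := by
              rw [hg₁]
              ring
          _ = g₁ ξ := by rw [hkinv, one_mul]
      · have h2 : f ξ = 0 := indicator_of_notMem hξ _
        simp [hg₂, h2]
    have hfinite : ∫⁻ ξ, g₁ ξ ≠ ∞ := by
      obtain ⟨R, -, hR⟩ := cap_subset_closedBall hne hε C r 1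
      have hbd : ∀ ξ, g₁ ξ ≤ (Metric.closedBall (0 : Fin n → ℝ) r).indicator
          (fun _ => volume (Metric.closedBall (0 : Fin n → ℝ) R)) ξ := by
        intro ξ
        by_cases hξ : ξ ∈ P
        · rw [indicator_of_mem (mem_closedBall_zero_iff.2 (hPsub hξ).1)]
          have h1 : f ξ = 1 := indicator_of_mem hξ _
          have h2 : (c ξ)⁻¹ ≤ 1 := ENNReal.inv_le_one.2 (hc1 ξ (hPdual hξ)).1
          calc g₁ ξ ≤ 1 * 1 * volume (cap Ω 1 ξ) := by
                rw [hg₁]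
                beta_reduce
                rw [h1]
                gcongr
            _ ≤ _ := by
                rw [one_mul, one_mul]
                exact measure_mono fun x hx => mem_closedBall_zero_iff.2 (hR ξ (hPsub hξ) x hx)
        · have h2 : f ξ = 0 := indicator_of_notMem hξ _
          simp [hg₁, h2]
      refine ((lintegral_mono hbd).trans_lt ?_).ne
      rw [lintegral_indicator_const Metric.isClosed_closedBall.measurableSet]
      exact ENNReal.mul_lt_top measure_closedBall_lt_top measure_closedBall_lt_top
    have hae : (fun ξ => ENNReal.ofReal ((k : ℝ) ^ n)⁻¹ * g₂ ξ) =ᵐ[volume] g₁ := by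
      refine ae_eq_of_ae_le_of_lintegral_le (Filter.Eventually.of_forall hle) ?_
        hg₁m.aemeasurable ?_
      · rw [lintegral_const_mul _ hg₂m, ← h_int]
        exact hfinite
      · rw [lintegral_const_mul _ hg₂m, ← h_int]
    filter_upwards [hae] with ξ hξ hξP
    obtain ⟨h2, h3⟩ := hc1 ξ (hPdual hξP)
    have h1 : f ξ = 1 := indicator_of_mem hξP _
    rw [hg₁, hg₂] at hξ
    beta_reduce at hξ
    rw [h1, one_mul, mul_left_comm, ENNReal.mul_right_inj (ENNReal.inv_ne_zero.2 h3)
      (ENNReal.inv_ne_top.2 (one_pos.trans_le h2).ne')] at hξ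
    rw [← hξ, ← mul_assoc, mul_comm (ENNReal.ofReal _), hkinv, one_mul]
  have hvol := coerciveDual_volume_ne_zero (coerciveDual_nonempty hne ho hc hl) hPN hPD
  have hall : ∀ᵐ ξ : Fin n → ℝ, ∀ k : ℕ, 1 ≤ k → ξ ∈ P →
      volume (cap Ω k ξ) = ENNReal.ofReal ((k : ℝ) ^ n) * volume (cap Ω 1 ξ) :=
    ae_all_iff.2 fun k => by
      by_cases hk : 1 ≤ k
      · filter_upwards [key k hk] with ξ hξ _ using hξ
      · exact Filter.Eventually.of_forall fun ξ h => absurd h hk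
  obtain ⟨ξ, hξP, hξ⟩ := ((frequently_ae_mem_iff.2 hvol).and_eventually hall).exists
  exact cone_of_volume_cap hne ho hc (hPdual hξP) fun k hk => hξ k hk hξP

/-- The homothety of ratio `t` centred at `p`, as a matrix of affine form. -/
def homothetyMatrix {n : ℕ} (p : Fin n → ℝ) (t : ℝ) : Matrix (Fin (n + 1)) (Fin (n + 1)) ℝ :=
  Matrix.of fun i j => Fin.lastCases (if j = Fin.last n then 1 else 0)
    (fun i' => Fin.lastCases ((1 - t) * p i') (fun j' => if i' = j' then t else 0) j) i

theorem homothetyMatrix_mul {n : ℕ} (p : Fin n → ℝ) (s t : ℝ) :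
    homothetyMatrix p s * homothetyMatrix p t = homothetyMatrix p (s * t) := by
  ext i j
  rw [Matrix.mul_apply, Fin.sum_univ_castSucc]
  refine Fin.lastCases ?_ (fun i => ?_) i <;> refine Fin.lastCases ?_ (fun j => ?_) j
  · simp [homothetyMatrix, (Fin.castSucc_lt_last _).ne]
  · simp [homothetyMatrix, (Fin.castSucc_lt_last _).ne]
  · simp [homothetyMatrix]
    ring
  · simp [homothetyMatrix, (Fin.castSucc_lt_last _).ne]

theorem homothetyMatrix_one {n : ℕ} (p : Fin n → ℝ) : homothetyMatrix p 1 = 1 := by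
  ext i j
  refine Fin.lastCases ?_ (fun i => ?_) i <;> refine Fin.lastCases ?_ (fun j => ?_) j
  · simp [homothetyMatrix]
  · simp [homothetyMatrix, (Fin.castSucc_lt_last _).ne, (Fin.castSucc_lt_last _).ne']
  · simp [homothetyMatrix, (Fin.castSucc_lt_last _).ne]
  · simp [homothetyMatrix, Matrix.one_apply]

theorem continuous_homothetyMatrix {n : ℕ} (p : Fin n → ℝ) : Continuous (homothetyMatrix p) := by
  refine continuous_matrix fun i j => ?_
  refine Fin.lastCases ?_ (fun i => ?_) i <;> refine Fin.lastCases ?_ (fun j => ?_) j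
  · simp only [homothetyMatrix, of_apply, Fin.lastCases_last]
    fun_prop
  · simp only [homothetyMatrix, of_apply, Fin.lastCases_last]
    fun_prop
  · simp only [homothetyMatrix, of_apply, Fin.lastCases_last, Fin.lastCases_castSucc]
    fun_prop
  · simp only [homothetyMatrix, of_apply, Fin.lastCases_castSucc]
    split_ifs <;> fun_prop

/-- The homothety of ratio `exp s` centred at `p`, as an element of `GL(n+1,ℝ)`. -/
def homothetyGL {n : ℕ} (p : Fin n → ℝ) (s : ℝ) : GL (Fin (n + 1)) ℝ where
  val := homothetyMatrix p (Real.exp s)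
  inv := homothetyMatrix p (Real.exp (-s))
  val_inv := by rw [homothetyMatrix_mul, ← Real.exp_add, add_neg_cancel, Real.exp_zero,
    homothetyMatrix_one]
  inv_val := by rw [homothetyMatrix_mul, ← Real.exp_add, neg_add_cancel, Real.exp_zero,
    homothetyMatrix_one]

theorem continuous_homothetyGL {n : ℕ} (p : Fin n → ℝ) : Continuous (homothetyGL p) := by
  rw [Units.continuous_iff]
  exact ⟨(continuous_homothetyMatrix p).comp Real.continuous_exp,
    (continuous_homothetyMatrix p).comp (Real.continuous_exp.comp continuous_neg)⟩

theorem homothetyGL_zero {n : ℕ} (p : Fin n → ℝ) : homothetyGL p 0 = 1 := by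
  ext1
  change homothetyMatrix p (Real.exp 0) = 1
  rw [Real.exp_zero, homothetyMatrix_one]

theorem homothetyGL_inv {n : ℕ} (p : Fin n → ℝ) (s : ℝ) :
    (homothetyGL p s)⁻¹ = homothetyGL p (-s) := by
  ext1
  rfl

theorem affAct_homothetyGL {n : ℕ} (p : Fin n → ℝ) (s : ℝ) (x : Fin n → ℝ) :
    affAct n (homothetyGL p s) x = p + Real.exp s • (x - p) := by
  ext i
  simp [affAct, homothetyGL, homothetyMatrix]
  ring

theorem homothetyGL_mem_autSet {n : ℕ} {Ω : Set (Fin n → ℝ)} {p : Fin n → ℝ}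
    (hp : ∀ x ∈ Ω, ∀ t : ℝ, 0 < t → p + t • (x - p) ∈ Ω) (s : ℝ) :
    homothetyGL p s ∈ AutSet n Ω := by
  rw [mem_autSet_iff, homothetyGL_inv]
  simp only [affAct_homothetyGL]
  refine ⟨⟨fun j => ?_, ?_⟩, fun x hx => hp x hx _ (Real.exp_pos _),
    fun x hx => hp x hx _ (Real.exp_pos _)⟩
  · simp [homothetyGL, homothetyMatrix, (Fin.castSucc_lt_last _).ne]
  · simp [homothetyGL, homothetyMatrix]

theorem IsCone.not_isCompact_autIdComp {n : ℕ} {Ω : Set (Fin n → ℝ)} (hn : 1 ≤ n)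
    (h : IsCone n Ω) : ¬ IsCompact (AutIdComp n Ω) := by
  obtain ⟨p, hp⟩ := h
  intro hcpt
  have hsub : range (homothetyGL p) ⊆ AutIdComp n Ω :=
    (isPreconnected_range (continuous_homothetyGL p)).subset_connectedComponentIn
      ⟨0, homothetyGL_zero p⟩ (range_subset_iff.2 (homothetyGL_mem_autSet hp))
  set i : Fin (n + 1) := (⟨0, hn⟩ : Fin n).castSucc with hi
  have hcont : Continuous fun g : GL (Fin (n + 1)) ℝ => g.val i i :=
    Units.continuous_val.matrix_elem i i
  obtain ⟨M, hM⟩ := hcpt.bddAbove_image hcont.continuousOn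
  have h1 := hM (mem_image_of_mem _ (hsub ⟨M, rfl⟩))
  have h2 : (homothetyGL p M).val i i = Real.exp M := by
    simp only [homothetyGL, homothetyMatrix, hi, of_apply, Fin.lastCases_castSucc, if_true]
  beta_reduce at h1
  rw [h2] at h1
  linarith [Real.add_one_le_exp M]

/-- the identity component of Aut(Ω) of a properly convex
quasi-homogeneous affine domain is noncompact. -/
theorem autIdComp_noncompact (n : ℕ) (hn : 1 ≤ n) (Ω : Set (Fin n → ℝ))
    (h1 : IsProperlyConvexDomain n Ω) (h2 : IsQuasiHomogeneous n Ω) :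
    ¬ IsCompact (AutIdComp n Ω) := by
  obtain ⟨⟨hne, ho, hc⟩, hl⟩ := h1
  exact fun hcpt =>
    (isCone_of_isCompact_autIdComp hn hne ho hc hl h2 hcpt).not_isCompact_autIdComp hn hcpt
end
end

section
/- Let Ω be a properly convex quasi-homogeneous affine domain in ℝ². Then Ω is affinely equivalent either to the quadrant {(x,y) ∈ ℝ² | x > 0 and y > 0} or to the parabolic region {(x,y) ∈ ℝ² | y > x²}. -/
open Matrix Set Filter Topology Pointwise

noncomputable section

/-- The symmetric second difference of `f` at `x` with step `h`. -/
def secondDiff (f : ℝ → ℝ) (x h : ℝ) : ℝ := f (x + h) + f (x - h) - 2 * f x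

theorem eq_affine_of_secondDiff_eq_zero {g : ℝ → ℝ} (hg : Continuous g)
    (h0 : ∀ x h, secondDiff g x h = 0) (x : ℝ) : g x = g 0 + x * (g 1 - g 0) := by
  have hadd : ∀ x y, g (x + y) - g 0 = (g x - g 0) + (g y - g 0) := by
    intro x y
    have h1 := h0 ((x + y) / 2) ((x + y) / 2)
    have h2 := h0 ((x + y) / 2) ((x - y) / 2)
    simp only [secondDiff] at h1 h2
    ring_nf at h1 h2 ⊢
    linarith
  let φ : ℝ →+ ℝ := AddMonoidHom.mk' (fun x => g x - g 0) hadd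
  have := map_real_smul φ (show Continuous fun x => g x - g 0 by fun_prop) x 1
  simp only [smul_eq_mul, mul_one, φ, AddMonoidHom.mk'_apply] at this
  linarith

theorem ConvexOn.le_mul_add_mul {I : Set ℝ} {f : ℝ → ℝ} (hf : ConvexOn ℝ I f) {x y : ℝ}
    (hx : x ∈ I) (hy : y ∈ I) {a b : ℝ} (ha : 0 ≤ a) (hb : 0 ≤ b) (hab : a + b = 1) :
    f (a * x + b * y) ≤ a * f x + b * f y :=
  hf.2 hx hy ha hb hab

theorem ConvexOn.collinear_of_secondDiff_eq_zero {I : Set ℝ} {f : ℝ → ℝ} (hf : ConvexOn ℝ I f)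
    {x y z : ℝ}
    (h0 : ∀ h, (x + y) / 2 - h ∈ I → (x + y) / 2 + h ∈ I → secondDiff f ((x + y) / 2) h = 0)
    (hx : x ∈ I) (hy : y ∈ I) (hxz : x < z) (hzy : z < y) :
    (y - x) * f z = (y - z) * f x + (z - x) * f y := by
  have key : ∀ w, x < w → w < y → (y - x) * f w ≤ (y - w) * f x + (w - x) * f y := by
    intro w hw1 hw2
    have hyx : 0 < y - x := by linarith
    have := hf.le_mul_add_mul hx hy (a := (y - w) / (y - x)) (b := (w - x) / (y - x))
      (by apply div_nonneg <;> linarith) (by apply div_nonneg <;> linarith) (by field_simp; ring)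
    have e : (y - w) / (y - x) * x + (w - x) / (y - x) * y = w := by field_simp; ring
    rw [e] at this
    calc (y - x) * f w ≤ (y - x) * ((y - w) / (y - x) * f x + (w - x) / (y - x) * f y) := by gcongr
      _ = _ := by field_simp
  have h1 := key z hxz hzy
  have h2 := key (x + y - z) (by linarith) (by linarith)
  have hI : OrdConnected I := hf.1.ordConnected
  have h3 := h0 ((y - x) / 2) (by ring_nf; exact hx) (by ring_nf; exact hy)
  have h4 := h0 (z - (x + y) / 2)
    (hI.out hx hy ⟨by linarith, by linarith⟩) (hI.out hx hy ⟨by linarith, by linarith⟩)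
  simp only [secondDiff] at h3 h4
  have e1 : (x + y) / 2 + (y - x) / 2 = y := by ring
  have e2 : (x + y) / 2 - (y - x) / 2 = x := by ring
  have e3 : (x + y) / 2 + (z - (x + y) / 2) = z := by ring
  have e4 : (x + y) / 2 - (z - (x + y) / 2) = x + y - z := by ring
  rw [e1, e2] at h3
  rw [e3, e4] at h4
  have h5 : f (x + y - z) = f x + f y - f z := by linarith
  rw [h5] at h2
  apply le_antisymm h1
  nlinarith

theorem ConvexOn.exists_eq_affine_of_secondDiff_eq_zero {I : Set ℝ} {f : ℝ → ℝ}
    (hf : ConvexOn ℝ I f) (hI : IsOpen I) (hne : I.Nonempty)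
    (h0 : ∀ x h, x - h ∈ I → x + h ∈ I → secondDiff f x h = 0) :
    ∃ u w, ∀ x ∈ I, f x = u * x + w := by
  obtain ⟨p, hp⟩ := hne
  obtain ⟨q, hpq, hq⟩ : ∃ q, p < q ∧ q ∈ I := by
    obtain ⟨ε, hε, hb⟩ := Metric.isOpen_iff.1 hI p hp
    refine ⟨p + ε / 2, by linarith, hb ?_⟩
    simp [abs_of_pos hε]
    linarith
  have hpq' : q - p ≠ 0 := by linarith
  have col := fun {x y z} => hf.collinear_of_secondDiff_eq_zero (x := x) (y := y) (z := z) (h0 _)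
  refine ⟨(f q - f p) / (q - p), f p - p * ((f q - f p) / (q - p)), fun x hx => ?_⟩
  rw [← mul_right_inj' hpq']
  have e : (q - p) * ((f q - f p) / (q - p) * x + (f p - p * ((f q - f p) / (q - p)))) =
      (q - x) * f p + (x - p) * f q := by field_simp; ring
  rw [e]
  rcases lt_trichotomy x p with h | rfl | h
  · linarith [col hx hq h hpq]
  · ring
  rcases lt_trichotomy x q with h' | rfl | h'
  · linarith [col hp hq h h']
  · ring
  · linarith [col hp hx hpq h']

theorem secondDiff_mono {f : ℝ → ℝ} (hf : ConvexOn ℝ univ f) (x : ℝ) {h k : ℝ} (h0 : 0 ≤ h)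
    (hk : h ≤ k) : secondDiff f x h ≤ secondDiff f x k := by
  rcases h0.eq_or_lt with rfl | h0
  · have := hf.le_mul_add_mul (mem_univ (x + k)) (mem_univ (x - k)) (a := 1 / 2) (b := 1 / 2)
      (by norm_num) (by norm_num) (by norm_num)
    ring_nf at this
    simp only [secondDiff, add_zero, sub_zero]
    linarith
  have hk0 : 0 < k := by linarith
  have e : ∀ s, k * f (x + s * h) ≤ (k - h) * f x + h * f (x + s * k) := by
    intro s
    have := hf.le_mul_add_mul (mem_univ x) (mem_univ (x + s * k)) (a := (k - h) / k) (b := h / k)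
      (by apply div_nonneg <;> linarith) (by positivity) (by field_simp; ring)
    have e : (k - h) / k * x + h / k * (x + s * k) = x + s * h := by field_simp; ring
    rw [e] at this
    calc k * f (x + s * h) ≤ k * ((k - h) / k * f x + h / k * f (x + s * k)) := by gcongr
      _ = _ := by field_simp
  have h1 := e 1
  have h2 := e (-1)
  have h3 := hf.le_mul_add_mul (mem_univ (x + k)) (mem_univ (x - k)) (a := 1 / 2) (b := 1 / 2)
      (by norm_num) (by norm_num) (by norm_num)
  have e3 : 1 / 2 * (x + k) + 1 / 2 * (x - k) = x := by ring
  rw [e3] at h3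
  simp only [one_mul, neg_mul, ← sub_eq_add_neg] at h1 h2
  have h4 : k * secondDiff f x h ≤ h * secondDiff f x k := by
    simp only [secondDiff]; nlinarith
  have h5 : 0 ≤ secondDiff f x k := by simp only [secondDiff]; linarith
  have : k * secondDiff f x h ≤ k * secondDiff f x k := by nlinarith
  exact le_of_mul_le_mul_left this hk0

/-- The map `y ↦ a * y + c` preserves `I` and multiplies the second differences of `f` by `b`. -/
structure IsScaling (I : Set ℝ) (f : ℝ → ℝ) (a b c : ℝ) : Prop where
  a_pos : 0 < a
  b_pos : 0 < b
  mem_iff : ∀ y, y ∈ I ↔ a * y + c ∈ I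
  secondDiff_eq : ∀ y h, y - h ∈ I → y + h ∈ I →
    secondDiff f (a * y + c) (a * h) = b * secondDiff f y h

theorem IsScaling.secondDiff_eq_inv {I : Set ℝ} {f : ℝ → ℝ} {a b c : ℝ} (hs : IsScaling I f a b c)
    {x h : ℝ} (h1 : x - h ∈ I) (h2 : x + h ∈ I) :
    secondDiff f x h = b * secondDiff f ((x - c) / a) (h / a) := by
  have ha := hs.a_pos.ne'
  have := hs.secondDiff_eq ((x - c) / a) (h / a)
    ((hs.mem_iff _).2 (by convert h1 using 1; field_simp; ring))
    ((hs.mem_iff _).2 (by convert h2 using 1; field_simp; ring))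
  rw [← this]
  congr 1 <;> field_simp
  ring

theorem secondDiff_eq_zero_of_tendsto {I : Set ℝ} {f : ℝ → ℝ} (hI : IsOpen I) (hc : Convex ℝ I)
    (hf : ContinuousOn f I) {a b c : ℕ → ℝ} {a' c' : ℝ} (hs : ∀ n, IsScaling I f (a n) (b n) (c n))
    (ha : Tendsto a atTop (𝓝 a')) (ha' : a' ≠ 0) (hb : Tendsto b atTop (𝓝 0))
    (hc' : Tendsto c atTop (𝓝 c')) {x h : ℝ} (h1 : x - h ∈ I) (h2 : x + h ∈ I)
    (h1' : (x - h - c') / a' ∈ I) (h2' : (x + h - c') / a' ∈ I) :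
    secondDiff f x h = 0 := by
  have hx : (x - c') / a' ∈ I := by
    have := hc h1' h2' (a := 1 / 2) (b := 1 / 2) (by norm_num) (by norm_num) (by norm_num)
    convert this using 1
    simp only [smul_eq_mul]
    field_simp
    ring
  have lim : ∀ y, (y - c') / a' ∈ I →
      Tendsto (fun n => f ((y - c n) / a n)) atTop (𝓝 (f ((y - c') / a'))) := by
    intro y hy
    have hcont := hf.continuousAt (hI.mem_nhds hy)
    exact hcont.tendsto.comp ((tendsto_const_nhds.sub hc').div ha ha')
  have L : Tendsto (fun n => b n * (f ((x + h - c n) / a n) + f ((x - h - c n) / a n)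
      - 2 * f ((x - c n) / a n))) atTop (𝓝 0) := by
    simpa using hb.mul (((lim _ h2').add (lim _ h1')).sub ((lim _ hx).const_mul 2))
  refine tendsto_nhds_unique (Tendsto.congr (fun n => ?_) L) tendsto_const_nhds |>.symm
  rw [(hs n).secondDiff_eq_inv h1 h2, secondDiff]
  congr 5 <;> ring

/-- Every point of `I` can be moved into the compact set `K` by the inverse of a scaling whose
vertical ratio is as small as desired. -/
def IsContracting (I : Set ℝ) (f : ℝ → ℝ) (K : Set ℝ) : Prop :=
  ∀ x ∈ I, ∀ ε > 0, ∃ a b c, IsScaling I f a b c ∧ b ≤ ε ∧ ∃ k ∈ K, x = a * k + c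

theorem IsContracting.exists_seq {I : Set ℝ} {f : ℝ → ℝ} {K : Set ℝ} (h : IsContracting I f K)
    (hK : IsCompact K) {x : ℝ} (hx : x ∈ I) :
    ∃ (a b c k : ℕ → ℝ) (k' : ℝ), k' ∈ K ∧ (∀ n, IsScaling I f (a n) (b n) (c n)) ∧
      Tendsto b atTop (𝓝 0) ∧ Tendsto k atTop (𝓝 k') ∧ (∀ n, k n ∈ K) ∧
      ∀ n, x = a n * k n + c n := by
  choose a b c hs hb k hk hx using fun n : ℕ => h x hx (1 / ((n : ℝ) + 1)) Nat.one_div_pos_of_nat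
  obtain ⟨k', hk', φ, hφ, hlim⟩ := hK.tendsto_subseq hk
  have hb0 : Tendsto b atTop (𝓝 0) := squeeze_zero (fun n => (hs n).b_pos.le) hb
    tendsto_one_div_add_atTop_nhds_zero_nat
  exact ⟨a ∘ φ, b ∘ φ, c ∘ φ, k ∘ φ, k', hk', fun n => hs _, hb0.comp hφ.tendsto_atTop, hlim,
    fun n => hk _, fun n => hx _⟩

theorem IsContracting.secondDiff_eq_zero_of_endpoint {I : Set ℝ} {f : ℝ → ℝ} {K : Set ℝ}
    (h : IsContracting I f K) (hK : IsCompact K) (hKI : K ⊆ I) (hI : IsOpen I) (hc : Convex ℝ I)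
    (hne : I.Nonempty) (hf : ContinuousOn f I) {α : ℝ} (hα : α ∉ I)
    (hfix : ∀ a b c, IsScaling I f a b c → a * α + c = α)
    (hcone : ∀ x ∈ I, ∀ s > 0, α + s * (x - α) ∈ I) {x t : ℝ} (h1 : x - t ∈ I) (h2 : x + t ∈ I) :
    secondDiff f x t = 0 := by
  obtain ⟨x0, hx0⟩ := hne
  obtain ⟨a, b, c, k, k', hk', hs, hb, hk, hkK, hx⟩ := h.exists_seq hK hx0
  have hkα : ∀ z ∈ K, z - α ≠ 0 := fun z hz h0 => hα (by
    rw [sub_eq_zero] at h0; rw [← h0]; exact hKI hz)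
  have ha : ∀ n, a n = (x0 - α) / (k n - α) := by
    intro n
    rw [eq_div_iff (hkα _ (hkK n))]
    linarith [hx n, hfix _ _ _ (hs n)]
  have hc0 : ∀ n, c n = α - a n * α := fun n => by linarith [hfix _ _ _ (hs n)]
  have hta : Tendsto a atTop (𝓝 ((x0 - α) / (k' - α))) := by
    rw [funext ha]
    exact tendsto_const_nhds.div (hk.sub tendsto_const_nhds) (hkα _ hk')
  set a' := (x0 - α) / (k' - α) with ha'
  have ha0 : a' ≠ 0 := div_ne_zero (fun h0 => hα (by
    rw [sub_eq_zero] at h0; rw [← h0]; exact hx0)) (hkα _ hk')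
  have hapos : 0 < a' := lt_of_le_of_ne
    (ge_of_tendsto' hta fun n => (hs n).a_pos.le) ha0.symm
  have htc : Tendsto c atTop (𝓝 (α - a' * α)) := by
    rw [funext hc0]
    exact tendsto_const_nhds.sub (hta.mul_const _)
  refine secondDiff_eq_zero_of_tendsto hI hc hf hs hta ha0 hb htc h1 h2 ?_ ?_
  · convert hcone _ h1 a'⁻¹ (by positivity) using 1; field_simp; ring
  · convert hcone _ h2 a'⁻¹ (by positivity) using 1; field_simp; ring

theorem IsContracting.exists_scaling_ne_one {f : ℝ → ℝ} {K : Set ℝ}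
    (h : IsContracting univ f K) (hK : IsCompact K) (hf : Continuous f)
    (hnz : ∃ x t, secondDiff f x t ≠ 0) : ∃ a b c, IsScaling univ f a b c ∧ a ≠ 1 := by
  by_contra! hone
  obtain ⟨x, t, hxt⟩ := hnz
  obtain ⟨a, b, c, k, k', hk', hs, hb, hk, hkK, hx⟩ := h.exists_seq hK (mem_univ 0)
  have ha : ∀ n, a n = 1 := fun n => hone _ _ _ (hs n)
  have hc : ∀ n, c n = - k n := fun n => by have := hx n; rw [ha] at this; linarith
  refine hxt (secondDiff_eq_zero_of_tendsto (a' := 1) (c' := - k') isOpen_univ convex_univ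
    hf.continuousOn hs ?_ one_ne_zero hb ?_ trivial trivial trivial trivial)
  · rw [funext ha]; exact tendsto_const_nhds
  · rw [funext hc]; exact hk.neg

theorem IsContracting.exists_scaling_not_fix {f : ℝ → ℝ} {K : Set ℝ}
    (h : IsContracting univ f K) (hK : IsCompact K) (hf : ConvexOn ℝ univ f)
    (hnz : ∃ x t, secondDiff f x t ≠ 0) (p : ℝ) : ∃ a b c, IsScaling univ f a b c ∧ a * p + c ≠ p := by
  by_contra! hfix
  obtain ⟨x, t, hxt⟩ := hnz
  obtain ⟨a, b, c, k, k', hk', hs, hb, hk, hkK, hx⟩ := h.exists_seq hK (mem_univ (p + 1))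
  obtain ⟨B, hB⟩ := hK.isBounded.subset_closedBall p
  have hak : ∀ n, a n * (k n - p) = 1 := fun n => by linarith [hx n, hfix _ _ _ (hs n)]
  have hBk : ∀ n, k n - p ≤ B := fun n => by
    have := hB (hkK n)
    rw [Metric.mem_closedBall, Real.dist_eq] at this
    exact (le_abs_self _).trans this
  have hkpos : ∀ n, 0 < k n - p := fun n =>
    pos_of_mul_pos_right (by rw [hak n]; exact one_pos) (hs n).a_pos.le
  have hBpos : 0 < B := (hkpos 0).trans_le (hBk 0)
  have ha : ∀ n, 1 / B ≤ a n := fun n => by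
    rw [div_le_iff₀ hBpos, ← hak n]
    exact mul_le_mul_of_nonneg_left (hBk n) (hs n).a_pos.le
  have zero : ∀ h, 0 ≤ h → secondDiff f p h = 0 := by
    intro h h0
    have hle : ∀ n, secondDiff f p h ≤ b n * secondDiff f p (B * h) := by
      intro n
      have := (hs n).secondDiff_eq p (B * h) trivial trivial
      rw [hfix _ _ _ (hs n)] at this
      rw [← this]
      refine secondDiff_mono hf p h0 ?_
      have : 1 ≤ a n * B := by rw [← div_le_iff₀ hBpos]; exact ha n
      nlinarith
    apply le_antisymm
    · have := ge_of_tendsto' (hb.mul_const (secondDiff f p (B * h))) hle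
      simpa using this
    · have := secondDiff_mono hf p le_rfl h0
      simp only [secondDiff, add_zero, sub_zero] at this ⊢
      linarith
  apply hxt
  -- `f` is affine on `[p - R, p + R]` for `R` large
  set R := |x - p| + |t| + 1 with hR
  have hRt : |x - p| + |t| < R := by rw [hR]; linarith
  have hR0 : 0 < R := by positivity
  have low : ∀ y, p - R < y → y < p + R →
      f y = ((p + R - y) * f (p - R) + (y - (p - R)) * f (p + R)) / (2 * R) := by
    intro y h1 h2
    have := hf.collinear_of_secondDiff_eq_zero (x := p - R) (y := p + R) (z := y)
      (fun r _ _ => ?_) trivial trivial h1 h2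
    · field_simp
      linarith
    · rw [show (p - R + (p + R)) / 2 = p by ring]
      rcases le_total 0 r with hr | hr
      · exact zero _ hr
      · have := zero (-r) (by linarith)
        simp only [secondDiff, ← sub_eq_add_neg, sub_neg_eq_add] at this ⊢
        linarith
  have l1 := abs_le.1 (le_refl |x - p|)
  have l2 := abs_le.1 (le_refl |t|)
  simp only [secondDiff]
  rw [low (x + t) (by linarith) (by linarith), low (x - t) (by linarith) (by linarith),
    low x (by linarith [abs_nonneg t]) (by linarith [abs_nonneg t])]
  ring

theorem exists_quadratic_of_secondDiff_eq {f : ℝ → ℝ} (hf : Continuous f)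
    (h0 : ∀ x h, secondDiff f x h = secondDiff f 0 h) :
    ∃ u v w, ∀ x, f x = u * x ^ 2 + v * x + w := by
  have diff : ∀ s x, f (x + s) - f x = f s - f 0 + x * (f (1 + s) - f 1 - (f s - f 0)) := by
    intro s x
    have := eq_affine_of_secondDiff_eq_zero (g := fun x => f (x + s) - f x) (by fun_prop)
      (fun x h => ?_) x
    · simpa using this
    · have h1 := h0 x h
      have h2 := h0 (x + s) h
      simp only [secondDiff] at h1 h2 ⊢
      rw [show x + h + s = x + s + h by ring, show x - h + s = x + s - h by ring]
      linarith
  have lin : ∀ s, f (1 + s) - f 1 - (f s - f 0) = s * (f (1 + 1) - f 1 - (f 1 - f 0)) := by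
    intro s
    have h1 := diff s 1
    have h2 := diff 1 s
    rw [add_comm s 1] at h2
    linarith
  set A := f (1 + 1) - f 1 - (f 1 - f 0)
  have cross : ∀ s x, f (x + s) - f x = f s - f 0 + x * (s * A) := fun s x => by
    rw [diff, lin]
  have := eq_affine_of_secondDiff_eq_zero (g := fun x => f x - A / 2 * x ^ 2) (by fun_prop)
    (fun x h => ?_)
  · refine ⟨A / 2, f 1 - A / 2 - f 0, f 0, fun x => ?_⟩
    have := this x
    linear_combination this
  · have h1 := cross h x
    have h2 := cross (-h) x
    have h3 := cross h (-h)
    rw [neg_add_cancel] at h3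
    rw [← sub_eq_add_neg] at h2
    simp only [secondDiff]
    linear_combination h1 + h2 - h3

/-- The periods of the second differences of `f`. -/
def secondDiffPeriods (f : ℝ → ℝ) : AddSubgroup ℝ where
  carrier := {τ | ∀ x h, secondDiff f (x + τ) h = secondDiff f x h}
  zero_mem' := by simp
  add_mem' := by
    intro σ τ hσ hτ x h
    rw [← add_assoc, hτ, hσ]
  neg_mem' := by
    intro τ hτ x h
    rw [← hτ (x + -τ), neg_add_cancel_right]

theorem IsScaling.eq_about {f : ℝ → ℝ} {a b c p : ℝ} (hs : IsScaling univ f a b c) (y h : ℝ) :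
    secondDiff f (p + (a * y + (a * p + c - p))) (a * h) = b * secondDiff f (p + y) h := by
  rw [← hs.secondDiff_eq (p + y) h trivial trivial]
  congr 1
  ring

theorem dense_secondDiffPeriods {f : ℝ → ℝ} {a b c a' b' c' p : ℝ}
    (hs : IsScaling univ f a b c) (hs' : IsScaling univ f a' b' c') (ha : a ≠ 1)
    (hp : a * p + c = p) (hp' : a' * p + c' ≠ p) :
    Dense (secondDiffPeriods f : Set ℝ) := by
  have E := fun y h => hs.eq_about (p := p) y h
  simp only [hp, sub_self, add_zero] at E
  have E' := fun y h => hs'.eq_about (p := p) y h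
  have ha0 := hs.a_pos
  have ha0' := hs'.a_pos
  set d := a' * p + c' - p with hd
  have hd0 : d ≠ 0 := sub_ne_zero.2 hp'
  have mem0 : (a - 1) * d ∈ secondDiffPeriods f := by
    intro x h
    have h1 := E (a' * ((x - p - d) / (a * a')) + d) (a' * (h / (a * a')))
    have h2 := E' (a * ((x - p - d) / (a * a'))) (a * (h / (a * a')))
    rw [E'] at h1
    rw [E] at h2
    have e1 : p + a * (a' * ((x - p - d) / (a * a')) + d) = x + (a - 1) * d := by field_simp; ring
    have e2 : p + (a' * (a * ((x - p - d) / (a * a'))) + d) = x := by field_simp; ring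
    have e3 : a * (a' * (h / (a * a'))) = h := by field_simp
    have e4 : a' * (a * (h / (a * a'))) = h := by field_simp
    rw [e1, e3] at h1
    rw [e2, e4] at h2
    rw [h1, h2]
    ring
  have mul_mem : ∀ τ ∈ secondDiffPeriods f, a * τ ∈ secondDiffPeriods f := by
    intro τ hτ x h
    have h1 := E ((x - p) / a + τ) (h / a)
    have h2 := E ((x - p) / a) (h / a)
    rw [← add_assoc, hτ, ← h2] at h1
    have e1 : p + a * ((x - p) / a + τ) = x + a * τ := by field_simp; ring
    have e2 : p + a * ((x - p) / a) = x := by field_simp; ring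
    have e3 : a * (h / a) = h := by field_simp
    rwa [e1, e2, e3] at h1
  have inv_mem : ∀ τ ∈ secondDiffPeriods f, a⁻¹ * τ ∈ secondDiffPeriods f := by
    intro τ hτ x h
    have h1 := E (x - p + a⁻¹ * τ) h
    have h2 := E (x - p) h
    have e1 : p + a * (x - p + a⁻¹ * τ) = p + a * (x - p) + τ := by field_simp; ring
    rw [e1, hτ, h2] at h1
    have := mul_left_cancel₀ hs.b_pos.ne' h1
    rw [show p + (x - p) = x by ring, show p + (x - p + a⁻¹ * τ) = x + a⁻¹ * τ by ring] at this
    exact this.symm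
  obtain ⟨q, hq0, hq1, hq⟩ : ∃ q : ℝ, 0 < q ∧ q < 1 ∧
      ∀ τ ∈ secondDiffPeriods f, q * τ ∈ secondDiffPeriods f := by
    rcases lt_or_gt_of_ne ha with h | h
    · exact ⟨a, ha0, h, mul_mem⟩
    · exact ⟨a⁻¹, inv_pos.2 ha0, inv_lt_one_of_one_lt₀ h, inv_mem⟩
  have mem1 : |(a - 1) * d| ∈ secondDiffPeriods f := by
    rcases abs_choice ((a - 1) * d) with h | h <;> rw [h]
    · exact mem0
    · exact neg_mem mem0
  have pos1 : 0 < |(a - 1) * d| := abs_pos.2 (mul_ne_zero (sub_ne_zero.2 ha) hd0)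
  have memn : ∀ n : ℕ, q ^ n * |(a - 1) * d| ∈ secondDiffPeriods f := by
    intro n
    induction n with
    | zero => simpa using mem1
    | succ n ih => rw [pow_succ', mul_assoc]; exact hq _ ih
  refine AddSubgroup.dense_of_not_isolated_zero _ fun ε hε => ?_
  obtain ⟨n, hn⟩ := exists_pow_lt_of_lt_one (div_pos hε pos1) hq1
  exact ⟨_, memn n, by positivity, by rwa [lt_div_iff₀ pos1] at hn⟩

theorem IsContracting.exists_quadratic {f : ℝ → ℝ} {K : Set ℝ} (h : IsContracting univ f K)
    (hK : IsCompact K) (hf : ConvexOn ℝ univ f) :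
    ∃ u v w, ∀ x, f x = u * x ^ 2 + v * x + w := by
  have hcont : Continuous f := continuousOn_univ.1 (hf.continuousOn isOpen_univ)
  apply exists_quadratic_of_secondDiff_eq hcont
  by_cases hnz : ∃ x t, secondDiff f x t ≠ 0
  · obtain ⟨a, b, c, hs, ha⟩ := h.exists_scaling_ne_one hK hcont hnz
    obtain ⟨a', b', c', hs', hp'⟩ := h.exists_scaling_not_fix hK hf hnz (c / (1 - a))
    have ha' : 1 - a ≠ 0 := sub_ne_zero.2 ha.symm
    have hd := dense_secondDiffPeriods hs hs' ha (p := c / (1 - a)) (by field_simp; ring) hp'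
    intro x t
    have hc : IsClosed {y | secondDiff f y t = secondDiff f 0 t} := by
      apply isClosed_eq <;> unfold secondDiff <;> fun_prop
    refine hc.closure_subset_iff.2 (fun y hy => ?_) (hd x)
    have := hy 0 t
    rwa [zero_add] at this
  · push Not at hnz
    intro x t
    rw [hnz, hnz]

theorem IsScaling.fix_of_isGLB {I : Set ℝ} {f : ℝ → ℝ} {a b c α : ℝ} (hs : IsScaling I f a b c)
    (hα : IsGLB I α) : a * α + c = α := by
  have ha := hs.a_pos
  apply le_antisymm
  · refine hα.2 fun z hz => ?_
    have h1 : (z - c) / a ∈ I := (hs.mem_iff _).2 (by convert hz using 1; field_simp; ring)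
    have := hα.1 h1
    rw [le_div_iff₀ ha] at this
    linarith
  · have : (α - c) / a ≤ α := hα.2 fun y hy => by
      have := hα.1 ((hs.mem_iff y).1 hy)
      rw [div_le_iff₀ ha]
      linarith
    rw [div_le_iff₀ ha] at this
    linarith

theorem IsScaling.fix_of_isLUB {I : Set ℝ} {f : ℝ → ℝ} {a b c α : ℝ} (hs : IsScaling I f a b c)
    (hα : IsLUB I α) : a * α + c = α := by
  have ha := hs.a_pos
  apply le_antisymm
  · have : α ≤ (α - c) / a := hα.2 fun y hy => by
      have := hα.1 ((hs.mem_iff y).1 hy)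
      rw [le_div_iff₀ ha]
      linarith
    rw [le_div_iff₀ ha] at this
    linarith
  · refine hα.2 fun z hz => ?_
    have h1 : (z - c) / a ∈ I := (hs.mem_iff _).2 (by convert hz using 1; field_simp; ring)
    have := hα.1 h1
    rw [div_le_iff₀ ha] at this
    linarith

/-- A contracting convex function is affine on a half-line or quadratic on the whole line. -/
theorem IsContracting.classification {I : Set ℝ} {f : ℝ → ℝ} {K : Set ℝ}
    (h : IsContracting I f K) (hK : IsCompact K) (hKI : K ⊆ I) (hI : IsOpen I)
    (hne : I.Nonempty) (hf : ConvexOn ℝ I f) :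
    (∃ α u w, I = Ioi α ∧ ∀ x ∈ I, f x = u * x + w) ∨
      (∃ α u w, I = Iio α ∧ ∀ x ∈ I, f x = u * x + w) ∨
      (I = univ ∧ ∃ u v w, ∀ x, f x = u * x ^ 2 + v * x + w) := by
  have hc := hf.1
  have hpc : IsPreconnected I := hc.isPreconnected
  have hcont := hf.continuousOn hI
  by_cases hb : BddBelow I <;> by_cases ha : BddAbove I
  · exfalso
    have hKeq : I ⊆ K := by
      intro x hx
      obtain ⟨a, b, c, hs, -, k, hk, rfl⟩ := h x hx 1 one_pos
      have h1 := hs.fix_of_isGLB (isGLB_csInf hne hb)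
      have h2 := hs.fix_of_isLUB (isLUB_csSup hne ha)
      have h3 : sInf I < sSup I := by
        obtain ⟨ε, hε, hball⟩ := Metric.isOpen_iff.1 hI _ hx
        refine (csInf_le hb hx).trans_lt (lt_of_lt_of_le (lt_add_of_pos_right _ (half_pos hε))
          (le_csSup ha (hball ?_)))
        simp [abs_of_pos hε]
        linarith
      have ha1 : a = 1 := by
        have : (a - 1) * (sSup I - sInf I) = 0 := by linear_combination h2 - h1
        rcases mul_eq_zero.1 this with h | h <;> linarith
      have hc0 : c = 0 := by rw [ha1] at h1; linarith
      rw [ha1, hc0]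
      simpa using hk
    have hcl : IsClopen I := ⟨(Subset.antisymm hKI hKeq ▸ hK).isClosed, hI⟩
    rcases isClopen_iff.1 hcl with h0 | h0
    · exact hne.ne_empty h0
    · rw [h0] at hb
      exact not_bddBelow_univ hb
  · left
    have hglb := isGLB_csInf hne hb
    have hα : sInf I ∉ I := fun hmem => by
      obtain ⟨ε, hε, hball⟩ := Metric.isOpen_iff.1 hI _ hmem
      have := csInf_le hb (hball (a := sInf I - ε / 2) (by simp [abs_of_pos hε]; linarith))
      linarith
    have hIoi : I = Ioi (sInf I) := Subset.antisymm
      (fun x hx => lt_of_le_of_ne (hglb.1 hx) fun h0 => hα (h0 ▸ hx)) (hpc.Ioi_csInf_subset hb ha)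
    obtain ⟨u, w, huw⟩ := hf.exists_eq_affine_of_secondDiff_eq_zero hI hne fun x t =>
      h.secondDiff_eq_zero_of_endpoint hK hKI hI hc hne hcont hα
        (fun a b c hs => hs.fix_of_isGLB hglb) (fun x hx s hs => by
          have hx : sInf I < x := by rw [hIoi] at hx; exact hx
          refine (Set.ext_iff.1 hIoi _).2 (mem_Ioi.2 ?_)
          have := mul_pos hs (sub_pos.2 hx)
          linarith)
    exact ⟨_, u, w, hIoi, huw⟩
  · right; left
    have hlub := isLUB_csSup hne ha
    have hα : sSup I ∉ I := fun hmem => by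
      obtain ⟨ε, hε, hball⟩ := Metric.isOpen_iff.1 hI _ hmem
      have := le_csSup ha (hball (a := sSup I + ε / 2) (by simp [abs_of_pos hε]; linarith))
      linarith
    have hIio : I = Iio (sSup I) := Subset.antisymm
      (fun x hx => lt_of_le_of_ne (hlub.1 hx) fun h0 => hα (h0 ▸ hx)) (hpc.Iio_csSup_subset hb ha)
    obtain ⟨u, w, huw⟩ := hf.exists_eq_affine_of_secondDiff_eq_zero hI hne fun x t =>
      h.secondDiff_eq_zero_of_endpoint hK hKI hI hc hne hcont hα
        (fun a b c hs => hs.fix_of_isLUB hlub) (fun x hx s hs => by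
          have hx : x < sSup I := by rw [hIio] at hx; exact hx
          refine (Set.ext_iff.1 hIio _).2 (mem_Iio.2 ?_)
          have := mul_pos hs (sub_pos.2 hx)
          linarith)
    exact ⟨_, u, w, hIio, huw⟩
  · right; right
    obtain rfl := hpc.eq_univ_of_unbounded hb ha
    exact ⟨rfl, h.exists_quadratic hK hf⟩

theorem convexOn_of_convex_strict_epigraph {I : Set ℝ} {f : ℝ → ℝ}
    (h : Convex ℝ {p : ℝ × ℝ | p.1 ∈ I ∧ f p.1 < p.2}) : ConvexOn ℝ I f := by
  have key : ∀ ⦃x⦄, x ∈ I → ∀ ⦃y⦄, y ∈ I → ∀ ⦃a b : ℝ⦄, 0 ≤ a → 0 ≤ b → a + b = 1 → ∀ ε > 0,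
      a • x + b • y ∈ I ∧ f (a • x + b • y) < a • f x + b • f y + ε := by
    intro x hx y hy a b ha hb hab ε hε
    have := h (x := (x, f x + ε)) ⟨hx, by simpa⟩ (y := (y, f y + ε)) ⟨hy, by simpa⟩ ha hb hab
    refine ⟨this.1, this.2.trans_eq ?_⟩
    simp only [Prod.snd_add, Prod.smul_snd, smul_eq_mul]
    linear_combination ε * hab
  exact ⟨fun x hx y hy a b ha hb hab => (key hx hy ha hb hab 1 one_pos).1,
    fun x hx y hy a b ha hb hab => le_of_forall_pos_le_add fun ε hε =>
      (key hx hy ha hb hab ε hε).2.le⟩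

/-- The function whose strict epigraph is a planar set that is stable under upward translation. -/
def lowerBoundary (Ω : Set (ℝ × ℝ)) (x : ℝ) : ℝ := sInf {y | (x, y) ∈ Ω}

theorem mem_iff_lowerBoundary_lt {Ω : Set (ℝ × ℝ)} (ho : IsOpen Ω)
    (hline : ∀ p ∈ Ω, ∀ v : ℝ × ℝ, v ≠ 0 → ∃ t : ℝ, p + t • v ∉ Ω)
    (hup : ∀ x y t, (x, y) ∈ Ω → 0 ≤ t → (x, y + t) ∈ Ω) (x y : ℝ) :
    (x, y) ∈ Ω ↔ x ∈ Prod.fst '' Ω ∧ lowerBoundary Ω x < y := by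
  constructor
  · intro h
    refine ⟨⟨_, h, rfl⟩, ?_⟩
    have hbdd : BddBelow {y | (x, y) ∈ Ω} := by
      obtain ⟨t, ht⟩ := hline _ h (0, 1) (by simp)
      refine ⟨y + t, fun z hz => ?_⟩
      by_contra! hlt
      apply ht
      have := hup x z (y + t - z) hz (by linarith)
      simpa using this
    have hopen : IsOpen {y | (x, y) ∈ Ω} := ho.preimage (by fun_prop : Continuous fun y => (x, y))
    obtain ⟨ε, hε, hball⟩ := Metric.isOpen_iff.1 hopen y h
    have := csInf_le hbdd (hball (a := y - ε / 2) (by simp [abs_of_pos hε]; linarith))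
    unfold lowerBoundary
    linarith
  · rintro ⟨⟨⟨x, z⟩, hz, rfl⟩, hlt⟩
    obtain ⟨w, hw, hwy⟩ := exists_lt_of_csInf_lt ⟨z, hz⟩ hlt
    have := hup _ _ (y - w) hw (by linarith)
    simpa using this

theorem triangular_classification {Ω : Set (ℝ × ℝ)} (hne : Ω.Nonempty) (ho : IsOpen Ω)
    (hconv : Convex ℝ Ω) (hline : ∀ p ∈ Ω, ∀ v : ℝ × ℝ, v ≠ 0 → ∃ t : ℝ, p + t • v ∉ Ω)
    (hup : ∀ x y t, (x, y) ∈ Ω → 0 ≤ t → (x, y + t) ∈ Ω) {K : Set (ℝ × ℝ)} (hK : IsCompact K)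
    (hKΩ : K ⊆ Ω) (hqh : ∀ p ∈ Ω, ∃ a b c d e : ℝ, 0 < a ∧ 0 < b ∧
      (∀ x y, (x, y) ∈ Ω ↔ (a * x + c, b * y + d * x + e) ∈ Ω) ∧
      ∃ k ∈ K, p = (a * k.1 + c, b * k.2 + d * k.1 + e)) :
    (∃ α u w : ℝ, Ω = {p | α < p.1 ∧ u * p.1 + w < p.2}) ∨
      (∃ α u w : ℝ, Ω = {p | p.1 < α ∧ u * p.1 + w < p.2}) ∨
      (∃ u v w : ℝ, 0 < u ∧ Ω = {p | u * p.1 ^ 2 + v * p.1 + w < p.2}) := by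
  have hmem := mem_iff_lowerBoundary_lt ho hline hup
  set I := Prod.fst '' Ω with hIdef
  set f := lowerBoundary Ω
  have hΩ : Ω = {p | p.1 ∈ I ∧ f p.1 < p.2} := by ext ⟨x, y⟩; exact hmem x y
  have hI : IsOpen I := isOpenMap_fst _ ho
  have hf : ConvexOn ℝ I f := convexOn_of_convex_strict_epigraph (hΩ ▸ hconv)
  have hKne : K.Nonempty := by
    obtain ⟨p, hp⟩ := hne
    obtain ⟨-, -, -, -, -, -, -, -, k, hk, -⟩ := hqh p hp
    exact ⟨k, hk⟩
  have hcontK : ContinuousOn (fun k : ℝ × ℝ => k.2 - f k.1) K :=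
    continuous_snd.continuousOn.sub
      ((hf.continuousOn hI).comp continuous_fst.continuousOn fun k hk => ⟨k, hKΩ hk, rfl⟩)
  obtain ⟨k₀, hk₀, hmin⟩ := hK.exists_isMinOn hKne hcontK
  set m := k₀.2 - f k₀.1
  have hm : 0 < m := sub_pos.2 ((hmem k₀.1 k₀.2).1 (hKΩ hk₀)).2
  have hcontr : IsContracting I f (Prod.fst '' K) := by
    intro x hx ε hε
    have hp : (x, f x + m * ε) ∈ Ω := (hmem _ _).2 ⟨hx, by linarith [mul_pos hm hε]⟩
    obtain ⟨a, b, c, d, e, ha, hb, hg, k, hk, heq⟩ := hqh _ hp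
    have hmemI : ∀ y, y ∈ I ↔ a * y + c ∈ I := by
      intro y
      constructor
      · rintro ⟨⟨y, z⟩, hz, rfl⟩
        exact ⟨_, (hg _ _).1 hz, rfl⟩
      · rintro ⟨⟨y', z⟩, hz, h0⟩
        refine ⟨(y, (z - d * y - e) / b), (hg _ _).2 ?_, rfl⟩
        simp only at h0
        rw [← h0]
        convert hz using 2
        field_simp
        ring
    have hfg : ∀ y ∈ I, f (a * y + c) = b * f y + d * y + e := by
      intro y hy
      refine eq_of_forall_gt_iff fun z => ?_
      have h1 := hg y ((z - d * y - e) / b)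
      rw [show b * ((z - d * y - e) / b) + d * y + e = z by field_simp; ring, hmem, hmem,
        and_iff_right hy, and_iff_right ((hmemI y).1 hy), lt_div_iff₀ hb] at h1
      rw [← h1]
      constructor <;> intro <;> linarith
    refine ⟨a, b, c, ⟨ha, hb, hmemI, fun y h h1 h2 => ?_⟩, ?_, k.1, ⟨k, hk, rfl⟩,
      congrArg Prod.fst heq⟩
    · have h3 : y ∈ I := by
        have := convex_iff_forall_pos.1 hf.1 h1 h2 (one_half_pos (α := ℝ)) one_half_pos
          (by norm_num)
        convert this using 1
        simp only [smul_eq_mul]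
        ring
      have e1 := hfg _ h1
      have e2 := hfg _ h2
      simp only [secondDiff]
      rw [show a * y + c + a * h = a * (y + h) + c by ring,
        show a * y + c - a * h = a * (y - h) + c by ring, e1, e2, hfg y h3]
      ring
    · have h1 : x = a * k.1 + c := congrArg Prod.fst heq
      have h2 : f x + m * ε = b * k.2 + d * k.1 + e := congrArg Prod.snd heq
      rw [h1, hfg _ ⟨k, hKΩ hk, rfl⟩] at h2
      have h3 : m ≤ k.2 - f k.1 := hmin hk
      have h4 : b * m ≤ ε * m := by nlinarith
      exact le_of_mul_le_mul_right h4 hm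
  have hKI : Prod.fst '' K ⊆ I := image_mono hKΩ
  rcases hcontr.classification (hK.image continuous_fst) hKI hI (hne.image _) hf with
    ⟨α, u, w, hIα, hfx⟩ | ⟨α, u, w, hIα, hfx⟩ | ⟨hIα, u, v, w, hfx⟩
  · left
    refine ⟨α, u, w, ?_⟩
    ext ⟨x, y⟩
    rw [hmem]
    constructor
    · rintro ⟨h1, h2⟩
      rw [hfx x h1] at h2
      rw [hIα] at h1
      exact ⟨h1, h2⟩
    · rintro ⟨h1, h2⟩
      have h3 : x ∈ I := hIα ▸ h1
      exact ⟨h3, by rw [hfx x h3]; exact h2⟩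
  · right; left
    refine ⟨α, u, w, ?_⟩
    ext ⟨x, y⟩
    rw [hmem]
    constructor
    · rintro ⟨h1, h2⟩
      rw [hfx x h1] at h2
      rw [hIα] at h1
      exact ⟨h1, h2⟩
    · rintro ⟨h1, h2⟩
      have h3 : x ∈ I := hIα ▸ h1
      exact ⟨h3, by rw [hfx x h3]; exact h2⟩
  · right; right
    have hΩ' : ∀ x y, (x, y) ∈ Ω ↔ u * x ^ 2 + v * x + w < y := by
      intro x y
      rw [hmem, hIα, hfx]
      simp
    refine ⟨u, v, w, ?_, ?_⟩
    · by_contra! hu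
      have h1 : ∀ t : ℝ, (0, w + 1) + t • (1, v) ∈ Ω := by
        intro t
        have : (t, w + 1 + t * v) ∈ Ω := by
          rw [hΩ']
          nlinarith [sq_nonneg t]
        simpa using this
      obtain ⟨t, ht⟩ := hline (0, w + 1) ((hΩ' _ _).2 (by simp)) (1, v) (by simp)
      exact ht (h1 t)
    · ext ⟨x, y⟩
      exact hΩ' x y

/-- A nonempty open convex set without lines on which the affine automorphisms act cocompactly. -/
structure IsQuasiHomogeneousDomain {V : Type*} [NormedAddCommGroup V] [NormedSpace ℝ V]
    (Ω : Set V) : Prop where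
  nonempty : Ω.Nonempty
  isOpen : IsOpen Ω
  convex : Convex ℝ Ω
  exists_notMem : ∀ p ∈ Ω, ∀ v ≠ 0, ∃ t : ℝ, p + t • v ∉ Ω
  cocompact : ∃ K, IsCompact K ∧ K ⊆ Ω ∧
    ∀ p ∈ Ω, ∃ g : V ≃ᵃ[ℝ] V, g '' Ω = Ω ∧ ∃ k ∈ K, g k = p

namespace IsQuasiHomogeneousDomain

variable {V W : Type*} [NormedAddCommGroup V] [NormedSpace ℝ V]
  [NormedAddCommGroup W] [NormedSpace ℝ W] {Ω : Set V}

theorem image [FiniteDimensional ℝ V] [FiniteDimensional ℝ W] (h : IsQuasiHomogeneousDomain Ω)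
    (e : V ≃ᵃ[ℝ] W) : IsQuasiHomogeneousDomain (e '' Ω) where
  nonempty := h.nonempty.image _
  isOpen := (AffineEquiv.toContinuousAffineEquiv e).toHomeomorph.isOpenMap _ h.isOpen
  convex := h.convex.affine_image e.toAffineMap
  exists_notMem := by
    rintro _ ⟨p, hp, rfl⟩ v hv
    obtain ⟨t, ht⟩ := h.exists_notMem p hp (e.linear.symm v) (by simpa using hv)
    refine ⟨t, fun hmem => ht ?_⟩
    rw [← e.injective.mem_set_image]
    convert hmem using 1
    rw [add_comm p, ← vadd_eq_add, e.map_vadd]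
    simp [add_comm]
  cocompact := by
    obtain ⟨K, hK, hKΩ, hg⟩ := h.cocompact
    refine ⟨e '' K, hK.image (AffineEquiv.toContinuousAffineEquiv e).toHomeomorph.continuous, image_mono hKΩ, ?_⟩
    rintro _ ⟨p, hp, rfl⟩
    obtain ⟨g, hgΩ, k, hk, rfl⟩ := hg p hp
    refine ⟨e.symm.trans (g.trans e), ?_, e k, mem_image_of_mem _ hk, by simp⟩
    simp only [AffineEquiv.coe_trans, image_comp]
    rw [← image_comp e.symm e]
    simp [hgΩ]

theorem not_isBounded [FiniteDimensional ℝ V] [Nontrivial V] (h : IsQuasiHomogeneousDomain Ω) :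
    ¬ Bornology.IsBounded Ω := by
  intro hb
  obtain ⟨x₀, hx₀⟩ := h.nonempty
  obtain ⟨r, hr, hball⟩ := Metric.isOpen_iff.1 h.isOpen x₀ hx₀
  obtain ⟨D, hD⟩ := Metric.isBounded_iff.1 hb
  obtain ⟨K, hK, hKΩ, hg⟩ := h.cocompact
  obtain ⟨δ, hδ, hthick⟩ := hK.exists_thickening_subset_open h.isOpen hKΩ
  have hD0 : 0 ≤ D := dist_nonneg.trans (hD hx₀ hx₀)
  have bound : ∀ g : V ≃ᵃ[ℝ] V, g '' Ω = Ω → ∀ v, ‖g.linear v‖ * (r / 2) ≤ D * ‖v‖ := by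
    intro g hgΩ v
    rcases eq_or_ne v 0 with rfl | hv
    · simp
    have hv' : 0 < ‖v‖ := norm_pos_iff.2 hv
    have hmem : ((r / 2) / ‖v‖) • v + x₀ ∈ Ω := hball (by
      rw [mem_ball_iff_norm, add_sub_cancel_right, norm_smul, norm_div, norm_norm,
        div_mul_cancel₀ _ hv'.ne', Real.norm_of_nonneg (by positivity)]
      linarith)
    have h1 := hD (hgΩ ▸ mem_image_of_mem g hmem) (hgΩ ▸ mem_image_of_mem g hx₀)
    rw [← vadd_eq_add, g.map_vadd, vadd_eq_add, dist_eq_norm, add_sub_cancel_right, map_smul,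
      norm_smul, norm_div, norm_norm, Real.norm_of_nonneg (by positivity), div_mul_eq_mul_div,
      div_le_iff₀ hv'] at h1
    linarith
  have hunif : ∃ ρ > 0, ∀ p ∈ Ω, Metric.ball p ρ ⊆ Ω := by
    refine ⟨δ * (r / 2) / (D + 1), by positivity, fun p hp q hq => ?_⟩
    obtain ⟨g, hgΩ, k, hk, rfl⟩ := hg p hp
    have hgΩ' : g.symm '' Ω = Ω := by
      conv_lhs => rw [← hgΩ]
      simp [← image_comp]
    have h1 := bound g.symm hgΩ' (q - g k)
    have h2 : g.symm.linear (q - g k) = g.symm q - k := by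
      have := g.symm.map_vadd (g k) (q - g k)
      simp only [vadd_eq_add, sub_add_cancel, AffineEquiv.symm_apply_apply] at this
      rw [this, add_sub_cancel_right]
    rw [h2] at h1
    rw [mem_ball_iff_norm, lt_div_iff₀ (by positivity)] at hq
    have h3 : ‖g.symm q - k‖ < δ := by
      refine lt_of_mul_lt_mul_right (h1.trans_lt ?_) (by positivity : 0 ≤ r / 2)
      nlinarith [norm_nonneg (q - g k)]
    have h4 : g.symm q ∈ Ω :=
      hthick (Metric.mem_thickening_iff.2 ⟨k, hk, by rwa [dist_eq_norm]⟩)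
    have := mem_image_of_mem g h4
    rwa [hgΩ, g.apply_symm_apply] at this
  obtain ⟨ρ, hρ, hsub⟩ := hunif
  have hclosed : IsClosed Ω := by
    refine isClosed_of_closure_subset fun q hq => ?_
    obtain ⟨p, hp, hpq⟩ := Metric.mem_closure_iff.1 hq ρ hρ
    exact hsub p hp hpq
  rcases isClopen_iff.1 ⟨hclosed, h.isOpen⟩ with h0 | h0
  · exact h.nonempty.ne_empty h0
  · obtain ⟨v, hv⟩ := exists_ne (0 : V)
    obtain ⟨t, ht⟩ := h.exists_notMem x₀ hx₀ v hv
    exact ht (h0 ▸ mem_univ _)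

theorem mem_asymptoticCone_iff_forall (h : IsQuasiHomogeneousDomain Ω) {v : V} :
    v ∈ asymptoticCone ℝ Ω ↔ ∀ x ∈ Ω, ∀ t : ℝ, 0 ≤ t → x + t • v ∈ Ω := by
  constructor
  · intro hv x hx t ht
    have := h.convex.smul_vadd_mem_of_mem_nhds_of_mem_asymptoticCone ht (h.isOpen.mem_nhds hx) hv
    rwa [vadd_eq_add, add_comm] at this
  · intro hv
    obtain ⟨x, hx⟩ := h.nonempty
    rw [mem_asymptoticCone_iff]
    refine tendsto_id.atTop_smul_const_tendsto_asymptoticNhds v |>.asymptoticNhds_vadd_const x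
      |>.frequently (Eventually.frequently ?_)
    filter_upwards [eventually_ge_atTop 0] with t ht
    have := hv x hx t ht
    rwa [add_comm] at this

theorem eq_zero_of_neg_mem (h : IsQuasiHomogeneousDomain Ω) {v : V}
    (hv : v ∈ asymptoticCone ℝ Ω) (hv' : -v ∈ asymptoticCone ℝ Ω) : v = 0 := by
  by_contra h0
  obtain ⟨x, hx⟩ := h.nonempty
  obtain ⟨t, ht⟩ := h.exists_notMem x hx v h0
  rcases le_total 0 t with h1 | h1
  · exact ht (h.mem_asymptoticCone_iff_forall.1 hv x hx t h1)
  · have := h.mem_asymptoticCone_iff_forall.1 hv' x hx (-t) (by linarith)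
    rw [neg_smul_neg] at this
    exact ht this

theorem map_mem_asymptoticCone [FiniteDimensional ℝ V] [FiniteDimensional ℝ W]
    (h : IsQuasiHomogeneousDomain Ω) (e : V ≃ᵃ[ℝ] W) {v : V}
    (hv : v ∈ asymptoticCone ℝ Ω) : e.linear v ∈ asymptoticCone ℝ (e '' Ω) := by
  rw [(h.image e).mem_asymptoticCone_iff_forall]
  rintro _ ⟨x, hx, rfl⟩ t ht
  refine ⟨x + t • v, h.mem_asymptoticCone_iff_forall.1 hv x hx t ht, ?_⟩
  rw [add_comm x, ← vadd_eq_add, e.map_vadd]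
  simp [add_comm]

end IsQuasiHomogeneousDomain

/-- The determinant of a pair of planar vectors. -/
def planeDet (u w : ℝ × ℝ) : ℝ := u.1 * w.2 - u.2 * w.1

/-- `e` spans an extremal ray of the planar cone `C`. -/
structure IsExtremalDirection (C : Set (ℝ × ℝ)) (e : ℝ × ℝ) : Prop where
  mem : e ∈ C
  ne_zero : e ≠ 0
  sign : (∀ w ∈ C, 0 ≤ planeDet e w) ∨ ∀ w ∈ C, planeDet e w ≤ 0

theorem map_eq_add (L : ℝ × ℝ →ₗ[ℝ] ℝ × ℝ) (u : ℝ × ℝ) :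
    L u = u.1 • L (1, 0) + u.2 • L (0, 1) := by
  rw [← map_smul, ← map_smul, ← map_add]
  simp

theorem planeDet_map (L : ℝ × ℝ →ₗ[ℝ] ℝ × ℝ) (u w : ℝ × ℝ) :
    planeDet (L u) (L w) = planeDet (L (1, 0)) (L (0, 1)) * planeDet u w := by
  rw [map_eq_add L u, map_eq_add L w]
  simp only [planeDet, Prod.fst_add, Prod.snd_add, Prod.smul_fst, Prod.smul_snd, smul_eq_mul]
  ring

theorem planeDet_map_ne_zero (L : (ℝ × ℝ) ≃ₗ[ℝ] ℝ × ℝ) :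
    planeDet (L (1, 0)) (L (0, 1)) ≠ 0 := by
  intro h0
  have := planeDet_map L.toLinearMap (L.symm (1, 0)) (L.symm (0, 1))
  simp only [LinearEquiv.coe_coe, LinearEquiv.apply_symm_apply, h0] at this
  simp [planeDet] at this

theorem exists_isExtremalDirection {C : Set (ℝ × ℝ)} (hcl : IsClosed C) (hconv : Convex ℝ C)
    (hsmul : ∀ s : ℝ, 0 ≤ s → ∀ v ∈ C, s • v ∈ C) (hpt : ∀ v ∈ C, -v ∈ C → v = 0)
    (hne : ∃ v ∈ C, v ≠ 0) : ∃ e, IsExtremalDirection C e := by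
  obtain ⟨v₀, hv₀, hv₀0⟩ := hne
  obtain ⟨φ, s, hs, hφ⟩ := geometric_hahn_banach_point_closed hconv hcl
    (fun h => hv₀0 (hpt v₀ hv₀ h) : -v₀ ∉ C)
  have h0C : (0 : ℝ × ℝ) ∈ C := by simpa using hsmul 0 le_rfl v₀ hv₀
  have hs0 : s < 0 := by simpa using hφ 0 h0C
  have hnonneg : ∀ w ∈ C, 0 ≤ φ w := by
    intro w hw
    by_contra! hneg
    have := hφ _ (hsmul (s / φ w) (div_nonneg_of_nonpos hs0.le hneg.le) w hw)
    rw [map_smul, smul_eq_mul, div_mul_cancel₀ _ hneg.ne] at this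
    exact lt_irrefl _ this
  have hv₀pos : 0 < φ v₀ := by
    rw [map_neg] at hs
    linarith
  set α := φ (1, 0)
  set β := φ (0, 1)
  have hφe : ∀ w, φ w = α * w.1 + β * w.2 := by
    intro w
    have : w = w.1 • ((1, 0) : ℝ × ℝ) + w.2 • ((0, 1) : ℝ × ℝ) := by simp
    conv_lhs => rw [this]
    rw [map_add, map_smul, map_smul, smul_eq_mul, smul_eq_mul, mul_comm α, mul_comm β]
  set μ : ℝ × ℝ → ℝ := fun w => α * w.2 - β * w.1
  have hN : 0 < α ^ 2 + β ^ 2 := by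
    by_contra! hN
    have hα : α = 0 := by nlinarith [sq_nonneg α, sq_nonneg β]
    have hβ : β = 0 := by nlinarith [sq_nonneg α, sq_nonneg β]
    rw [hφe, hα, hβ] at hv₀pos
    simp at hv₀pos
  have hid : ∀ u w, (α ^ 2 + β ^ 2) * planeDet u w = φ u * μ w - μ u * φ w := by
    intro u w
    rw [hφe, hφe]
    simp only [planeDet, μ]
    ring
  by_cases hex : ∃ u ∈ C, u ≠ 0 ∧ φ u = 0
  · obtain ⟨u, hu, hu0, hφu⟩ := hex
    refine ⟨u, hu, hu0, ?_⟩
    rcases le_total (μ u) 0 with h | h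
    · left
      intro w hw
      refine nonneg_of_mul_nonneg_right ?_ hN
      rw [hid, hφu]
      nlinarith [hnonneg w hw]
    · right
      intro w hw
      refine nonpos_of_mul_nonpos_right ?_ hN
      rw [hid, hφu]
      nlinarith [hnonneg w hw]
  · push Not at hex
    have hpos : ∀ w ∈ C, w ≠ 0 → 0 < φ w := fun w hw hw0 =>
      lt_of_le_of_ne (hnonneg w hw) (hex w hw hw0).symm
    have hne0 : ∀ w ∈ C ∩ Metric.sphere 0 1, w ≠ 0 := fun w hw h0 => by
      have := hw.2
      rw [h0] at this
      simp at this
    have hcomp : IsCompact (C ∩ Metric.sphere 0 1) := (isCompact_sphere _ _).inter_left hcl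
    have hunit : ∀ w ∈ C, w ≠ 0 → ‖w‖⁻¹ • w ∈ C ∩ Metric.sphere 0 1 := fun w hw hw0 =>
      ⟨hsmul _ (by positivity) w hw, by
        rw [mem_sphere_zero_iff_norm, norm_smul, norm_inv, norm_norm,
          inv_mul_cancel₀ (norm_ne_zero_iff.2 hw0)]⟩
    have hcont : ContinuousOn (fun w => μ w / φ w) (C ∩ Metric.sphere 0 1) :=
      ContinuousOn.div (by fun_prop) (by fun_prop) fun w hw => (hpos w hw.1 (hne0 w hw)).ne'
    obtain ⟨e, he, hmin⟩ := hcomp.exists_isMinOn ⟨_, hunit v₀ hv₀ hv₀0⟩ hcont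
    refine ⟨e, he.1, hne0 e he, Or.inl fun w hw => ?_⟩
    rcases eq_or_ne w 0 with rfl | hw0
    · simp [planeDet]
    have h1 : μ e / φ e ≤ μ (‖w‖⁻¹ • w) / φ (‖w‖⁻¹ • w) := hmin (hunit w hw hw0)
    have h2 : μ (‖w‖⁻¹ • w) = ‖w‖⁻¹ * μ w := by
      simp only [μ, Prod.smul_fst, Prod.smul_snd, smul_eq_mul]
      ring
    rw [h2, map_smul, smul_eq_mul, mul_div_mul_left _ _ (inv_ne_zero (norm_ne_zero_iff.2 hw0)),
      div_le_div_iff₀ (hpos e he.1 (hne0 e he)) (hpos w hw hw0)] at h1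
    refine nonneg_of_mul_nonneg_right ?_ hN
    rw [hid]
    linarith

theorem IsExtremalDirection.map {C C' : Set (ℝ × ℝ)} {e : ℝ × ℝ} (he : IsExtremalDirection C e)
    (L : (ℝ × ℝ) ≃ₗ[ℝ] ℝ × ℝ) (hmem : L e ∈ C') (hC : ∀ w ∈ C', L.symm w ∈ C) :
    IsExtremalDirection C' (L e) where
  mem := hmem
  ne_zero := by simpa using he.ne_zero
  sign := by
    have key : ∀ w, planeDet (L e) w =
        planeDet (L (1, 0)) (L (0, 1)) * planeDet e (L.symm w) := fun w => by
      have := planeDet_map L.toLinearMap e (L.symm w)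
      simpa using this
    simp only [key]
    rcases le_total 0 (planeDet (L (1, 0)) (L (0, 1))) with h | h <;> rcases he.sign with hs | hs
    · exact .inl fun w hw => mul_nonneg h (hs _ (hC w hw))
    · exact .inr fun w hw => mul_nonpos_of_nonneg_of_nonpos h (hs _ (hC w hw))
    · exact .inr fun w hw => mul_nonpos_of_nonpos_of_nonneg h (hs _ (hC w hw))
    · exact .inl fun w hw => mul_nonneg_of_nonpos_of_nonpos h (hs _ (hC w hw))

theorem IsExtremalDirection.planeDet_map_self {C : Set (ℝ × ℝ)} {e : ℝ × ℝ}
    (he : IsExtremalDirection C e) (L : (ℝ × ℝ) ≃ₗ[ℝ] ℝ × ℝ)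
    (hdet : 0 < planeDet (L (1, 0)) (L (0, 1))) (hC : ∀ w ∈ C, L w ∈ C)
    (hC' : ∀ w ∈ C, L.symm w ∈ C) : planeDet e (L e) = 0 := by
  have h1 := planeDet_map L.toLinearMap e (L.symm e)
  simp only [LinearEquiv.coe_coe, LinearEquiv.apply_symm_apply] at h1
  have h2 : planeDet (L e) e = - planeDet e (L e) := by simp only [planeDet]; ring
  rw [h2] at h1
  rcases he.sign with hs | hs
  · have h3 := hs _ (hC e he.mem)
    have h4 := mul_nonneg hdet.le (hs _ (hC' e he.mem))
    linarith
  · have h3 := hs _ (hC e he.mem)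
    have h4 := mul_nonpos_of_nonneg_of_nonpos hdet.le (hs _ (hC' e he.mem))
    linarith

namespace IsQuasiHomogeneousDomain

theorem exists_oriented {Ω : Set (ℝ × ℝ)} (h : IsQuasiHomogeneousDomain Ω) :
    ∃ K, IsCompact K ∧ K ⊆ Ω ∧ ∀ p ∈ Ω, ∃ g : (ℝ × ℝ) ≃ᵃ[ℝ] ℝ × ℝ, g '' Ω = Ω ∧
      0 < planeDet (g.linear (1, 0)) (g.linear (0, 1)) ∧ ∃ k ∈ K, g k = p := by
  obtain ⟨K, hK, hKΩ, hg⟩ := h.cocompact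
  by_cases hneg : ∃ g₀ : (ℝ × ℝ) ≃ᵃ[ℝ] ℝ × ℝ, g₀ '' Ω = Ω ∧
      planeDet (g₀.linear (1, 0)) (g₀.linear (0, 1)) < 0
  · obtain ⟨g₀, hg₀, hdet₀⟩ := hneg
    refine ⟨K ∪ g₀.symm '' K, hK.union
      (hK.image (AffineEquiv.toContinuousAffineEquiv g₀.symm).continuous),
      union_subset hKΩ ?_, fun p hp => ?_⟩
    · rintro _ ⟨k, hk, rfl⟩
      rw [← g₀.injective.mem_set_image, hg₀, g₀.apply_symm_apply]
      exact hKΩ hk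
    · obtain ⟨g, hgΩ, k, hk, rfl⟩ := hg p hp
      rcases lt_or_gt_of_ne (planeDet_map_ne_zero g.linear) with hdet | hdet
      · refine ⟨g₀.trans g, ?_, ?_, g₀.symm k, Or.inr (mem_image_of_mem _ hk), by simp⟩
        · rw [AffineEquiv.coe_trans, image_comp, hg₀, hgΩ]
        · have := planeDet_map g.linear.toLinearMap (g₀.linear (1, 0)) (g₀.linear (0, 1))
          simp only [LinearEquiv.coe_coe] at this
          change 0 < planeDet (g.linear (g₀.linear (1, 0))) (g.linear (g₀.linear (0, 1)))
          rw [this]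
          exact mul_pos_of_neg_of_neg hdet hdet₀
      · exact ⟨g, hgΩ, hdet, k, Or.inl hk, rfl⟩
  · push Not at hneg
    refine ⟨K, hK, hKΩ, fun p hp => ?_⟩
    obtain ⟨g, hgΩ, hk⟩ := hg p hp
    exact ⟨g, hgΩ, lt_of_le_of_ne (hneg g hgΩ) (planeDet_map_ne_zero g.linear).symm, hk⟩

theorem eq_of_isExtremalDirection {Ω : Set (ℝ × ℝ)} (h : IsQuasiHomogeneousDomain Ω)
    (he : IsExtremalDirection (asymptoticCone ℝ Ω) (0, 1)) :
    (∃ α u w : ℝ, Ω = {p | α < p.1 ∧ u * p.1 + w < p.2}) ∨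
    (∃ α u w : ℝ, Ω = {p | p.1 < α ∧ u * p.1 + w < p.2}) ∨
    (∃ u v w : ℝ, 0 < u ∧ Ω = {p | u * p.1 ^ 2 + v * p.1 + w < p.2}) := by
  obtain ⟨K, hK, hKΩ, hg⟩ := h.exists_oriented
  refine triangular_classification h.nonempty h.isOpen h.convex h.exists_notMem
    (fun x y t hxy ht => ?_) hK hKΩ fun p hp => ?_
  · simpa using h.mem_asymptoticCone_iff_forall.1 he.mem _ hxy t ht
  obtain ⟨g, hgΩ, hdet, k, hk, rfl⟩ := hg p hp
  have hgΩ' : g.symm '' Ω = Ω := by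
    conv_lhs => rw [← hgΩ]
    simp [← image_comp]
  have hL : ∀ w ∈ asymptoticCone ℝ Ω, g.linear w ∈ asymptoticCone ℝ Ω := fun w hw => by
    simpa only [hgΩ] using h.map_mem_asymptoticCone g hw
  have hL' : ∀ w ∈ asymptoticCone ℝ Ω, g.linear.symm w ∈ asymptoticCone ℝ Ω := fun w hw => by
    have := h.map_mem_asymptoticCone g.symm hw
    rwa [hgΩ'] at this
  have h0 := he.planeDet_map_self g.linear hdet hL hL'
  obtain ⟨a, d, had⟩ : ∃ a d, g.linear (1, 0) = (a, d) := ⟨_, _, rfl⟩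
  obtain ⟨b', b, hb⟩ : ∃ b' b, g.linear (0, 1) = (b', b) := ⟨_, _, rfl⟩
  obtain ⟨c, e, hce⟩ : ∃ c e, g 0 = (c, e) := ⟨_, _, rfl⟩
  rw [hb] at h0
  simp only [planeDet, zero_mul, one_mul, zero_sub, neg_eq_zero] at h0
  subst h0
  rw [had, hb] at hdet
  simp only [planeDet, mul_zero, sub_zero] at hdet
  have hb0 : 0 < b := by
    by_contra! hb0
    have hb1 : b < 0 := lt_of_le_of_ne hb0 fun h => by simp [h] at hdet
    have h1 := smul_mem_asymptoticCone (k := ℝ) (c := (-b)⁻¹) (by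
      rw [inv_nonneg]; linarith) (hL _ he.mem)
    rw [hb] at h1
    refine he.ne_zero (h.eq_zero_of_neg_mem he.mem ?_)
    convert h1 using 1
    ext
    · simp
    · simp [inv_neg, hb1.ne]
  have hgf : ∀ x y, g (x, y) = (a * x + c, b * y + d * x + e) := fun x y => by
    have h1 := g.map_vadd 0 (x, y)
    have h2 := map_eq_add g.linear.toLinearMap (x, y)
    simp only [LinearEquiv.coe_coe] at h2
    rw [vadd_eq_add, add_zero, h2, had, hb, hce] at h1
    rw [h1]
    ext
    · simp [mul_comm]
    · simp only [Prod.smul_mk, smul_eq_mul, mul_zero, Prod.mk_add_mk, vadd_eq_add]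
      ring
  refine ⟨a, b, c, d, e, pos_of_mul_pos_left hdet hb0.le, hb0, fun x y => ?_, k, hk, hgf _ _⟩
  rw [← hgf, ← g.injective.mem_set_image, hgΩ]

end IsQuasiHomogeneousDomain

/-- The planar affine equivalence `(x, y) ↦ (a x + c, b y + d x + e)`. -/
def triangularEquiv (a b c d e : ℝ) (ha : a ≠ 0) (hb : b ≠ 0) : (ℝ × ℝ) ≃ᵃ[ℝ] ℝ × ℝ :=
  .trans (LinearEquiv.toAffineEquiv
    { toFun := fun p => (a * p.1, b * p.2 + d * p.1)
      map_add' := fun p q => by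
        ext <;> simp only [Prod.fst_add, Prod.snd_add] <;> ring
      map_smul' := fun s p => by
        ext <;> simp only [Prod.smul_fst, Prod.smul_snd, smul_eq_mul, RingHom.id_apply] <;> ring
      invFun := fun p => (p.1 / a, (p.2 - d * (p.1 / a)) / b)
      left_inv := fun p => by
        ext <;> field_simp
        ring
      right_inv := fun p => by
        ext <;> field_simp
        ring })
    (AffineEquiv.constVAdd ℝ (ℝ × ℝ) (c, e))

theorem triangularEquiv_apply {a b : ℝ} (c d e : ℝ) (ha : a ≠ 0) (hb : b ≠ 0) (p : ℝ × ℝ) :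
    triangularEquiv a b c d e ha hb p = (a * p.1 + c, b * p.2 + d * p.1 + e) := by
  ext <;> simp [triangularEquiv, add_comm]

theorem IsQuasiHomogeneousDomain.exists_image_eq {Ω : Set (ℝ × ℝ)}
    (h : IsQuasiHomogeneousDomain Ω) : ∃ g : (ℝ × ℝ) ≃ᵃ[ℝ] ℝ × ℝ,
      g '' Ω = {p | 0 < p.1 ∧ 0 < p.2} ∨ g '' Ω = {p | p.1 ^ 2 < p.2} := by
  obtain ⟨v, hv0, hv⟩ := not_bounded_iff_exists_ne_zero_mem_asymptoticCone.1 h.not_isBounded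
  obtain ⟨e, he⟩ := exists_isExtremalDirection isClosed_asymptoticCone h.convex.asymptoticCone
    (fun s hs v hv => smul_mem_asymptoticCone hs hv) (fun v => h.eq_zero_of_neg_mem) ⟨v, hv, hv0⟩
  have hn : e.1 ^ 2 + e.2 ^ 2 ≠ 0 := fun h0 => he.ne_zero <| by
    ext
    · exact pow_eq_zero_iff two_ne_zero |>.1 (by nlinarith [sq_nonneg e.1, sq_nonneg e.2])
    · exact pow_eq_zero_iff two_ne_zero |>.1 (by nlinarith [sq_nonneg e.1, sq_nonneg e.2])
  let T : (ℝ × ℝ) ≃ₗ[ℝ] ℝ × ℝ :=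
    { toFun := fun p => (e.2 * p.1 - e.1 * p.2, (e.1 * p.1 + e.2 * p.2) / (e.1 ^ 2 + e.2 ^ 2))
      map_add' := fun p q => by
        ext <;> simp only [Prod.fst_add, Prod.snd_add] <;> ring
      map_smul' := fun s p => by
        ext <;> simp only [Prod.smul_fst, Prod.smul_snd, smul_eq_mul, RingHom.id_apply] <;> ring
      invFun := fun p => (e.2 * p.1 / (e.1 ^ 2 + e.2 ^ 2) + e.1 * p.2,
        -e.1 * p.1 / (e.1 ^ 2 + e.2 ^ 2) + e.2 * p.2)
      left_inv := fun p => by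
        ext <;> field_simp <;> ring
      right_inv := fun p => by
        ext <;> field_simp <;> ring }
  have hTe : T e = (0, 1) := by
    ext
    · change e.2 * e.1 - e.1 * e.2 = 0
      ring
    · change (e.1 * e.1 + e.2 * e.2) / (e.1 ^ 2 + e.2 ^ 2) = 1
      field_simp
  have hTΩ := h.image T.toAffineEquiv
  have heT := he.map T (C' := asymptoticCone ℝ (T.toAffineEquiv '' Ω))
    (h.map_mem_asymptoticCone T.toAffineEquiv he.mem) fun w hw => by
      have := hTΩ.map_mem_asymptoticCone T.toAffineEquiv.symm hw
      rwa [← image_comp, ← AffineEquiv.coe_trans, AffineEquiv.self_trans_symm,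
        AffineEquiv.coe_refl, image_id] at this
  rw [hTe] at heT
  suffices hS : ∃ g : (ℝ × ℝ) ≃ᵃ[ℝ] ℝ × ℝ,
      T.toAffineEquiv '' Ω = g ⁻¹' {p | 0 < p.1 ∧ 0 < p.2} ∨
        T.toAffineEquiv '' Ω = g ⁻¹' {p | p.1 ^ 2 < p.2} by
    obtain ⟨g, hg⟩ := hS
    refine ⟨T.toAffineEquiv.trans g, ?_⟩
    simp only [AffineEquiv.coe_trans, image_comp]
    exact hg.imp (fun h => by rw [h, image_preimage_eq _ g.surjective])
      fun h => by rw [h, image_preimage_eq _ g.surjective]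
  rcases hTΩ.eq_of_isExtremalDirection heT with ⟨α, u, w, hu⟩ | ⟨α, u, w, hu⟩ | ⟨u, v, w, hu0, hu⟩
  · refine ⟨triangularEquiv 1 1 (-α) (-u) (-w) one_ne_zero one_ne_zero, Or.inl ?_⟩
    rw [hu]
    ext p
    simp only [mem_preimage, mem_ofPred_eq, triangularEquiv_apply]
    constructor <;> rintro ⟨h1, h2⟩ <;> constructor <;> linarith
  · refine ⟨triangularEquiv (-1) 1 α (-u) (-w) (by norm_num) one_ne_zero, Or.inl ?_⟩
    rw [hu]
    ext p
    simp only [mem_preimage, mem_ofPred_eq, triangularEquiv_apply]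
    constructor <;> rintro ⟨h1, h2⟩ <;> constructor <;> linarith
  · refine ⟨triangularEquiv √u 1 0 (-v) (-w) (by positivity) one_ne_zero, Or.inr ?_⟩
    rw [hu]
    ext p
    simp only [mem_preimage, mem_ofPred_eq, triangularEquiv_apply, add_zero, mul_pow,
      Real.sq_sqrt hu0.le]
    constructor <;> intro h1 <;> linarith

/-- A matrix in affine form acts on `ℝⁿ` by an affine equivalence. -/
theorem exists_affineEquiv_eq_affAct {n : ℕ} {g : GL (Fin (n + 1)) ℝ} (hg : IsAffineForm n g) :
    ∃ e : (Fin n → ℝ) ≃ᵃ[ℝ] (Fin n → ℝ), ⇑e = affAct n g := by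
  set A : Matrix (Fin n) (Fin n) ℝ := of fun i j => g.val i.castSucc j.castSucc
  have hA : Function.Injective A.mulVecLin := by
    rw [injective_iff_map_eq_zero]
    intro v hv
    have h0 : g.val *ᵥ (Fin.snoc v 0 : Fin (n + 1) → ℝ) = 0 := by
      ext i
      refine Fin.lastCases ?_ (fun i => ?_) i
      · simp [mulVec, dotProduct, Fin.sum_univ_castSucc, hg.1]
      · simpa [mulVec, dotProduct, Fin.sum_univ_castSucc, A] using congrFun hv i
    have h1 : (Fin.snoc v 0 : Fin (n + 1) → ℝ) = 0 := by
      have := congrArg (g⁻¹.val *ᵥ ·) h0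
      simpa [mulVec_mulVec, ← Units.val_mul] using this
    ext i
    simpa using congrFun h1 i.castSucc
  refine ⟨(LinearEquiv.ofInjectiveEndo A.mulVecLin hA).toAffineEquiv.trans
    (AffineEquiv.constVAdd ℝ _ fun i => g.val i.castSucc (Fin.last n)), ?_⟩
  ext x i
  simp [affAct, mulVec, dotProduct, A, add_comm]

theorem IsQuasiHomogeneous.isQuasiHomogeneousDomain {n : ℕ} {Ω : Set (Fin n → ℝ)}
    (h2 : IsQuasiHomogeneous n Ω) (h1 : IsProperlyConvexDomain n Ω) :
    IsQuasiHomogeneousDomain Ω where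
  nonempty := h1.1.1
  isOpen := h1.1.2.1
  convex := h1.1.2.2
  exists_notMem := by
    intro p hp v hv
    by_contra! hall
    exact h1.2 ⟨p, hp, v, hv, hall⟩
  cocompact := by
    obtain ⟨K, hK, hKΩ, hcov⟩ := h2
    refine ⟨K, hK, hKΩ, fun p hp => ?_⟩
    rw [← hcov] at hp
    simp only [mem_iUnion] at hp
    obtain ⟨g, hg, hgp⟩ := hp
    obtain ⟨e, he⟩ := exists_affineEquiv_eq_affAct hg.1
    exact ⟨e, he ▸ hg.2, by rwa [he]⟩

/-- a properly convex quasi-homogeneous affine domain in ℝ² is affinely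
equivalent to the quadrant or to the parabolic region. -/
theorem dim2_classification (Ω : Set (Fin 2 → ℝ))
    (h1 : IsProperlyConvexDomain 2 Ω) (h2 : IsQuasiHomogeneous 2 Ω) :
    AffinelyEquivalent 2 Ω {x : Fin 2 → ℝ | 0 < x 0 ∧ 0 < x 1} ∨
      AffinelyEquivalent 2 Ω {x : Fin 2 → ℝ | x 0 ^ 2 < x 1} := by
  set φ := (LinearEquiv.finTwoArrow ℝ ℝ).toAffineEquiv
  obtain ⟨g, hg⟩ := ((h2.isQuasiHomogeneousDomain h1).image φ).exists_image_eq
  have key : ∀ S : Set (ℝ × ℝ), g '' (φ '' Ω) = S →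
      (φ.trans (g.trans φ.symm)) '' Ω = φ ⁻¹' S := fun S hS => by
    rw [← hS, AffineEquiv.coe_trans, AffineEquiv.coe_trans, image_comp, image_comp]
    exact φ.toEquiv.symm.image_eq_preimage_symm _
  exact hg.imp (fun h => ⟨_, key _ h⟩) fun h => ⟨_, key _ h⟩
end
end
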